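/- arXiv:math/0205106 — 5 statements merged into one kernel-verified Lean document; each statement's English description precedes it below -/
import Mathlib

section
/- Let D be the open unit disk in ℝ², let H : closure(D) × ℝ³ × (ℝ³ × ℝ³) → ℝ be continuous, and let v : closure(D) → ℝ³ be twice continuously differentiable up to the boundary and satisfy Δv(ξ) = H(ξ, v(ξ), (v_x(ξ), v_y(ξ))) · (v_x(ξ) ∧ v_y(ξ)) for every ξ ∈ D, together with v = 0 on ∂D. Then the outward normal derivative of v vanishes on ∂D: for every ξ = (x,y) with x² + y² = 1 one has x·v_x(ξ) + y·v_y(ξ) = 0. -/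
noncomputable section

/-- Cross product on ℝ³. -/
def cross3 (u v : Fin 3 → ℝ) : Fin 3 → ℝ :=
  ![u 1 * v 2 - u 2 * v 1, u 2 * v 0 - u 0 * v 2, u 0 * v 1 - u 1 * v 0]

/-- Partial derivative in the first coordinate, taken within a set `s`. -/
def pdxW {E : Type*} [NormedAddCommGroup E] [NormedSpace ℝ E] (f : ℝ × ℝ → E)
    (s : Set (ℝ × ℝ)) (p : ℝ × ℝ) : E :=
  fderivWithin ℝ f s p (1, 0)

/-- Partial derivative in the second coordinate, taken within a set `s`. -/
def pdyW {E : Type*} [NormedAddCommGroup E] [NormedSpace ℝ E] (f : ℝ × ℝ → E)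
    (s : Set (ℝ × ℝ)) (p : ℝ × ℝ) : E :=
  fderivWithin ℝ f s p (0, 1)

/-- Componentwise Laplacian Δf = f_xx + f_yy, with derivatives taken within `s`. -/
def lapW {E : Type*} [NormedAddCommGroup E] [NormedSpace ℝ E] (f : ℝ × ℝ → E)
    (s : Set (ℝ × ℝ)) (p : ℝ × ℝ) : E :=
  pdxW (fun q => pdxW f s q) s p + pdyW (fun q => pdyW f s q) s p

/-- The open unit disk in ℝ². -/
def unitDisk : Set (ℝ × ℝ) := {p : ℝ × ℝ | p.1 ^ 2 + p.2 ^ 2 < 1}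

/-- The closed unit disk in ℝ². -/
def closedUnitDisk : Set (ℝ × ℝ) := {p : ℝ × ℝ | p.1 ^ 2 + p.2 ^ 2 ≤ 1}

open Complex Metric in
/-- A holomorphic function on the unit disc that vanishes at the center and has nonnegative real
part on the unit circle has vanishing real part on the unit circle. -/
theorem re_eq_zero_on_circle_of_nonneg {F : ℂ → ℂ} (hF : DiffContOnCl ℂ F (ball 0 1))
    (h0 : F 0 = 0) (hre : ∀ z ∈ sphere (0 : ℂ) 1, 0 ≤ (F z).re) :
    ∀ z ∈ sphere (0 : ℂ) 1, (F z).re = 0 := by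
  have hg : DiffContOnCl ℂ (fun z => Complex.exp (-F z)) (ball 0 1) :=
    Complex.differentiable_exp.comp_diffContOnCl hF.neg
  have hmax : IsMaxOn (norm ∘ fun z => Complex.exp (-F z)) (ball 0 1) 0 := by
    intro w hw
    have := norm_le_of_forall_mem_frontier_norm_le isBounded_ball hg (C := 1) (z := w)
      (by
        intro z hz
        rw [frontier_ball (0 : ℂ) one_ne_zero] at hz
        simpa [Complex.norm_exp] using hre z hz)
      (subset_closure hw)
    simpa [h0] using this
  intro z hz
  have := norm_eqOn_closedBall_of_isMaxOn hg hmax (sphere_subset_closedBall hz)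
  simpa [h0, Complex.norm_exp] using this

theorem convex_closedUnitDisk : Convex ℝ closedUnitDisk := by
  intro p hp q hq a b ha hb hab
  simp only [closedUnitDisk, Set.mem_ofPred_eq, Prod.fst_add, Prod.snd_add, Prod.smul_fst,
    Prod.smul_snd, smul_eq_mul] at *
  obtain rfl : b = 1 - a := by linarith
  nlinarith [mul_nonneg ha hb, mul_nonneg (mul_nonneg ha hb) (sq_nonneg (p.1 - q.1)),
    mul_nonneg (mul_nonneg ha hb) (sq_nonneg (p.2 - q.2)), mul_le_mul_of_nonneg_left hp ha,
    mul_le_mul_of_nonneg_left hq hb]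

theorem isOpen_unitDisk : IsOpen unitDisk :=
  isOpen_lt (by fun_prop) continuous_const

theorem unitDisk_subset_closedUnitDisk : unitDisk ⊆ closedUnitDisk :=
  fun _ hp => le_of_lt (Set.mem_ofPred_eq ▸ hp)

theorem closedUnitDisk_mem_nhds {p : ℝ × ℝ} (hp : p ∈ unitDisk) : closedUnitDisk ∈ nhds p :=
  Filter.mem_of_superset (isOpen_unitDisk.mem_nhds hp) unitDisk_subset_closedUnitDisk

theorem uniqueDiffOn_closedUnitDisk : UniqueDiffOn ℝ closedUnitDisk :=
  uniqueDiffOn_convex convex_closedUnitDisk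
    ⟨0, mem_interior_iff_mem_nhds.2 (closedUnitDisk_mem_nhds (by simp [unitDisk]))⟩

/-- The linear map sending a differential `A` to the `i`-th component of `A e₁ - i A e₂`. -/
def conjGradCLM (i : Fin 3) : ((ℝ × ℝ) →L[ℝ] (Fin 3 → ℝ)) →L[ℝ] ℂ :=
  Complex.ofRealCLM.comp ((ContinuousLinearMap.proj (φ := fun _ : Fin 3 => ℝ) i).comp
      (ContinuousLinearMap.apply ℝ (Fin 3 → ℝ) ((1, 0) : ℝ × ℝ))) -
    Complex.I • Complex.ofRealCLM.comp ((ContinuousLinearMap.proj (φ := fun _ : Fin 3 => ℝ) i).comp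
      (ContinuousLinearMap.apply ℝ (Fin 3 → ℝ) ((0, 1) : ℝ × ℝ)))

theorem conjGradCLM_apply (i : Fin 3) (A : (ℝ × ℝ) →L[ℝ] (Fin 3 → ℝ)) :
    conjGradCLM i A = (A (1, 0) i : ℂ) - Complex.I * (A (0, 1) i : ℂ) := by
  simp [conjGradCLM]

/-- The Hopf differential `|vₓ|² - |v_y|² - 2i vₓ·v_y` of `v`, multiplied by `z²`. -/
def hopfFun (v : ℝ × ℝ → Fin 3 → ℝ) (z : ℂ) : ℂ :=
  z ^ 2 * ∑ i, conjGradCLM i (fderivWithin ℝ v closedUnitDisk (Complex.equivRealProdCLM z)) ^ 2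

theorem equivRealProdCLM_mem_closedUnitDisk {z : ℂ} (hz : z ∈ Metric.closedBall (0 : ℂ) 1) :
    Complex.equivRealProdCLM z ∈ closedUnitDisk := by
  rw [mem_closedBall_zero_iff, ← sq_le_one_iff₀ (norm_nonneg z), Complex.sq_norm,
    Complex.normSq_apply] at hz
  simpa [closedUnitDisk, sq] using hz

theorem equivRealProdCLM_mem_unitDisk {z : ℂ} (hz : z ∈ Metric.ball (0 : ℂ) 1) :
    Complex.equivRealProdCLM z ∈ unitDisk := by
  rw [mem_ball_zero_iff, ← sq_lt_one_iff₀ (norm_nonneg z), Complex.sq_norm,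
    Complex.normSq_apply] at hz
  simpa [unitDisk, sq] using hz

theorem continuousOn_hopfFun {v : ℝ × ℝ → Fin 3 → ℝ} (hv : ContDiffOn ℝ 2 v closedUnitDisk) :
    ContinuousOn (hopfFun v) (Metric.closedBall 0 1) := by
  have hA : ContinuousOn
      (fun z : ℂ => fderivWithin ℝ v closedUnitDisk (Complex.equivRealProdCLM z))
      (Metric.closedBall 0 1) :=
    (hv.continuousOn_fderivWithin uniqueDiffOn_closedUnitDisk (by norm_num)).comp
      Complex.equivRealProdCLM.continuous.continuousOn
      fun _ hz => equivRealProdCLM_mem_closedUnitDisk hz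
  exact (continuousOn_id.pow 2).mul (continuousOn_finsetSum _ fun i _ =>
    ((conjGradCLM i).continuous.comp_continuousOn hA).pow 2)

/-- At interior points, the second derivative of a `C²` map is symmetric and its trace is the
Laplacian. -/
theorem exists_hasFDerivAt_fderivWithin {v : ℝ × ℝ → Fin 3 → ℝ}
    (hv : ContDiffOn ℝ 2 v closedUnitDisk) {p : ℝ × ℝ} (hp : p ∈ unitDisk) :
    ∃ T : (ℝ × ℝ) →L[ℝ] (ℝ × ℝ) →L[ℝ] (Fin 3 → ℝ),
      HasFDerivAt (fderivWithin ℝ v closedUnitDisk) T p ∧ T (1, 0) (0, 1) = T (0, 1) (1, 0) ∧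
        lapW v closedUnitDisk p = T (1, 0) (1, 0) + T (0, 1) (0, 1) := by
  have hpK := unitDisk_subset_closedUnitDisk hp
  have hN := closedUnitDisk_mem_nhds hp
  have hA : DifferentiableWithinAt ℝ (fderivWithin ℝ v closedUnitDisk) closedUnitDisk p :=
    ((hv.fderivWithin uniqueDiffOn_closedUnitDisk (m := 1) (by norm_num)).differentiableOn
      one_ne_zero) p hpK
  have hsymm : IsSymmSndFDerivWithinAt ℝ v closedUnitDisk p :=
    (hv p hpK).isSymmSndFDerivWithinAt (by simp) uniqueDiffOn_closedUnitDisk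
      (subset_closure (mem_interior_iff_mem_nhds.2 hN)) hpK
  have key (u : ℝ × ℝ) :
      fderivWithin ℝ (fun q => fderivWithin ℝ v closedUnitDisk q u) closedUnitDisk p u =
        fderivWithin ℝ (fderivWithin ℝ v closedUnitDisk) closedUnitDisk p u u := by
    have h := ((ContinuousLinearMap.apply ℝ (Fin 3 → ℝ) u).hasFDerivAt.comp_hasFDerivWithinAt p
      hA.hasFDerivWithinAt).fderivWithin (uniqueDiffOn_closedUnitDisk p hpK)
    exact DFunLike.congr_fun h u
  exact ⟨_, hA.hasFDerivWithinAt.hasFDerivAt hN, hsymm _ _,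
    congrArg₂ (· + ·) (key (1, 0)) (key (0, 1))⟩

theorem differentiableAt_hopfFun {v : ℝ × ℝ → Fin 3 → ℝ} (hv : ContDiffOn ℝ 2 v closedUnitDisk)
    {z : ℂ} (hz : z ∈ Metric.ball (0 : ℂ) 1) {c : ℝ}
    (hc : lapW v closedUnitDisk (Complex.equivRealProdCLM z) =
      c • cross3 (pdxW v closedUnitDisk (Complex.equivRealProdCLM z))
        (pdyW v closedUnitDisk (Complex.equivRealProdCLM z))) :
    DifferentiableAt ℂ (hopfFun v) z := by
  obtain ⟨T, hT, hsymm, hlap⟩ :=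
    exists_hasFDerivAt_fderivWithin hv (equivRealProdCLM_mem_unitDisk hz)
  rw [hlap] at hc
  set e := Complex.equivRealProdCLM
  set A := fderivWithin ℝ v closedUnitDisk
  have hW (i : Fin 3) : HasFDerivAt (fun w : ℂ => conjGradCLM i (A (e w)))
      ((conjGradCLM i).comp (T.comp (e : ℂ →L[ℝ] ℝ × ℝ))) z :=
    (conjGradCLM i).hasFDerivAt.comp z (hT.comp z e.hasFDerivAt)
  have hS := HasFDerivAt.fun_sum (u := Finset.univ) fun i _ => (hW i).pow 2
  refine (differentiableAt_id.pow 2).mul ?_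
  refine differentiableAt_complex_iff_differentiableAt_real.2 ⟨hS.differentiableAt, ?_⟩
  have he1 : e 1 = (1, 0) := by simp [e]
  have heI : e Complex.I = (0, 1) := by simp [e]
  have hc' (i : Fin 3) : ((T (1, 0) (1, 0) i : ℝ) : ℂ) = ((c • cross3 (A (e z) (1, 0))
      (A (e z) (0, 1))) i - T (0, 1) (0, 1) i : ℝ) := by
    rw [eq_sub_of_add_eq hc]; rfl
  rw [hS.fderiv]
  simp only [Fin.sum_univ_three, add_apply, smul_apply,
    ContinuousLinearMap.comp_apply, ContinuousLinearEquiv.coe_coe, he1, heI, conjGradCLM_apply,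
    hsymm, smul_eq_mul, hc']
  simp [cross3]
  ring_nf
  simp only [Complex.I_sq, Complex.I_pow_three]
  ring

/-- If `v` vanishes on the unit circle, then so does its tangential derivative there. -/
theorem tangential_derivative_eq_zero {v : ℝ × ℝ → Fin 3 → ℝ}
    (hv : ContDiffOn ℝ 2 v closedUnitDisk)
    (hbc : ∀ ξ : ℝ × ℝ, ξ.1 ^ 2 + ξ.2 ^ 2 = 1 → v ξ = 0)
    {ξ : ℝ × ℝ} (hξ : ξ.1 ^ 2 + ξ.2 ^ 2 = 1) :
    ξ.1 • pdyW v closedUnitDisk ξ = ξ.2 • pdxW v closedUnitDisk ξ := by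
  have hcirc (t : ℝ) : (ξ.1 * Real.cos t - ξ.2 * Real.sin t) ^ 2 +
      (ξ.2 * Real.cos t + ξ.1 * Real.sin t) ^ 2 = 1 := by
    linear_combination (Real.cos t ^ 2 + Real.sin t ^ 2) * hξ + Real.cos_sq_add_sin_sq t
  have hγ : HasDerivAt (fun t : ℝ => (ξ.1 * Real.cos t - ξ.2 * Real.sin t,
      ξ.2 * Real.cos t + ξ.1 * Real.sin t)) (-ξ.2, ξ.1) 0 := by
    have hcos := Real.hasDerivAt_cos 0
    have hsin := Real.hasDerivAt_sin 0
    convert ((hcos.const_mul ξ.1).sub (hsin.const_mul ξ.2)).prodMk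
      ((hcos.const_mul ξ.2).add (hsin.const_mul ξ.1)) using 1 <;> simp
  have hd := ((hv.differentiableOn two_ne_zero) ξ hξ.le).hasFDerivWithinAt
  have h := hd.comp_hasDerivWithinAt_of_eq (s := Set.univ) 0 hγ.hasDerivWithinAt
    (fun t _ => (hcirc t).le) (by simp)
  rw [hasDerivWithinAt_univ] at h
  have hzero := h.unique ((hasDerivAt_const (0 : ℝ) (0 : Fin 3 → ℝ)).congr_of_eventuallyEq
    (Filter.Eventually.of_forall fun t => hbc _ (hcirc t)))
  have hdecomp : ((-ξ.2, ξ.1) : ℝ × ℝ) = (-ξ.2) • (1, 0) + ξ.1 • (0, 1) := by simp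
  rw [hdecomp, map_add, map_smul, map_smul, neg_smul, neg_add_eq_zero] at hzero
  exact hzero.symm

theorem hopfFun_eq_of_tangential {v : ℝ × ℝ → Fin 3 → ℝ} {z : ℂ}
    (ht : z.re • pdyW v closedUnitDisk (Complex.equivRealProdCLM z) =
      z.im • pdxW v closedUnitDisk (Complex.equivRealProdCLM z)) :
    hopfFun v z = ((∑ i, (z.re * pdxW v closedUnitDisk (Complex.equivRealProdCLM z) i +
      z.im * pdyW v closedUnitDisk (Complex.equivRealProdCLM z) i) ^ 2 : ℝ) : ℂ) := by
  rw [hopfFun, Finset.mul_sum, Complex.ofReal_sum]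
  refine Finset.sum_congr rfl fun i _ => ?_
  rw [← mul_pow, Complex.ofReal_pow, conjGradCLM_apply]
  congr 1
  have hi := congrFun ht i
  simp only [Pi.smul_apply, smul_eq_mul, pdxW, pdyW, Complex.equivRealProdCLM_apply] at hi ⊢
  apply Complex.ext
  · simp
  · simp
    linarith

/-- Any C² solution of `Δv = H(ξ, v, ∇v) vₓ ∧ v_y` in the unit disk `D` with
`v = 0` on `∂D` has vanishing outward normal derivative on `∂D`:
`x·vₓ + y·v_y = 0` whenever `x² + y² = 1`. -/
theorem statement1
    (H : (ℝ × ℝ) → (Fin 3 → ℝ) → (Fin 3 → ℝ) × (Fin 3 → ℝ) → ℝ)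
    (hH : ContinuousOn
      (fun q : (ℝ × ℝ) × (Fin 3 → ℝ) × ((Fin 3 → ℝ) × (Fin 3 → ℝ)) => H q.1 q.2.1 q.2.2)
      (closedUnitDisk ×ˢ (Set.univ : Set ((Fin 3 → ℝ) × ((Fin 3 → ℝ) × (Fin 3 → ℝ))))))
    (v : ℝ × ℝ → Fin 3 → ℝ)
    (hv : ContDiffOn ℝ 2 v closedUnitDisk)
    (hpde : ∀ ξ ∈ unitDisk, lapW v closedUnitDisk ξ =
      H ξ (v ξ) (pdxW v closedUnitDisk ξ, pdyW v closedUnitDisk ξ) •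
        cross3 (pdxW v closedUnitDisk ξ) (pdyW v closedUnitDisk ξ))
    (hbc : ∀ ξ : ℝ × ℝ, ξ.1 ^ 2 + ξ.2 ^ 2 = 1 → v ξ = 0) :
    ∀ ξ : ℝ × ℝ, ξ.1 ^ 2 + ξ.2 ^ 2 = 1 →
      ξ.1 • pdxW v closedUnitDisk ξ + ξ.2 • pdyW v closedUnitDisk ξ = 0 := by
  intro ξ hξ
  have hdiff : DiffContOnCl ℂ (hopfFun v) (Metric.ball 0 1) := by
    refine ⟨fun z hz => ?_, ?_⟩
    · exact (differentiableAt_hopfFun hv hz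
        (hpde _ (equivRealProdCLM_mem_unitDisk hz))).differentiableWithinAt
    · rw [closure_ball (0 : ℂ) one_ne_zero]
      exact continuousOn_hopfFun hv
  have hsphere {z : ℂ} (hz : z ∈ Metric.sphere (0 : ℂ) 1) : z.re ^ 2 + z.im ^ 2 = 1 := by
    rw [sq, sq, ← Complex.normSq_apply, ← Complex.sq_norm, mem_sphere_zero_iff_norm.1 hz, one_pow]
  have hbdry {z : ℂ} (hz : z.re ^ 2 + z.im ^ 2 = 1) :=
    hopfFun_eq_of_tangential
      (tangential_derivative_eq_zero hv hbc (ξ := Complex.equivRealProdCLM z) hz)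
  have hre := re_eq_zero_on_circle_of_nonneg hdiff (by simp [hopfFun]) fun z hz => by
    rw [hbdry (hsphere hz), Complex.ofReal_re]
    positivity
  have hz : Complex.equivRealProdCLM.symm ξ ∈ Metric.sphere (0 : ℂ) 1 := by
    rw [mem_sphere_zero_iff_norm, ← pow_eq_one_iff_of_nonneg (norm_nonneg _) two_ne_zero, Complex.sq_norm,
      Complex.normSq_apply]
    simpa [sq] using hξ
  have h := hre _ hz
  rw [hbdry (hsphere hz), Complex.ofReal_re,
    Finset.sum_eq_zero_iff_of_nonneg fun _ _ => sq_nonneg _] at h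
  ext i
  simpa using h i (Finset.mem_univ i)
end
end

section
/- Let w : ℝ² → ℝ³ be a twice continuously differentiable map with ∫_{ℝ²} |∇w|² dξ < ∞ and ∫_{ℝ²} |w(ξ)|²/(1+|ξ|²)² dξ < ∞, and suppose w solves the linearization of the H-surface equation at the stereographic projection, i.e. Δw(ξ) = 2 ( w_x(ξ) ∧ π_y(ξ) + π_x(ξ) ∧ w_y(ξ) ) for every ξ ∈ ℝ². Then there exist vectors c, b ∈ ℝ³ and a real skew-symmetric 3×3 matrix A such that w(ξ) = c + A·π(ξ) + ⟨b, π(ξ)⟩·π(ξ) for every ξ ∈ ℝ². -/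
noncomputable section

open MeasureTheory

/-- Partial derivative in the first coordinate. -/
def pdx {E : Type*} [NormedAddCommGroup E] [NormedSpace ℝ E] (f : ℝ × ℝ → E) (p : ℝ × ℝ) : E :=
  fderiv ℝ f p (1, 0)

/-- Partial derivative in the second coordinate. -/
def pdy {E : Type*} [NormedAddCommGroup E] [NormedSpace ℝ E] (f : ℝ × ℝ → E) (p : ℝ × ℝ) : E :=
  fderiv ℝ f p (0, 1)

/-- Componentwise Laplacian Δf = f_xx + f_yy. -/
def lap {E : Type*} [NormedAddCommGroup E] [NormedSpace ℝ E] (f : ℝ × ℝ → E) (p : ℝ × ℝ) : E :=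
  pdx (pdx f) p + pdy (pdy f) p

/-- The stereographic projection π : ℝ² → ℝ³. -/
def stereo (p : ℝ × ℝ) : Fin 3 → ℝ :=
  ![2 * p.1 / (1 + p.1 ^ 2 + p.2 ^ 2), 2 * p.2 / (1 + p.1 ^ 2 + p.2 ^ 2),
    (p.1 ^ 2 + p.2 ^ 2 - 1) / (1 + p.1 ^ 2 + p.2 ^ 2)]

/-- `f` is differentiable at `p` with partial derivatives `a` and `b`. -/
def HasPD (f : ℝ × ℝ → ℝ) (a b : ℝ) (p : ℝ × ℝ) : Prop :=
  HasFDerivAt f (a • ContinuousLinearMap.fst ℝ ℝ ℝ + b • ContinuousLinearMap.snd ℝ ℝ ℝ) p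

namespace HasPD

variable {f g : ℝ × ℝ → ℝ} {a b c d : ℝ} {p : ℝ × ℝ}

theorem congr (h : HasPD f a b p) (ha : a = c) (hb : b = d) : HasPD f c d p := by
  subst ha hb; exact h

theorem const (r : ℝ) (p : ℝ × ℝ) : HasPD (fun _ => r) 0 0 p := by
  simpa [HasPD] using hasFDerivAt_const r p

theorem fst (p : ℝ × ℝ) : HasPD (fun q => q.1) 1 0 p := by
  simpa [HasPD] using hasFDerivAt_fst (𝕜 := ℝ) (p := p)

theorem snd (p : ℝ × ℝ) : HasPD (fun q => q.2) 0 1 p := by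
  simpa [HasPD] using hasFDerivAt_snd (𝕜 := ℝ) (p := p)

theorem add (hf : HasPD f a b p) (hg : HasPD g c d p) :
    HasPD (fun q => f q + g q) (a + c) (b + d) p := by
  unfold HasPD at *
  refine (hf.add hg).congr_fderiv ?_
  ext <;> simp

theorem neg (hf : HasPD f a b p) : HasPD (fun q => -f q) (-a) (-b) p := by
  unfold HasPD at *
  refine hf.neg.congr_fderiv ?_
  ext <;> simp

theorem sub (hf : HasPD f a b p) (hg : HasPD g c d p) :
    HasPD (fun q => f q - g q) (a - c) (b - d) p := by
  unfold HasPD at *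
  refine (hf.sub hg).congr_fderiv ?_
  ext <;> simp

theorem mul (hf : HasPD f a b p) (hg : HasPD g c d p) :
    HasPD (fun q => f q * g q) (a * g p + f p * c) (b * g p + f p * d) p := by
  unfold HasPD at *
  refine (hf.mul hg).congr_fderiv ?_
  ext <;> simp <;> ring

theorem inv (hf : HasPD f a b p) (h0 : f p ≠ 0) :
    HasPD (fun q => (f q)⁻¹) (-a / f p ^ 2) (-b / f p ^ 2) p := by
  unfold HasPD at *
  refine ((hasDerivAt_inv h0).comp_hasFDerivAt p hf).congr_fderiv ?_
  ext <;> simp <;> ring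

theorem div (hf : HasPD f a b p) (hg : HasPD g c d p) (h0 : g p ≠ 0) :
    HasPD (fun q => f q / g q) ((a * g p - f p * c) / g p ^ 2)
      ((b * g p - f p * d) / g p ^ 2) p := by
  simp only [div_eq_mul_inv (f _)]
  refine (hf.mul (hg.inv h0)).congr ?_ ?_ <;> field_simp <;> ring

theorem pdx_eq (h : HasPD f a b p) : pdx f p = a := by
  unfold HasPD at h
  simp [pdx, h.fderiv]

theorem pdy_eq (h : HasPD f a b p) : pdy f p = b := by
  unfold HasPD at h
  simp [pdy, h.fderiv]

end HasPD

theorem DifferentiableAt.hasPD_apply {w : ℝ × ℝ → Fin 3 → ℝ} {p : ℝ × ℝ}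
    (h : DifferentiableAt ℝ w p) (i : Fin 3) :
    HasPD (fun q => w q i) (pdx w p i) (pdy w p i) p := by
  unfold HasPD
  refine (hasFDerivAt_pi'.1 h.hasFDerivAt i).congr_fderiv ?_
  ext <;> simp [pdx, pdy]

theorem DifferentiableAt.hasPD {f : ℝ × ℝ → ℝ} {p : ℝ × ℝ}
    (h : DifferentiableAt ℝ f p) : HasPD f (pdx f p) (pdy f p) p := by
  unfold HasPD
  refine h.hasFDerivAt.congr_fderiv ?_
  ext <;> simp [pdx, pdy]

section

variable {E : Type*} [NormedAddCommGroup E] [NormedSpace ℝ E] {w : ℝ × ℝ → E}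

theorem ContDiff.pdx_one (hw : ContDiff ℝ 2 w) : ContDiff ℝ 1 (pdx w) :=
  (hw.fderiv_right (m := 1) (by norm_num)).clm_apply contDiff_const

theorem ContDiff.pdy_one (hw : ContDiff ℝ 2 w) : ContDiff ℝ 1 (pdy w) :=
  (hw.fderiv_right (m := 1) (by norm_num)).clm_apply contDiff_const

theorem ContDiff.continuous_pdx (hw : ContDiff ℝ 1 w) : Continuous (pdx w) :=
  (hw.continuous_fderiv (by norm_num)).clm_apply continuous_const

theorem ContDiff.continuous_pdy (hw : ContDiff ℝ 1 w) : Continuous (pdy w) :=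
  (hw.continuous_fderiv (by norm_num)).clm_apply continuous_const

theorem pdx_pdy_comm (hw : ContDiff ℝ 2 w) (p : ℝ × ℝ) : pdx (pdy w) p = pdy (pdx w) p := by
  have hd : DifferentiableAt ℝ (fderiv ℝ w) p :=
    (hw.fderiv_right (m := 1) (by norm_num)).differentiable (by norm_num) p
  have hs : IsSymmSndFDerivAt ℝ w p := hw.contDiffAt.isSymmSndFDerivAt (by simp)
  have e : ∀ u v : ℝ × ℝ, fderiv ℝ (fun q => fderiv ℝ w q u) p v = fderiv ℝ (fderiv ℝ w) p v u := by
    intro u v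
    rw [fderiv_clm_apply hd (differentiableAt_const _)]
    simp
  change fderiv ℝ (fun q => fderiv ℝ w q (0, 1)) p (1, 0)
    = fderiv ℝ (fun q => fderiv ℝ w q (1, 0)) p (0, 1)
  rw [e, e]
  exact hs.eq _ _

end

theorem one_add_sq_pos (p : ℝ × ℝ) : 0 < 1 + p.1 ^ 2 + p.2 ^ 2 := by positivity

theorem one_add_sq_ne (p : ℝ × ℝ) : 1 + p.1 ^ 2 + p.2 ^ 2 ≠ 0 := (one_add_sq_pos p).ne'

theorem hasPD_sq_fst (p : ℝ × ℝ) : HasPD (fun q => q.1 ^ 2) (2 * p.1) 0 p := by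
  simp only [sq]
  exact ((HasPD.fst p).mul (HasPD.fst p)).congr (by ring) (by ring)

theorem hasPD_sq_snd (p : ℝ × ℝ) : HasPD (fun q => q.2 ^ 2) 0 (2 * p.2) p := by
  simp only [sq]
  exact ((HasPD.snd p).mul (HasPD.snd p)).congr (by ring) (by ring)

theorem hasPD_one_add_sq (p : ℝ × ℝ) :
    HasPD (fun q => 1 + q.1 ^ 2 + q.2 ^ 2) (2 * p.1) (2 * p.2) p :=
  (((HasPD.const 1 p).add (hasPD_sq_fst p)).add (hasPD_sq_snd p)).congr (by ring) (by ring)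

theorem hasPD_one_add_sq_sq (p : ℝ × ℝ) :
    HasPD (fun q => (1 + q.1 ^ 2 + q.2 ^ 2) ^ 2) (4 * p.1 * (1 + p.1 ^ 2 + p.2 ^ 2))
      (4 * p.2 * (1 + p.1 ^ 2 + p.2 ^ 2)) p := by
  have h := ((hasPD_one_add_sq p).mul (hasPD_one_add_sq p)).congr
    (c := 4 * p.1 * (1 + p.1 ^ 2 + p.2 ^ 2)) (d := 4 * p.2 * (1 + p.1 ^ 2 + p.2 ^ 2))
    (by ring) (by ring)
  simpa only [← sq] using h

/-- Explicit first coordinate derivative of the stereographic projection. -/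
def stereoX (p : ℝ × ℝ) : Fin 3 → ℝ :=
  ![2 * (1 - p.1 ^ 2 + p.2 ^ 2) / (1 + p.1 ^ 2 + p.2 ^ 2) ^ 2,
    -(4 * p.1 * p.2) / (1 + p.1 ^ 2 + p.2 ^ 2) ^ 2,
    4 * p.1 / (1 + p.1 ^ 2 + p.2 ^ 2) ^ 2]

/-- Explicit second coordinate derivative of the stereographic projection. -/
def stereoY (p : ℝ × ℝ) : Fin 3 → ℝ :=
  ![-(4 * p.1 * p.2) / (1 + p.1 ^ 2 + p.2 ^ 2) ^ 2,
    2 * (1 + p.1 ^ 2 - p.2 ^ 2) / (1 + p.1 ^ 2 + p.2 ^ 2) ^ 2,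
    4 * p.2 / (1 + p.1 ^ 2 + p.2 ^ 2) ^ 2]

/-- Explicit mixed second derivative of the stereographic projection. -/
def stereoXY (p : ℝ × ℝ) : Fin 3 → ℝ :=
  ![4 * p.2 * (3 * p.1 ^ 2 - p.2 ^ 2 - 1) / (1 + p.1 ^ 2 + p.2 ^ 2) ^ 3,
    4 * p.1 * (3 * p.2 ^ 2 - p.1 ^ 2 - 1) / (1 + p.1 ^ 2 + p.2 ^ 2) ^ 3,
    -(16 * p.1 * p.2) / (1 + p.1 ^ 2 + p.2 ^ 2) ^ 3]

/-- Explicit second derivative of the stereographic projection in the first coordinate. -/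
def stereoXX (p : ℝ × ℝ) : Fin 3 → ℝ :=
  ![4 * p.1 * (p.1 ^ 2 - 3 * p.2 ^ 2 - 3) / (1 + p.1 ^ 2 + p.2 ^ 2) ^ 3,
    4 * p.2 * (3 * p.1 ^ 2 - p.2 ^ 2 - 1) / (1 + p.1 ^ 2 + p.2 ^ 2) ^ 3,
    4 * (1 - 3 * p.1 ^ 2 + p.2 ^ 2) / (1 + p.1 ^ 2 + p.2 ^ 2) ^ 3]

/-- Explicit second derivative of the stereographic projection in the second coordinate. -/
def stereoYY (p : ℝ × ℝ) : Fin 3 → ℝ :=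
  ![4 * p.1 * (3 * p.2 ^ 2 - p.1 ^ 2 - 1) / (1 + p.1 ^ 2 + p.2 ^ 2) ^ 3,
    4 * p.2 * (p.2 ^ 2 - 3 * p.1 ^ 2 - 3) / (1 + p.1 ^ 2 + p.2 ^ 2) ^ 3,
    4 * (1 + p.1 ^ 2 - 3 * p.2 ^ 2) / (1 + p.1 ^ 2 + p.2 ^ 2) ^ 3]

theorem hasPD_stereo (p : ℝ × ℝ) (i : Fin 3) :
    HasPD (fun q => stereo q i) (stereoX p i) (stereoY p i) p := by
  have hD := one_add_sq_ne p
  fin_cases i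
  · refine (((HasPD.const 2 p).mul (HasPD.fst p)).div (hasPD_one_add_sq p) hD).congr ?_ ?_ <;>
      simp [stereoX, stereoY] <;> field_simp <;> ring
  · refine (((HasPD.const 2 p).mul (HasPD.snd p)).div (hasPD_one_add_sq p) hD).congr ?_ ?_ <;>
      simp [stereoX, stereoY] <;> field_simp <;> ring
  · refine ((((hasPD_sq_fst p).add (hasPD_sq_snd p)).sub (HasPD.const 1 p)).div
      (hasPD_one_add_sq p) hD).congr ?_ ?_ <;>
      simp [stereoX, stereoY] <;> field_simp <;> ring

theorem hasPD_stereoX (p : ℝ × ℝ) (i : Fin 3) :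
    HasPD (fun q => stereoX q i) (stereoXX p i) (stereoXY p i) p := by
  have hD := one_add_sq_ne p
  have hD2 := pow_ne_zero 2 hD
  fin_cases i
  · refine (((HasPD.const 2 p).mul (((HasPD.const 1 p).sub (hasPD_sq_fst p)).add
      (hasPD_sq_snd p))).div (hasPD_one_add_sq_sq p) hD2).congr ?_ ?_ <;>
      simp [stereoXX, stereoXY] <;> field_simp <;> ring
  · refine ((((HasPD.const 4 p).mul (HasPD.fst p)).mul
      (HasPD.snd p)).neg.div (hasPD_one_add_sq_sq p) hD2).congr ?_ ?_ <;>
      simp [stereoXX, stereoXY] <;> field_simp <;> ring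
  · refine (((HasPD.const 4 p).mul (HasPD.fst p)).div (hasPD_one_add_sq_sq p) hD2).congr ?_ ?_ <;>
      simp [stereoXX, stereoXY] <;> field_simp <;> ring

theorem hasPD_stereoY (p : ℝ × ℝ) (i : Fin 3) :
    HasPD (fun q => stereoY q i) (stereoXY p i) (stereoYY p i) p := by
  have hD := one_add_sq_ne p
  have hD2 := pow_ne_zero 2 hD
  fin_cases i
  · refine ((((HasPD.const 4 p).mul (HasPD.fst p)).mul
      (HasPD.snd p)).neg.div (hasPD_one_add_sq_sq p) hD2).congr ?_ ?_ <;>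
      simp [stereoYY, stereoXY] <;> field_simp <;> ring
  · refine (((HasPD.const 2 p).mul (((HasPD.const 1 p).add (hasPD_sq_fst p)).sub
      (hasPD_sq_snd p))).div (hasPD_one_add_sq_sq p) hD2).congr ?_ ?_ <;>
      simp [stereoYY, stereoXY] <;> field_simp <;> ring
  · refine (((HasPD.const 4 p).mul (HasPD.snd p)).div (hasPD_one_add_sq_sq p) hD2).congr ?_ ?_ <;>
      simp [stereoYY, stereoXY] <;> field_simp <;> ring

theorem differentiableAt_stereo (p : ℝ × ℝ) : DifferentiableAt ℝ stereo p :=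
  differentiableAt_pi.2 fun i => (hasPD_stereo p i).differentiableAt

theorem pdx_stereo (p : ℝ × ℝ) : pdx stereo p = stereoX p := by
  funext i
  rw [← (hasPD_stereo p i).pdx_eq, ((differentiableAt_stereo p).hasPD_apply i).pdx_eq]

theorem pdy_stereo (p : ℝ × ℝ) : pdy stereo p = stereoY p := by
  funext i
  rw [← (hasPD_stereo p i).pdy_eq, ((differentiableAt_stereo p).hasPD_apply i).pdy_eq]

theorem contDiff_stereo_apply (i : Fin 3) : ContDiff ℝ 2 (fun p => stereo p i) := by
  have hD : ContDiff ℝ 2 (fun p : ℝ × ℝ => 1 + p.1 ^ 2 + p.2 ^ 2) := by fun_prop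
  fin_cases i
  · exact ContDiff.div (by fun_prop) hD one_add_sq_ne
  · exact ContDiff.div (by fun_prop) hD one_add_sq_ne
  · exact ContDiff.div (by fun_prop) hD one_add_sq_ne

theorem lap_eq_of_hasPD {f fx fy : ℝ × ℝ → ℝ} {a b c d : ℝ} {p : ℝ × ℝ}
    (h : ∀ q, HasPD f (fx q) (fy q) q) (hx : HasPD fx a b p) (hy : HasPD fy c d p) :
    lap f p = a + d := by
  have e1 : pdx f = fx := funext fun q => (h q).pdx_eq
  have e2 : pdy f = fy := funext fun q => (h q).pdy_eq
  rw [lap, e1, e2, hx.pdx_eq, hy.pdy_eq]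

theorem lap_stereo_apply (i : Fin 3) (p : ℝ × ℝ) :
    lap (fun q => stereo q i) p = -8 * stereo p i / (1 + p.1 ^ 2 + p.2 ^ 2) ^ 2 := by
  rw [lap_eq_of_hasPD (fun q => hasPD_stereo q i) (hasPD_stereoX p i) (hasPD_stereoY p i)]
  have hD := one_add_sq_ne p
  fin_cases i <;> simp [stereo, stereoXX, stereoYY] <;> field_simp <;> ring

/-- The component of `w` normal to the sphere. -/
def normalPart (w : ℝ × ℝ → Fin 3 → ℝ) (p : ℝ × ℝ) : ℝ :=
  w p 0 * stereo p 0 + w p 1 * stereo p 1 + w p 2 * stereo p 2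

/-- First coordinate of the part of `w` tangent to the sphere. -/
def tangentX (w : ℝ × ℝ → Fin 3 → ℝ) (p : ℝ × ℝ) : ℝ :=
  (1 - p.1 ^ 2 + p.2 ^ 2) / 2 * w p 0 - p.1 * p.2 * w p 1 + p.1 * w p 2

/-- Second coordinate of the part of `w` tangent to the sphere. -/
def tangentY (w : ℝ × ℝ → Fin 3 → ℝ) (p : ℝ × ℝ) : ℝ :=
  (1 + p.1 ^ 2 - p.2 ^ 2) / 2 * w p 1 - p.1 * p.2 * w p 0 + p.2 * w p 2

theorem eq_normalPart_add_tangent (w : ℝ × ℝ → Fin 3 → ℝ) (p : ℝ × ℝ) (i : Fin 3) :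
    w p i = normalPart w p * stereo p i + tangentX w p * stereoX p i
      + tangentY w p * stereoY p i := by
  have hD := one_add_sq_ne p
  fin_cases i <;> simp [normalPart, tangentX, tangentY, stereo, stereoX, stereoY] <;>
    field_simp <;> ring

theorem sum_sq_eq (w : ℝ × ℝ → Fin 3 → ℝ) (p : ℝ × ℝ) :
    ∑ i, w p i ^ 2 = normalPart w p ^ 2
      + 4 * (tangentX w p ^ 2 + tangentY w p ^ 2) / (1 + p.1 ^ 2 + p.2 ^ 2) ^ 2 := by
  have hD := one_add_sq_ne p
  rw [Fin.sum_univ_three]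
  simp only [normalPart, tangentX, tangentY, stereo, Matrix.cons_val]
  field_simp
  ring

/-- Real part of the Hopf differential of the pair `w`, `stereo`. -/
def hopfRe (w : ℝ × ℝ → Fin 3 → ℝ) (p : ℝ × ℝ) : ℝ :=
  pdx w p 0 * stereoX p 0 + pdx w p 1 * stereoX p 1 + pdx w p 2 * stereoX p 2
    - (pdy w p 0 * stereoY p 0 + pdy w p 1 * stereoY p 1 + pdy w p 2 * stereoY p 2)

/-- Imaginary part of the Hopf differential of the pair `w`, `stereo`. -/
def hopfIm (w : ℝ × ℝ → Fin 3 → ℝ) (p : ℝ × ℝ) : ℝ :=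
  -(pdx w p 0 * stereoY p 0 + pdx w p 1 * stereoY p 1 + pdx w p 2 * stereoY p 2
    + (pdy w p 0 * stereoX p 0 + pdy w p 1 * stereoX p 1 + pdy w p 2 * stereoX p 2))

section

variable {w : ℝ × ℝ → Fin 3 → ℝ}

theorem hasPD_tangentX {p : ℝ × ℝ} (hw : DifferentiableAt ℝ w p) :
    HasPD (tangentX w)
      (-p.1 * w p 0 - p.2 * w p 1 + w p 2 + (1 - p.1 ^ 2 + p.2 ^ 2) / 2 * pdx w p 0
        - p.1 * p.2 * pdx w p 1 + p.1 * pdx w p 2)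
      (p.2 * w p 0 - p.1 * w p 1 + (1 - p.1 ^ 2 + p.2 ^ 2) / 2 * pdy w p 0
        - p.1 * p.2 * pdy w p 1 + p.1 * pdy w p 2) p := by
  refine ((((((HasPD.const 1 p).sub (hasPD_sq_fst p)).add (hasPD_sq_snd p)).div
    (HasPD.const 2 p) two_ne_zero).mul (hw.hasPD_apply 0)).sub
    (((HasPD.fst p).mul (HasPD.snd p)).mul (hw.hasPD_apply 1))).add
    ((HasPD.fst p).mul (hw.hasPD_apply 2)) |>.congr ?_ ?_ <;> ring

theorem hasPD_tangentY {p : ℝ × ℝ} (hw : DifferentiableAt ℝ w p) :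
    HasPD (tangentY w)
      (p.1 * w p 1 - p.2 * w p 0 + (1 + p.1 ^ 2 - p.2 ^ 2) / 2 * pdx w p 1
        - p.1 * p.2 * pdx w p 0 + p.2 * pdx w p 2)
      (-p.1 * w p 0 - p.2 * w p 1 + w p 2 + (1 + p.1 ^ 2 - p.2 ^ 2) / 2 * pdy w p 1
        - p.1 * p.2 * pdy w p 0 + p.2 * pdy w p 2) p := by
  refine ((((((HasPD.const 1 p).add (hasPD_sq_fst p)).sub (hasPD_sq_snd p)).div
    (HasPD.const 2 p) two_ne_zero).mul (hw.hasPD_apply 1)).sub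
    (((HasPD.fst p).mul (HasPD.snd p)).mul (hw.hasPD_apply 0))).add
    ((HasPD.snd p).mul (hw.hasPD_apply 2)) |>.congr ?_ ?_ <;> ring

/-- If the Hopf differential vanishes, the tangent part satisfies the Cauchy-Riemann equations. -/
theorem tangent_cauchyRiemann (hw : Differentiable ℝ w) (hRe : ∀ p, hopfRe w p = 0)
    (hIm : ∀ p, hopfIm w p = 0) (p : ℝ × ℝ) :
    ∃ a b, HasPD (tangentX w) a b p ∧ HasPD (tangentY w) (-b) a p := by
  have hD := one_add_sq_ne p
  refine ⟨_, _, hasPD_tangentX (hw p), (hasPD_tangentY (hw p)).congr ?_ ?_⟩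
  · have h := hIm p
    simp only [hopfIm, stereoX, stereoY, Matrix.cons_val] at h
    field_simp at h
    linear_combination (-1 / 4) * h
  · have h := hRe p
    simp only [hopfRe, stereoX, stereoY, Matrix.cons_val] at h
    field_simp at h
    linear_combination (-1 / 4) * h

theorem lap_normalPart (hw : ContDiff ℝ 2 w) (hpde : ∀ ξ : ℝ × ℝ, lap w ξ =
      (2 : ℝ) • (cross3 (pdx w ξ) (pdy stereo ξ) + cross3 (pdx stereo ξ) (pdy w ξ)))
    (p : ℝ × ℝ) :
    lap (normalPart w) p = -8 * normalPart w p / (1 + p.1 ^ 2 + p.2 ^ 2) ^ 2 := by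
  have hD := one_add_sq_ne p
  have hd : Differentiable ℝ w := hw.differentiable (by norm_num)
  have hdx : Differentiable ℝ (pdx w) := hw.pdx_one.differentiable (by norm_num)
  have hdy : Differentiable ℝ (pdy w) := hw.pdy_one.differentiable (by norm_num)
  have h1 : ∀ q, HasPD (normalPart w) _ _ q := fun q =>
    ((((hd q).hasPD_apply 0).mul (hasPD_stereo q 0)).add
      (((hd q).hasPD_apply 1).mul (hasPD_stereo q 1))).add
      (((hd q).hasPD_apply 2).mul (hasPD_stereo q 2))
  have hx := fun i => (((hdx p).hasPD_apply i).mul (hasPD_stereo p i)).add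
    (((hd p).hasPD_apply i).mul (hasPD_stereoX p i))
  have hy := fun i => (((hdy p).hasPD_apply i).mul (hasPD_stereo p i)).add
    (((hd p).hasPD_apply i).mul (hasPD_stereoY p i))
  rw [lap_eq_of_hasPD h1 (((hx 0).add (hx 1)).add (hx 2)) (((hy 0).add (hy 1)).add (hy 2))]
  have e := hpde p
  rw [pdx_stereo, pdy_stereo] at e
  have e0 := congrFun e 0
  have e1 := congrFun e 1
  have e2 := congrFun e 2
  simp only [lap, cross3, Pi.add_apply, Pi.smul_apply, smul_eq_mul, Matrix.cons_val] at e0 e1 e2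
  rw [← eq_sub_iff_add_eq] at e0 e1 e2
  rw [e0, e1, e2]
  simp only [normalPart, stereo, stereoX, stereoY, stereoXX, stereoYY, Matrix.cons_val]
  field_simp
  ring

/-- The Hopf differential of a solution satisfies the Cauchy-Riemann equations. -/
theorem hopf_cauchyRiemann (hw : ContDiff ℝ 2 w) (hpde : ∀ ξ : ℝ × ℝ, lap w ξ =
      (2 : ℝ) • (cross3 (pdx w ξ) (pdy stereo ξ) + cross3 (pdx stereo ξ) (pdy w ξ)))
    (p : ℝ × ℝ) :
    ∃ a b, HasPD (hopfRe w) a b p ∧ HasPD (hopfIm w) (-b) a p := by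
  have hD := one_add_sq_ne p
  have hdx : Differentiable ℝ (pdx w) := hw.pdx_one.differentiable (by norm_num)
  have hdy : Differentiable ℝ (pdy w) := hw.pdy_one.differentiable (by norm_num)
  have hxX := fun i => ((hdx p).hasPD_apply i).mul (hasPD_stereoX p i)
  have hxY := fun i => ((hdx p).hasPD_apply i).mul (hasPD_stereoY p i)
  have hyX := fun i => ((hdy p).hasPD_apply i).mul (hasPD_stereoX p i)
  have hyY := fun i => ((hdy p).hasPD_apply i).mul (hasPD_stereoY p i)
  have e := hpde p
  rw [pdx_stereo, pdy_stereo] at e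
  have e0 := congrFun e 0
  have e1 := congrFun e 1
  have e2 := congrFun e 2
  simp only [lap, cross3, Pi.add_apply, Pi.smul_apply, smul_eq_mul, Matrix.cons_val] at e0 e1 e2
  rw [← eq_sub_iff_add_eq] at e0 e1 e2
  refine ⟨_, _, (((hxX 0).add (hxX 1)).add (hxX 2)).sub (((hyY 0).add (hyY 1)).add (hyY 2)),
    ((((hxY 0).add (hxY 1)).add (hxY 2)).add
      (((hyX 0).add (hyX 1)).add (hyX 2))).neg.congr ?_ ?_⟩
  · rw [e0, e1, e2, pdx_pdy_comm hw p]
    simp only [stereoX, stereoY, stereoXX, stereoYY, stereoXY, Matrix.cons_val]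
    field_simp
    ring
  · rw [e0, e1, e2, pdx_pdy_comm hw p]
    simp only [stereoX, stereoY, stereoXX, stereoYY, stereoXY, Matrix.cons_val]
    field_simp
    ring

end

open Complex in
/-- The curve integral defining the `n`-th Fourier mode of `G` on the circle of radius `R`. -/
def circleMode (G : ℝ × ℝ → ℂ) (n : ℤ) (R : ℝ) : ℂ :=
  ∫ θ in (-Real.pi)..Real.pi, G (R * Real.cos θ, R * Real.sin θ) * exp (-(n * θ) * I)

theorem norm_exp_neg_int_mul_I (n : ℤ) (θ : ℝ) : ‖Complex.exp (-(n * θ) * Complex.I)‖ = 1 := by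
  have := Complex.norm_exp_ofReal_mul_I (-(n * θ))
  push_cast at this
  exact this

theorem sq_intervalIntegral_le {g : ℝ → ℝ} (hg : Continuous g) {a b : ℝ} (hab : a < b) :
    (∫ θ in a..b, g θ) ^ 2 ≤ (b - a) * ∫ θ in a..b, g θ ^ 2 := by
  set A := ∫ θ in a..b, g θ with hA
  have h0 : 0 ≤ ∫ θ in a..b, (g θ - A / (b - a)) ^ 2 :=
    intervalIntegral.integral_nonneg hab.le fun θ _ => sq_nonneg _
  have h1 : ∫ θ in a..b, (g θ - A / (b - a)) ^ 2
      = (∫ θ in a..b, g θ ^ 2) - 2 * (A / (b - a)) * A + (b - a) * (A / (b - a)) ^ 2 := by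
    have : ∀ θ, (g θ - A / (b - a)) ^ 2
        = g θ ^ 2 - 2 * (A / (b - a)) * g θ + (A / (b - a)) ^ 2 := fun θ => by ring
    simp only [this]
    rw [intervalIntegral.integral_add, intervalIntegral.integral_sub,
      intervalIntegral.integral_const_mul, intervalIntegral.integral_const, smul_eq_mul]
    all_goals exact Continuous.intervalIntegrable (by fun_prop) _ _
  have hb : 0 < b - a := sub_pos.2 hab
  rw [h1] at h0
  have h2 : (∫ θ in a..b, g θ ^ 2) - 2 * (A / (b - a)) * A + (b - a) * (A / (b - a)) ^ 2
      = (∫ θ in a..b, g θ ^ 2) - A ^ 2 / (b - a) := by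
    field_simp
    ring
  rw [h2, sub_nonneg, div_le_iff₀ hb] at h0
  linarith

theorem sq_norm_circleMode_le {G : ℝ × ℝ → ℂ} (hG : Continuous G) (n : ℤ) (R : ℝ) :
    ‖circleMode G n R‖ ^ 2
      ≤ 2 * Real.pi * ∫ θ in (-Real.pi)..Real.pi, ‖G (R * Real.cos θ, R * Real.sin θ)‖ ^ 2 := by
  have hpi : -Real.pi < Real.pi := by linarith [Real.pi_pos]
  have h := sq_intervalIntegral_le (g := fun θ => ‖G (R * Real.cos θ, R * Real.sin θ)‖)
    (by fun_prop) hpi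
  have h2 : ‖circleMode G n R‖ ≤ ∫ θ in (-Real.pi)..Real.pi,
      ‖G (R * Real.cos θ, R * Real.sin θ)‖ := by
    refine (intervalIntegral.norm_integral_le_integral_norm hpi.le).trans_eq ?_
    simp only [norm_mul, norm_exp_neg_int_mul_I, mul_one]
  calc _ ≤ _ := pow_le_pow_left₀ (norm_nonneg _) h2 2
    _ ≤ _ := h
    _ = _ := by ring

theorem integrableOn_polar {f : ℝ × ℝ → ℝ} (hf : Integrable f) :
    IntegrableOn (fun p : ℝ × ℝ => p.1 * f (p.1 * Real.cos p.2, p.1 * Real.sin p.2))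
      (Set.Ioi 0 ×ˢ Set.Ioo (-Real.pi) Real.pi) := by
  have h := hf.integrableOn (s := polarCoord.source)
  rw [← polarCoord.symm_image_target_eq_source,
    integrableOn_image_iff_integrableOn_abs_det_fderiv_smul volume
      polarCoord.open_target.measurableSet
      (fun p _ => (hasFDerivAt_polarCoord_symm p).hasFDerivWithinAt)
      polarCoord.symm.injOn] at h
  refine h.congr_fun (fun p hp => ?_) polarCoord.open_target.measurableSet
  have hp0 : 0 < p.1 := hp.1
  simp [det_fderivPolarCoordSymm, abs_of_pos hp0]

/-- A square-integrable function (for the weight `(1 + |p|²)⁻ᵐ`) has no Fourier mode growing at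
least like `R ^ j` with `m ≤ j + 1`. -/
theorem not_le_norm_circleMode {G : ℝ × ℝ → ℂ} (hG : Continuous G) {m j : ℕ} (hmj : m ≤ j + 1)
    (hint : Integrable (fun p : ℝ × ℝ => ‖G p‖ ^ 2 / (1 + p.1 ^ 2 + p.2 ^ 2) ^ m))
    (n : ℤ) {c : ℝ} (hc : 0 < c) : ¬ ∀ R : ℝ, 1 ≤ R → c * R ^ j ≤ ‖circleMode G n R‖ := by
  intro h
  have h1 := integrableOn_polar hint
  rw [IntegrableOn, Measure.volume_eq_prod, ← Measure.prod_restrict] at h1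
  have h2 := h1.integral_prod_left
  have h3 : IntegrableOn (fun r : ℝ => ∫ θ in Set.Ioo (-Real.pi) Real.pi,
      r * (‖G (r * Real.cos θ, r * Real.sin θ)‖ ^ 2 /
        (1 + (r * Real.cos θ) ^ 2 + (r * Real.sin θ) ^ 2) ^ m)) (Set.Ioi 1) :=
    IntegrableOn.mono_set h2 (Set.Ioi_subset_Ioi zero_le_one)
  set δ := c ^ 2 / (2 * Real.pi) / 2 ^ m with hδ
  have hδ0 : 0 < δ := by positivity
  refine not_integrableOn_Ioi_inv (a := 1) ?_
  have h4 : IntegrableOn (fun r : ℝ => δ * r⁻¹) (Set.Ioi 1) := by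
    refine Integrable.mono' h3 (by fun_prop) ?_
    filter_upwards [ae_restrict_mem measurableSet_Ioi] with r hr
    have hr1 : (1 : ℝ) < r := hr
    have hr0 : 0 < r := by linarith
    rw [Real.norm_of_nonneg (by positivity)]
    have e : ∀ θ : ℝ, r * (‖G (r * Real.cos θ, r * Real.sin θ)‖ ^ 2 /
        (1 + (r * Real.cos θ) ^ 2 + (r * Real.sin θ) ^ 2) ^ m)
        = (r / (1 + r ^ 2) ^ m) * ‖G (r * Real.cos θ, r * Real.sin θ)‖ ^ 2 := by
      intro θ
      have : 1 + (r * Real.cos θ) ^ 2 + (r * Real.sin θ) ^ 2 = 1 + r ^ 2 := by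
        linear_combination r ^ 2 * Real.sin_sq_add_cos_sq θ
      rw [this]
      ring
    simp only [e]
    rw [integral_const_mul, ← integral_Ioc_eq_integral_Ioo,
      ← intervalIntegral.integral_of_le (by linarith [Real.pi_pos])]
    have h5 := sq_norm_circleMode_le hG n r
    have h6 : (c * r ^ j) ^ 2 ≤ ‖circleMode G n r‖ ^ 2 :=
      pow_le_pow_left₀ (by positivity) (h r hr1.le) 2
    have h7 : (c * r ^ j) ^ 2 / (2 * Real.pi)
        ≤ ∫ θ in (-Real.pi)..Real.pi, ‖G (r * Real.cos θ, r * Real.sin θ)‖ ^ 2 := by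
      rw [div_le_iff₀ (by positivity)]
      linarith
    refine le_trans ?_ (mul_le_mul_of_nonneg_left h7 (by positivity))
    have h8 : (1 + r ^ 2) ^ m ≤ 2 ^ m * (r ^ 2) ^ m := by
      rw [← mul_pow]
      exact pow_le_pow_left₀ (by positivity) (by nlinarith) m
    have h9 : (r ^ 2) ^ m ≤ (r ^ 2) ^ (j + 1) :=
      pow_le_pow_right₀ (by nlinarith) hmj
    have h10 : (1 + r ^ 2) ^ m ≤ 2 ^ m * (r ^ 2) ^ (j + 1) :=
      h8.trans (mul_le_mul_of_nonneg_left h9 (by positivity))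
    rw [hδ, div_mul_div_comm, ← div_eq_mul_inv, div_div, div_div, div_le_div_iff₀
      (by positivity) (by positivity)]
    calc c ^ 2 * ((1 + r ^ 2) ^ m * (2 * Real.pi))
        ≤ c ^ 2 * ((2 ^ m * (r ^ 2) ^ (j + 1)) * (2 * Real.pi)) := by gcongr
      _ = _ := by ring
  have h5 := h4.const_mul δ⁻¹
  refine (integrable_congr (ae_of_all _ fun r => ?_)).1 h5
  field_simp

open Complex in
theorem circleMode_entire {H : ℂ → ℂ} (hH : Differentiable ℂ H) (j : ℕ) {R : ℝ} (hR : 0 < R) :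
    circleMode (fun p => H ⟨p.1, p.2⟩) j R
      = 2 * Real.pi / j.factorial * R ^ j * iteratedDeriv j H 0 := by
  have h := (hH.diffContOnCl (s := Metric.ball 0 R)).circleIntegral_one_div_sub_center_pow_smul
    hR j
  set u : ℝ → ℂ := fun θ => H (circleMap 0 R θ) * exp (-(j * θ) * I) with hu
  have hper : Function.Periodic u (2 * Real.pi) := by
    intro θ
    simp only [hu]
    rw [periodic_circleMap]
    congr 1
    have : -((j : ℂ) * ((θ + 2 * Real.pi : ℝ) : ℂ)) * I
        = -(j * θ) * I - (j : ℤ) * (2 * Real.pi * I) := by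
      push_cast; ring
    rw [this, exp_periodic.sub_int_mul_eq]
  have h1 : circleMode (fun p => H ⟨p.1, p.2⟩) j R = ∫ θ in (0 : ℝ)..2 * Real.pi, u θ := by
    have h2 := hper.intervalIntegral_add_eq (-Real.pi) 0
    rw [zero_add, show -Real.pi + 2 * Real.pi = Real.pi by ring] at h2
    rw [← h2, circleMode]
    congr 1
    funext θ
    simp only [hu]
    have : circleMap 0 R θ = ⟨R * Real.cos θ, R * Real.sin θ⟩ := by
      apply Complex.ext <;> simp [circleMap, exp_ofReal_mul_I_re, exp_ofReal_mul_I_im]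
    rw [this]
    simp
  have h3 : (∮ z in C(0, R), (1 / (z - 0) ^ (j + 1)) • H z) = I / R ^ j * circleMode
      (fun p => H ⟨p.1, p.2⟩) j R := by
    rw [h1, circleIntegral, ← intervalIntegral.integral_const_mul]
    congr 1
    funext θ
    have hR' : (R : ℂ) ≠ 0 := by exact_mod_cast hR.ne'
    simp only [hu, deriv_circleMap, smul_eq_mul, sub_zero]
    have e1 : exp (-(j * θ) * I) = (exp (θ * I) ^ j)⁻¹ := by
      rw [← exp_nat_mul, ← exp_neg]
      congr 1
      ring
    have e2 : circleMap 0 R θ = R * exp (θ * I) := by simp [circleMap]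
    have e3 := exp_ne_zero (θ * I)
    rw [e1, e2]
    field_simp
    ring
  rw [h3] at h
  have hR' : (R : ℂ) ≠ 0 := by exact_mod_cast hR.ne'
  have h4 := congrArg (fun z => R ^ j / I * z) h
  simp only [smul_eq_mul] at h4
  have hI := I_ne_zero
  have : (R : ℂ) ^ j / I * (I / R ^ j * circleMode (fun p => H ⟨p.1, p.2⟩) j R)
      = circleMode (fun p => H ⟨p.1, p.2⟩) j R := by
    field_simp
  rw [this] at h4
  rw [h4]
  field_simp

theorem iteratedDeriv_eq_zero_of_integrable {H : ℂ → ℂ} (hH : Differentiable ℂ H) {m j : ℕ}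
    (hmj : m ≤ j + 1)
    (hint : Integrable (fun p : ℝ × ℝ => ‖H ⟨p.1, p.2⟩‖ ^ 2 / (1 + p.1 ^ 2 + p.2 ^ 2) ^ m)) :
    iteratedDeriv j H 0 = 0 := by
  by_contra hne
  have hcont : Continuous (fun p : ℝ × ℝ => H ⟨p.1, p.2⟩) := by
    refine hH.continuous.comp ?_
    exact Complex.equivRealProdCLM.symm.continuous
  refine not_le_norm_circleMode hcont hmj hint j
    (c := 2 * Real.pi / j.factorial * ‖iteratedDeriv j H 0‖) (by positivity) fun R hR => ?_
  have hR0 : 0 < R := by linarith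
  rw [circleMode_entire hH j hR0]
  simp only [norm_mul, norm_div, norm_pow, Complex.norm_real, Complex.norm_natCast,
    Complex.norm_ofNat, Real.norm_eq_abs, abs_of_pos hR0, abs_of_pos Real.pi_pos]
  exact le_of_eq (by ring)

theorem eq_zero_of_fourier_modes {u : ℝ → ℂ} (hc : Continuous u)
    (hp : Function.Periodic u (2 * Real.pi))
    (h : ∀ n : ℤ, ∫ θ in (-Real.pi)..Real.pi, u θ * Complex.exp (-(n * θ) * Complex.I) = 0)
    (θ : ℝ) : u θ = 0 := by
  have : Fact (0 < 2 * Real.pi) := ⟨Real.two_pi_pos⟩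
  let f : C(AddCircle (2 * Real.pi), ℂ) :=
    ⟨hp.lift, continuous_coinduced_dom.mpr hc⟩
  have hcoef : ∀ n, fourierCoeff f n = 0 := by
    intro n
    rw [fourierCoeff_eq_intervalIntegral f n (-Real.pi),
      show -Real.pi + 2 * Real.pi = Real.pi by ring]
    refine smul_eq_zero_of_right _ ((?_ : _ = _).trans (h n))
    refine intervalIntegral.integral_congr fun x _ => ?_
    have e : f (x : AddCircle (2 * Real.pi)) = u x := hp.lift_coe x
    simp only [smul_eq_mul]
    rw [e, mul_comm, fourier_coe_apply]
    congr 2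
    have : (Real.pi : ℂ) ≠ 0 := by exact_mod_cast Real.pi_ne_zero
    push_cast
    field_simp
  have hs : Summable (fourierCoeff f) := by
    rw [funext hcoef]; exact summable_zero
  have h2 := has_pointwise_sum_fourier_series_of_summable hs (θ : AddCircle (2 * Real.pi))
  simp only [hcoef, zero_smul] at h2
  have := h2.unique hasSum_zero
  rwa [show f (θ : AddCircle (2 * Real.pi)) = u θ from hp.lift_coe θ] at this

/-- The radial derivative `r ∂_r u`. -/
def radial (u : ℝ × ℝ → ℝ) (p : ℝ × ℝ) : ℝ := p.1 * pdx u p + p.2 * pdy u p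

/-- The angular derivative `∂_θ u`. -/
def angular (u : ℝ × ℝ → ℝ) (p : ℝ × ℝ) : ℝ := p.1 * pdy u p - p.2 * pdx u p

theorem ContDiff.radial_one {u : ℝ × ℝ → ℝ} (hu : ContDiff ℝ 2 u) : ContDiff ℝ 1 (radial u) := by
  have h1 := hu.pdx_one
  have h2 := hu.pdy_one
  unfold radial
  fun_prop

theorem ContDiff.angular_one {u : ℝ × ℝ → ℝ} (hu : ContDiff ℝ 2 u) :
    ContDiff ℝ 1 (angular u) := by
  have h1 := hu.pdx_one
  have h2 := hu.pdy_one
  unfold angular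
  fun_prop

theorem ContDiff.continuous_radial {u : ℝ × ℝ → ℝ} (hu : ContDiff ℝ 1 u) :
    Continuous (radial u) := by
  have h1 := hu.continuous_pdx
  have h2 := hu.continuous_pdy
  unfold radial
  fun_prop

theorem ContDiff.continuous_angular {u : ℝ × ℝ → ℝ} (hu : ContDiff ℝ 1 u) :
    Continuous (angular u) := by
  have h1 := hu.continuous_pdx
  have h2 := hu.continuous_pdy
  unfold angular
  fun_prop

theorem radial_radial_add_angular_angular {u : ℝ × ℝ → ℝ} (hu : ContDiff ℝ 2 u) (p : ℝ × ℝ) :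
    radial (radial u) p + angular (angular u) p = (p.1 ^ 2 + p.2 ^ 2) * lap u p := by
  have hx := (hu.pdx_one.differentiable (by norm_num) p).hasPD
  have hy := (hu.pdy_one.differentiable (by norm_num) p).hasPD
  have h1 : HasPD (radial u) _ _ p := ((HasPD.fst p).mul hx).add ((HasPD.snd p).mul hy)
  have h2 : HasPD (angular u) _ _ p := ((HasPD.fst p).mul hy).sub ((HasPD.snd p).mul hx)
  rw [radial, angular, h1.pdx_eq, h1.pdy_eq, h2.pdx_eq, h2.pdy_eq, pdx_pdy_comm hu, lap]
  ring

theorem hasDerivAt_comp_polar_log {u : ℝ × ℝ → ℝ} (hu : ContDiff ℝ 1 u) (t θ : ℝ) :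
    HasDerivAt (fun s => u (Real.exp s * Real.cos θ, Real.exp s * Real.sin θ))
      (radial u (Real.exp t * Real.cos θ, Real.exp t * Real.sin θ)) t := by
  have h1 : HasFDerivAt u _ (Real.exp t * Real.cos θ, Real.exp t * Real.sin θ) :=
    (hu.differentiable (by norm_num) _).hasPD
  have h2 := ((Real.hasDerivAt_exp t).mul_const (Real.cos θ)).prodMk
    ((Real.hasDerivAt_exp t).mul_const (Real.sin θ))
  refine (h1.comp_hasDerivAt_of_eq t h2 rfl).congr_deriv ?_
  simp [radial]
  ring

theorem hasDerivAt_comp_polar_angle {u : ℝ × ℝ → ℝ} (hu : ContDiff ℝ 1 u) (R θ : ℝ) :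
    HasDerivAt (fun s => u (R * Real.cos s, R * Real.sin s))
      (angular u (R * Real.cos θ, R * Real.sin θ)) θ := by
  have h1 : HasFDerivAt u _ (R * Real.cos θ, R * Real.sin θ) :=
    (hu.differentiable (by norm_num) _).hasPD
  have h2 := ((Real.hasDerivAt_cos θ).const_mul R).prodMk ((Real.hasDerivAt_sin θ).const_mul R)
  refine (h1.comp_hasDerivAt_of_eq θ h2 rfl).congr_deriv ?_
  simp [angular]
  ring

theorem continuous_circleMode_integrand {u : ℝ × ℝ → ℝ} (hu : Continuous u) (n : ℤ) :
    Continuous (fun z : ℝ × ℝ => ((u (z.1 * Real.cos z.2, z.1 * Real.sin z.2) : ℝ) : ℂ) *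
      Complex.exp (-(n * z.2) * Complex.I)) := by
  fun_prop

theorem continuous_circleMode_integrand_right {u : ℝ × ℝ → ℝ} (hu : Continuous u) (n : ℤ)
    (R : ℝ) : Continuous (fun θ : ℝ => ((u (R * Real.cos θ, R * Real.sin θ) : ℝ) : ℂ) *
      Complex.exp (-(n * θ) * Complex.I)) :=
  (continuous_circleMode_integrand hu n).comp (continuous_const.prodMk continuous_id)

theorem hasDerivAt_circleMode {u : ℝ × ℝ → ℝ} (hu : ContDiff ℝ 1 u) (n : ℤ) (t : ℝ) :
    HasDerivAt (fun s => circleMode (fun p => (u p : ℂ)) n (Real.exp s))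
      (circleMode (fun p => (radial u p : ℂ)) n (Real.exp t)) t := by
  set K : Set (ℝ × ℝ) := Set.Icc (t - 1) (t + 1) ×ˢ Set.uIcc (-Real.pi) Real.pi
  have hK : IsCompact K := isCompact_Icc.prod isCompact_uIcc
  have hcont' := continuous_circleMode_integrand hu.continuous_radial n
  obtain ⟨C, hC⟩ := hK.exists_bound_of_continuousOn
    (f := fun z : ℝ × ℝ => ((radial u (Real.exp z.1 * Real.cos z.2,
      Real.exp z.1 * Real.sin z.2) : ℝ) : ℂ) * Complex.exp (-(n * z.2) * Complex.I))
    (hcont'.comp ((Real.continuous_exp.comp continuous_fst).prodMk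
      continuous_snd)).continuousOn
  refine (intervalIntegral.hasDerivAt_integral_of_dominated_loc_of_deriv_le
    (F := fun s θ => ((u (Real.exp s * Real.cos θ, Real.exp s * Real.sin θ) : ℝ) : ℂ) *
      Complex.exp (-(n * θ) * Complex.I))
    (F' := fun s θ => ((radial u (Real.exp s * Real.cos θ, Real.exp s * Real.sin θ) : ℝ) : ℂ) *
      Complex.exp (-(n * θ) * Complex.I))
    (s := Set.Ioo (t - 1) (t + 1)) (bound := fun _ => C)
    (Ioo_mem_nhds (by linarith) (by linarith)) ?_ ?_ ?_ ?_ ?_ ?_).2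
  · exact Filter.Eventually.of_forall fun s =>
      (continuous_circleMode_integrand_right hu.continuous n _).aestronglyMeasurable
  · exact (continuous_circleMode_integrand_right hu.continuous n _).intervalIntegrable _ _
  · exact (continuous_circleMode_integrand_right hu.continuous_radial n _).aestronglyMeasurable
  · exact ae_of_all _ fun θ hθ s hs => hC (s, θ)
      ⟨Set.Ioo_subset_Icc_self hs, Set.uIoc_subset_uIcc hθ⟩
  · exact intervalIntegrable_const
  · exact ae_of_all _ fun θ _ s _ =>
      ((hasDerivAt_comp_polar_log hu s θ).ofReal_comp).mul_const _

theorem circleMode_angular {u : ℝ × ℝ → ℝ} (hu : ContDiff ℝ 1 u) (n : ℤ) (R : ℝ) :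
    circleMode (fun p => (angular u p : ℂ)) n R
      = n * Complex.I * circleMode (fun p => (u p : ℂ)) n R := by
  have hcont := continuous_circleMode_integrand_right hu.continuous n R
  have hcont' := continuous_circleMode_integrand_right hu.continuous_angular n R
  have hd : ∀ θ : ℝ, HasDerivAt (fun s : ℝ => ((u (R * Real.cos s, R * Real.sin s) : ℝ) : ℂ)
      * Complex.exp (-(n * s) * Complex.I))
      (((angular u (R * Real.cos θ, R * Real.sin θ) : ℝ) : ℂ)
        * Complex.exp (-(n * θ) * Complex.I)
        - n * Complex.I * (((u (R * Real.cos θ, R * Real.sin θ) : ℝ) : ℂ)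
          * Complex.exp (-(n * θ) * Complex.I))) θ := by
    intro θ
    have h1 : HasDerivAt (fun s : ℝ => -((n : ℂ) * (s : ℂ)) * Complex.I)
        (-((n : ℂ) * 1) * Complex.I) θ :=
      (((hasDerivAt_id θ).ofReal_comp.const_mul (n : ℂ)).neg.mul_const Complex.I)
    refine ((hasDerivAt_comp_polar_angle hu R θ).ofReal_comp.mul h1.cexp).congr_deriv ?_
    ring
  have h2 := intervalIntegral.integral_eq_sub_of_hasDerivAt (a := -Real.pi) (b := Real.pi)
    (fun θ _ => hd θ) ((hcont'.sub (hcont.const_mul _)).intervalIntegrable _ _)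
  rw [intervalIntegral.integral_sub (hcont'.intervalIntegrable _ _)
    ((hcont.const_mul _).intervalIntegrable _ _),
    intervalIntegral.integral_const_mul] at h2
  have h3 : Complex.exp (-(n * (-Real.pi : ℝ)) * Complex.I)
      = Complex.exp (-(n * (Real.pi : ℝ)) * Complex.I) := by
    have : -((n : ℂ) * ((-Real.pi : ℝ) : ℂ)) * Complex.I
        = -(n * (Real.pi : ℝ)) * Complex.I + n * (2 * Real.pi * Complex.I) := by
      push_cast; ring
    rw [this, Complex.exp_periodic.int_mul n]
  rw [h3, Real.cos_neg, Real.sin_neg, Real.cos_pi, Real.sin_pi, neg_zero, sub_self,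
    sub_eq_zero] at h2
  exact h2

/-- The Fourier modes of an eigenfunction solve a Pöschl-Teller equation. -/
theorem hasDerivAt_circleMode_radial {f : ℝ × ℝ → ℝ} (hf : ContDiff ℝ 2 f)
    (hlap : ∀ p, lap f p = -8 * f p / (1 + p.1 ^ 2 + p.2 ^ 2) ^ 2) (n : ℤ) (t : ℝ) :
    HasDerivAt (fun s => circleMode (fun p => (radial f p : ℂ)) n (Real.exp s))
      ((((n : ℝ) ^ 2 - 8 * Real.exp t ^ 2 / (1 + Real.exp t ^ 2) ^ 2 : ℝ) : ℂ)
        * circleMode (fun p => (f p : ℂ)) n (Real.exp t)) t := by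
  refine (hasDerivAt_circleMode hf.radial_one n t).congr_deriv ?_
  set R := Real.exp t
  have hA := circleMode_angular hf.angular_one n R
  rw [circleMode_angular (hf.of_le (by norm_num)) n R] at hA
  have hsum : circleMode (fun p => (radial (radial f) p : ℂ)) n R
      + circleMode (fun p => (angular (angular f) p : ℂ)) n R
      = ((-8 * R ^ 2 / (1 + R ^ 2) ^ 2 : ℝ) : ℂ) * circleMode (fun p => (f p : ℂ)) n R := by
    rw [circleMode, circleMode, circleMode, ← intervalIntegral.integral_add,
      ← intervalIntegral.integral_const_mul]
    · refine intervalIntegral.integral_congr fun θ _ => ?_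
      have h1 := radial_radial_add_angular_angular hf (R * Real.cos θ, R * Real.sin θ)
      rw [hlap] at h1
      have e : (R * Real.cos θ) ^ 2 + (R * Real.sin θ) ^ 2 = R ^ 2 := by
        linear_combination R ^ 2 * Real.sin_sq_add_cos_sq θ
      simp only [add_assoc] at h1
      rw [e] at h1
      rw [← add_mul, ← Complex.ofReal_add, h1, ← mul_assoc, ← Complex.ofReal_mul]
      congr 2
      ring
    · exact (continuous_circleMode_integrand_right
        hf.radial_one.continuous_radial n R).intervalIntegrable _ _
    · exact (continuous_circleMode_integrand_right
        hf.angular_one.continuous_angular n R).intervalIntegrable _ _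
  rw [hA] at hsum
  have hI := Complex.I_sq
  push_cast at hsum ⊢
  linear_combination hsum - (n : ℂ) ^ 2 * circleMode (fun p => (f p : ℂ)) n R * hI

open Filter Topology Asymptotics

theorem tendsto_circleMode_mul_exp_neg {u : ℝ × ℝ → ℝ} (hu : u =o[𝓝 0] fun p => p) (n : ℤ) :
    Tendsto (fun t => circleMode (fun p => (u p : ℂ)) n (Real.exp t) * (Real.exp (-t) : ℝ))
      atBot (𝓝 0) := by
  rw [Metric.tendsto_nhds]
  intro ε hε
  have hpi := Real.pi_pos
  have h1 := hu.def (c := ε / (4 * Real.pi)) (by positivity)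
  obtain ⟨δ, hδ, h2⟩ := Metric.eventually_nhds_iff.1 h1
  have h3 : ∀ᶠ t in atBot, Real.exp t < δ := Real.tendsto_exp_atBot.eventually_lt_const hδ
  filter_upwards [h3] with t ht
  have hR := Real.exp_pos t
  have h4 : ‖circleMode (fun p => (u p : ℂ)) n (Real.exp t)‖
      ≤ (ε / (4 * Real.pi) * Real.exp t) * |Real.pi - -Real.pi| := by
    refine intervalIntegral.norm_integral_le_of_norm_le_const fun θ _ => ?_
    have h5 : ‖((Real.exp t * Real.cos θ, Real.exp t * Real.sin θ) : ℝ × ℝ)‖ ≤ Real.exp t := by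
      rw [Prod.norm_def]
      refine max_le ?_ ?_
      · simpa [abs_of_pos hR] using mul_le_of_le_one_right hR.le (Real.abs_cos_le_one θ)
      · simpa [abs_of_pos hR] using mul_le_of_le_one_right hR.le (Real.abs_sin_le_one θ)
    rw [norm_mul, norm_exp_neg_int_mul_I, mul_one, Complex.norm_real]
    refine (h2 ?_).trans (mul_le_mul_of_nonneg_left h5 (by positivity))
    rw [dist_zero_right]
    exact h5.trans_lt ht
  rw [dist_zero_right, norm_mul, Complex.norm_real, Real.norm_of_nonneg (Real.exp_pos _).le]
  rw [abs_of_pos (by linarith)] at h4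
  calc _ ≤ (ε / (4 * Real.pi) * Real.exp t) * (Real.pi - -Real.pi) * Real.exp (-t) := by gcongr
    _ = ε / 2 * (Real.exp t * Real.exp (-t)) := by field_simp; ring
    _ = ε / 2 := by rw [← Real.exp_add]; simp
    _ < ε := by linarith

theorem isLittleO_of_contDiff {u : ℝ × ℝ → ℝ} (hu : ContDiff ℝ 1 u) (h0 : u 0 = 0)
    (hx : pdx u 0 = 0) (hy : pdy u 0 = 0) : u =o[𝓝 0] fun p => p := by
  have h : HasFDerivAt u _ 0 := (hu.differentiable (by norm_num) 0).hasPD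
  rw [hx, hy, zero_smul, zero_smul, add_zero] at h
  simpa [h0] using hasFDerivAt_iff_isLittleO.1 h

theorem isLittleO_radial {u : ℝ × ℝ → ℝ} (hu : ContDiff ℝ 1 u)
    (hx : pdx u 0 = 0) (hy : pdy u 0 = 0) : radial u =o[𝓝 0] fun p => p := by
  have h1 : pdx u =o[𝓝 0] fun _ => (1 : ℝ) := by
    rw [isLittleO_one_iff, ← hx]
    exact hu.continuous_pdx.tendsto 0
  have h2 : pdy u =o[𝓝 0] fun _ => (1 : ℝ) := by
    rw [isLittleO_one_iff, ← hy]
    exact hu.continuous_pdy.tendsto 0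
  have e1 : (fun p : ℝ × ℝ => p.1) =O[𝓝 0] fun p => ‖p‖ :=
    IsBigO.of_bound 1 (Eventually.of_forall fun p => by simpa using norm_fst_le p)
  have e2 : (fun p : ℝ × ℝ => p.2) =O[𝓝 0] fun p => ‖p‖ :=
    IsBigO.of_bound 1 (Eventually.of_forall fun p => by simpa using norm_snd_le p)
  have := (e1.mul_isLittleO h1).add (e2.mul_isLittleO h2)
  simp only [mul_one] at this
  exact isLittleO_norm_right.1 this

/-- Two solutions of a linear equation with second derivative `q y`, one of size `o(eᵗ)` and the other
`O(e⁻ᵗ)` at `-∞`, have vanishing Wronskian. -/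
theorem wronskian_eq_zero {F F1 : ℝ → ℂ} {φ φ1 q : ℝ → ℝ} {C : ℝ}
    (hF : ∀ t, HasDerivAt F (F1 t) t) (hF1 : ∀ t, HasDerivAt F1 (q t * F t) t)
    (hφ : ∀ t, HasDerivAt φ (φ1 t) t) (hφ1 : ∀ t, HasDerivAt φ1 (q t * φ t) t)
    (hF0 : Tendsto (fun t => F t * (Real.exp (-t) : ℝ)) atBot (𝓝 0))
    (hF10 : Tendsto (fun t => F1 t * (Real.exp (-t) : ℝ)) atBot (𝓝 0))
    (hb : ∀ t ≤ 0, |φ t * Real.exp t| ≤ C) (hb1 : ∀ t ≤ 0, |φ1 t * Real.exp t| ≤ C) (t : ℝ) :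
    F1 t * φ t = F t * φ1 t := by
  have hd : ∀ t, HasDerivAt (fun s => F1 s * φ s - F s * φ1 s) 0 t := fun t => by
    refine (((hF1 t).mul (hφ t).ofReal_comp).sub
      ((hF t).mul (hφ1 t).ofReal_comp)).congr_deriv ?_
    push_cast
    ring
  have hconst : ∀ s, F1 s * φ s - F s * φ1 s = F1 t * φ t - F t * φ1 t := fun s =>
    is_const_of_deriv_eq_zero (f := fun s => F1 s * φ s - F s * φ1 s)
      (fun t => (hd t).differentiableAt) (fun t => (hd t).deriv) s t
  have key : ∀ {G : ℝ → ℂ} {χ : ℝ → ℝ}, Tendsto (fun t => G t * (Real.exp (-t) : ℝ)) atBot (𝓝 0) →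
      (∀ t ≤ 0, |χ t * Real.exp t| ≤ C) → Tendsto (fun t => G t * χ t) atBot (𝓝 0) := by
    intro G χ hG hχ
    have h := hG.zero_mul_isBoundedUnder_le (g := fun t => ((χ t * Real.exp t : ℝ) : ℂ)) ?_
    · refine h.congr fun t => ?_
      have : (Real.exp (-t) : ℂ) * Real.exp t = 1 := by
        rw [← Complex.ofReal_mul, ← Real.exp_add]; simp
      push_cast at this ⊢
      linear_combination (G t * χ t) * this
    · refine isBoundedUnder_of_eventually_le (a := C) ?_
      filter_upwards [eventually_le_atBot 0] with t ht
      simpa only [Function.comp_apply, Complex.norm_real, Real.norm_eq_abs] using hχ t ht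
  have hlim := (key hF10 hb).sub (key hF0 hb1)
  rw [sub_zero] at hlim
  have := tendsto_nhds_unique (hlim.congr hconst) tendsto_const_nhds
  exact sub_eq_zero.1 this.symm

/-- The factor `k - tanh t`. -/
def ptTau (k t : ℝ) : ℝ := k + (1 - Real.exp t ^ 2) / (1 + Real.exp t ^ 2)

/-- Derivative of `ptTau`. -/
def ptTau' (t : ℝ) : ℝ := -4 * Real.exp t ^ 2 / (1 + Real.exp t ^ 2) ^ 2

theorem hasDerivAt_ptTau (k t : ℝ) : HasDerivAt (ptTau k) (ptTau' t) t := by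
  have hE := Real.hasDerivAt_exp t
  have hne : 1 + Real.exp t ^ 2 ≠ 0 := by positivity
  refine ((((hE.pow 2).const_sub 1).div ((hE.pow 2).const_add 1) hne).const_add k).congr_deriv ?_
  simp only [ptTau', Pi.pow_apply]
  field_simp
  push_cast
  ring

theorem hasDerivAt_ptTau' (t : ℝ) : HasDerivAt ptTau'
    (-8 * Real.exp t ^ 2 * (1 - Real.exp t ^ 2) / (1 + Real.exp t ^ 2) ^ 3) t := by
  have hE := Real.hasDerivAt_exp t
  have hne : (1 + Real.exp t ^ 2) ^ 2 ≠ 0 := by positivity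
  have hne1 : 1 + Real.exp t ^ 2 ≠ 0 := by positivity
  refine (((hE.pow 2).const_mul (-4)).div (((hE.pow 2).const_add 1).pow 2) hne).congr_deriv ?_
  simp only [Pi.pow_apply]
  field_simp
  push_cast
  ring

theorem abs_ptTau_le {k : ℝ} (hk : 0 ≤ k) (t : ℝ) : |ptTau k t| ≤ k + 1 := by
  have hp : 0 < 1 + Real.exp t ^ 2 := by positivity
  have h : |(1 - Real.exp t ^ 2) / (1 + Real.exp t ^ 2)| ≤ 1 := by
    rw [abs_div, abs_of_pos hp, div_le_one hp, abs_le]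
    constructor <;> nlinarith [Real.exp_pos t]
  exact (abs_add_le _ _).trans (by rw [abs_of_nonneg hk]; linarith)

theorem lt_ptTau (k t : ℝ) : k - 1 < ptTau k t := by
  have hp : 0 < 1 + Real.exp t ^ 2 := by positivity
  have h : -1 < (1 - Real.exp t ^ 2) / (1 + Real.exp t ^ 2) := by
    rw [lt_div_iff₀ hp]; linarith
  unfold ptTau
  linarith

theorem abs_ptTau'_le (t : ℝ) : |ptTau' t| ≤ 1 := by
  have hp : 0 < (1 + Real.exp t ^ 2) ^ 2 := by positivity
  rw [ptTau', abs_div, abs_of_pos hp, div_le_one hp, abs_of_nonpos (by nlinarith [Real.exp_pos t])]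
  nlinarith [sq_nonneg (1 - Real.exp t ^ 2)]

theorem abs_mul_exp_le_one {t : ℝ} (ht : t ≤ 0) : |t| * Real.exp t ≤ 1 := by
  have h := Real.add_one_le_exp (-t)
  rw [abs_of_nonpos ht]
  calc -t * Real.exp t ≤ Real.exp (-t) * Real.exp t := by gcongr; linarith
    _ = 1 := by rw [← Real.exp_add]; simp

/-- The Pöschl-Teller potential. -/
def ptPot (k t : ℝ) : ℝ := k ^ 2 - 8 * Real.exp t ^ 2 / (1 + Real.exp t ^ 2) ^ 2

theorem hasDerivAt_exp_pow (k : ℕ) (t : ℝ) :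
    HasDerivAt (fun s => Real.exp s ^ k) (k * Real.exp t ^ k) t := by
  have h := (((hasDerivAt_id t).const_mul (k : ℝ)).exp)
  simp only [id, Real.exp_nat_mul, mul_one] at h
  exact h.congr_deriv (by ring)

section

variable {F F1 : ℝ → ℂ} {k : ℕ}

theorem ptSolution_wronskian
    (hF : ∀ t, HasDerivAt F (F1 t) t) (hF1 : ∀ t, HasDerivAt F1 (ptPot k t * F t) t)
    (hF0 : Tendsto (fun t => F t * (Real.exp (-t) : ℝ)) atBot (𝓝 0))
    (hF10 : Tendsto (fun t => F1 t * (Real.exp (-t) : ℝ)) atBot (𝓝 0))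
    (t : ℝ) :
    F1 t * ((Real.exp t ^ k * ptTau k t : ℝ) : ℂ)
      = F t * ((Real.exp t ^ k * (k * ptTau k t + ptTau' t) : ℝ) : ℂ) := by
  have hk : (0 : ℝ) ≤ k := k.cast_nonneg
  refine wronskian_eq_zero (C := k * (k + 1) + k + 1) hF hF1
    (φ := fun t => Real.exp t ^ k * ptTau k t)
    (φ1 := fun t => Real.exp t ^ k * (k * ptTau k t + ptTau' t)) ?_ ?_ hF0 hF10 ?_ ?_ t
  · intro t
    refine ((hasDerivAt_exp_pow k t).mul (hasDerivAt_ptTau k t)).congr_deriv ?_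
    ring
  · intro t
    refine ((hasDerivAt_exp_pow k t).mul (((hasDerivAt_ptTau k t).const_mul (k : ℝ)).add
      (hasDerivAt_ptTau' t))).congr_deriv ?_
    have hne1 : 1 + Real.exp t ^ 2 ≠ 0 := by positivity
    simp only [ptTau, ptTau', ptPot, Pi.add_apply]
    field_simp
    ring
  all_goals
    intro t ht
    have hE0 := Real.exp_pos t
    have hE : Real.exp t ^ k * Real.exp t ≤ 1 := by
      rw [← pow_succ]; exact pow_le_one₀ hE0.le (Real.exp_le_one_iff.2 ht)
    have h1 := abs_ptTau_le hk t
    have h2 := abs_ptTau'_le t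
  · rw [mul_right_comm, abs_mul, abs_of_pos (by positivity)]
    calc _ ≤ 1 * ((k : ℝ) + 1) := by gcongr
      _ ≤ _ := by nlinarith
  · rw [mul_right_comm, abs_mul, abs_of_pos (by positivity)]
    calc _ ≤ 1 * ((k : ℝ) * (k + 1) + 1) := by
          gcongr
          refine (abs_add_le _ _).trans (add_le_add ?_ h2)
          rw [abs_mul, abs_of_nonneg hk]
          gcongr
      _ ≤ _ := by nlinarith

theorem ptSolution_zero
    (hF : ∀ t, HasDerivAt F (F1 t) t) (hF1 : ∀ t, HasDerivAt F1 (ptPot k t * F t) t)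
    (hF0 : Tendsto (fun t => F t * (Real.exp (-t) : ℝ)) atBot (𝓝 0))
    (hF10 : Tendsto (fun t => F1 t * (Real.exp (-t) : ℝ)) atBot (𝓝 0))
    (hk : k = 0) (t : ℝ) : F t = 0 := by
  have h1 := ptSolution_wronskian hF hF1 hF0 hF10 t
  subst hk
  have h2 : F1 t * ((1 + t * ptTau 0 t : ℝ) : ℂ) = F t * ((ptTau 0 t + t * ptTau' t : ℝ) : ℂ) := by
    refine wronskian_eq_zero (C := 2) hF hF1
      (φ := fun t => 1 + t * ptTau 0 t)
      (φ1 := fun t => ptTau 0 t + t * ptTau' t) ?_ ?_ hF0 hF10 ?_ ?_ t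
    · intro t
      refine (((hasDerivAt_id t).mul (hasDerivAt_ptTau 0 t)).const_add 1).congr_deriv ?_
      simp
    · intro t
      refine ((hasDerivAt_ptTau 0 t).add
        ((hasDerivAt_id t).mul (hasDerivAt_ptTau' t))).congr_deriv ?_
      have hne1 : 1 + Real.exp t ^ 2 ≠ 0 := by positivity
      simp only [ptTau, ptTau', ptPot, id]
      push_cast
      field_simp
      ring
    all_goals
      intro t ht
      have hE0 := Real.exp_pos t
      have hE1 : Real.exp t ≤ 1 := Real.exp_le_one_iff.2 ht
      have h1 := abs_ptTau_le le_rfl t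
      have h2 := abs_ptTau'_le t
      have h3 := abs_mul_exp_le_one ht
      rw [abs_mul, abs_of_pos hE0]
    · calc _ ≤ (1 + |t| * (0 + 1)) * Real.exp t := by
            gcongr
            refine (abs_add_le _ _).trans (add_le_add (by simp) ?_)
            rw [abs_mul]
            gcongr
        _ ≤ 2 := by linarith
    · calc _ ≤ ((0 + 1) + |t| * 1) * Real.exp t := by
            gcongr
            refine (abs_add_le _ _).trans (add_le_add h1 ?_)
            rw [abs_mul]
            gcongr
        _ ≤ 2 := by linarith
  simp only [pow_zero, one_mul, Nat.cast_zero, zero_mul, zero_add] at h1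
  have e : (ptTau 0 t) ^ 2 - ptTau' t = 1 := by
    have hne1 : 1 + Real.exp t ^ 2 ≠ 0 := by positivity
    simp only [ptTau, ptTau']
    field_simp
    ring
  have e' : ((ptTau 0 t : ℝ) : ℂ) ^ 2 - (ptTau' t : ℝ) = 1 := by exact_mod_cast e
  push_cast at h2
  linear_combination (1 + t * (ptTau 0 t : ℂ)) * h1 - (ptTau 0 t : ℂ) * h2 - F t * e'

theorem ptSolution_eq_const_mul
    (hF : ∀ t, HasDerivAt F (F1 t) t) (hF1 : ∀ t, HasDerivAt F1 (ptPot k t * F t) t)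
    (hF0 : Tendsto (fun t => F t * (Real.exp (-t) : ℝ)) atBot (𝓝 0))
    (hF10 : Tendsto (fun t => F1 t * (Real.exp (-t) : ℝ)) atBot (𝓝 0))
    (hk : 1 ≤ k) :
    ∃ c : ℂ, ∀ t, F t = c * ((Real.exp t ^ k * ptTau k t : ℝ) : ℂ) := by
  have hk' : (1 : ℝ) ≤ k := by exact_mod_cast hk
  have hpos : ∀ t, 0 < Real.exp t ^ k * ptTau k t := fun t =>
    mul_pos (by positivity) (by linarith [lt_ptTau k t])
  have hne : ∀ t, ((Real.exp t ^ k * ptTau k t : ℝ) : ℂ) ≠ 0 := fun t => by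
    exact_mod_cast (hpos t).ne'
  have hd : ∀ t, HasDerivAt (fun s => F s / ((Real.exp s ^ k * ptTau k s : ℝ) : ℂ)) 0 t := by
    intro t
    have hφ : HasDerivAt (fun s => Real.exp s ^ k * ptTau k s)
        (Real.exp t ^ k * (k * ptTau k t + ptTau' t)) t := by
      refine ((hasDerivAt_exp_pow k t).mul (hasDerivAt_ptTau k t)).congr_deriv ?_
      ring
    refine ((hF t).div hφ.ofReal_comp (hne t)).congr_deriv ?_
    rw [ptSolution_wronskian hF hF1 hF0 hF10 t, sub_self, zero_div]
  refine ⟨F 0 / ((Real.exp 0 ^ k * ptTau k 0 : ℝ) : ℂ), fun t => ?_⟩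
  rw [← div_eq_iff (hne t)]
  exact is_const_of_deriv_eq_zero
    (f := fun s => F s / ((Real.exp s ^ k * ptTau k s : ℝ) : ℂ))
    (fun t => (hd t).differentiableAt) (fun t => (hd t).deriv) t 0

theorem ptSolution_one
    (hF : ∀ t, HasDerivAt F (F1 t) t) (hF1 : ∀ t, HasDerivAt F1 (ptPot k t * F t) t)
    (hF0 : Tendsto (fun t => F t * (Real.exp (-t) : ℝ)) atBot (𝓝 0))
    (hF10 : Tendsto (fun t => F1 t * (Real.exp (-t) : ℝ)) atBot (𝓝 0))
    (hk : k = 1) (t : ℝ) : F t = 0 := by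
  obtain ⟨c, hc⟩ := ptSolution_eq_const_mul hF hF1 hF0 hF10 hk.ge
  subst hk
  have h1 : ∀ t, F t * (Real.exp (-t) : ℝ) = c * ((ptTau 1 t : ℝ) : ℂ) := by
    intro t
    have : (Real.exp (-t) : ℂ) * Real.exp t = 1 := by
      rw [← Complex.ofReal_mul, ← Real.exp_add]; simp
    rw [hc]
    push_cast at this ⊢
    linear_combination (c * (ptTau 1 t : ℂ)) * this
  have h2 : Tendsto (ptTau 1) atBot (𝓝 (1 + (1 - 0 ^ 2) / (1 + 0 ^ 2))) :=
    (((Real.tendsto_exp_atBot.pow 2).const_sub 1).div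
      ((Real.tendsto_exp_atBot.pow 2).const_add 1) (by norm_num)).const_add 1
  have h3 := ((Complex.continuous_ofReal.tendsto _).comp h2).const_mul c
  have h4 := tendsto_nhds_unique (hF0.congr h1) h3
  have hc0 : c = 0 := by
    by_contra hne
    norm_num at h4
    exact hne h4
  rw [hc, hc0, zero_mul]

end

/-- A first-eigenfunction on the sphere vanishing to second order at a point is zero. -/
theorem eigenfunction_eq_zero {f : ℝ × ℝ → ℝ} (hf : ContDiff ℝ 2 f)
    (hlap : ∀ p, lap f p = -8 * f p / (1 + p.1 ^ 2 + p.2 ^ 2) ^ 2)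
    (hint : Integrable (fun p : ℝ × ℝ => f p ^ 2 / (1 + p.1 ^ 2 + p.2 ^ 2) ^ 2))
    (h0 : f 0 = 0) (hx : pdx f 0 = 0) (hy : pdy f 0 = 0) (p : ℝ × ℝ) : f p = 0 := by
  have hf1 : ContDiff ℝ 1 f := hf.of_le (by norm_num)
  have hmode : ∀ (n : ℤ) (t : ℝ), circleMode (fun p => (f p : ℂ)) n (Real.exp t) = 0 := by
    intro n
    set F : ℝ → ℂ := fun t => circleMode (fun p => (f p : ℂ)) n (Real.exp t) with hFdef
    have hF := hasDerivAt_circleMode hf1 n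
    have hF1 : ∀ t, HasDerivAt (fun s => circleMode (fun p => (radial f p : ℂ)) n (Real.exp s))
        (ptPot n.natAbs t * F t) t := by
      intro t
      refine (hasDerivAt_circleMode_radial hf hlap n t).congr_deriv ?_
      have : ((n.natAbs : ℝ)) ^ 2 = (n : ℝ) ^ 2 := by
        rw [Nat.cast_natAbs, Int.cast_abs, sq_abs]
      rw [ptPot, this]
    have hF0 := tendsto_circleMode_mul_exp_neg (isLittleO_of_contDiff hf1 h0 hx hy) n
    have hF10 := tendsto_circleMode_mul_exp_neg (isLittleO_radial hf1 hx hy) n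
    obtain hk | hk | hk : n.natAbs = 0 ∨ n.natAbs = 1 ∨ 2 ≤ n.natAbs := by omega
    · exact ptSolution_zero hF hF1 hF0 hF10 hk
    · exact ptSolution_one hF hF1 hF0 hF10 hk
    · obtain ⟨c, hc⟩ := ptSolution_eq_const_mul hF hF1 hF0 hF10 (by omega)
      have hk' : (2 : ℝ) ≤ n.natAbs := by exact_mod_cast hk
      suffices c = 0 by
        intro t
        have := hc t
        simp_all
      by_contra hne
      refine not_le_norm_circleMode (G := fun p => (f p : ℂ)) (m := 2) (j := n.natAbs)
        (Complex.continuous_ofReal.comp hf.continuous) (by omega) ?_ n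
        (norm_pos_iff.2 hne) fun R hR => ?_
      · simpa only [Complex.norm_real, Real.norm_eq_abs, sq_abs] using hint
      · have hR0 : 0 < R := by linarith
        have h := hc (Real.log R)
        simp only [Real.exp_log hR0] at h
        have hτ := lt_ptTau n.natAbs (Real.log R)
        rw [h, norm_mul, Complex.norm_real, Real.norm_of_nonneg (by
          exact mul_nonneg (by positivity) (by linarith))]
        have : R ^ n.natAbs * 1 ≤ R ^ n.natAbs * ptTau n.natAbs (Real.log R) := by
          gcongr
          linarith
        rw [mul_one] at this
        gcongr
  have hcirc : ∀ t θ : ℝ, f (Real.exp t * Real.cos θ, Real.exp t * Real.sin θ) = 0 := by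
    intro t θ
    have hc : Continuous fun θ : ℝ =>
        ((f (Real.exp t * Real.cos θ, Real.exp t * Real.sin θ) : ℝ) : ℂ) := by
      have := hf.continuous
      fun_prop
    have hp : Function.Periodic (fun θ : ℝ =>
        ((f (Real.exp t * Real.cos θ, Real.exp t * Real.sin θ) : ℝ) : ℂ)) (2 * Real.pi) := by
      intro θ
      simp
    exact_mod_cast eq_zero_of_fourier_modes hc hp (fun n => hmode n t) θ
  by_cases hp : p = 0
  · rw [hp, h0]
  · set z : ℂ := ⟨p.1, p.2⟩ with hz
    have hz0 : z ≠ 0 := by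
      intro h
      exact hp (Prod.ext (congrArg Complex.re h) (congrArg Complex.im h))
    have h := hcirc (Real.log ‖z‖) z.arg
    rw [Real.exp_log (norm_pos_iff.2 hz0), Complex.norm_mul_cos_arg, Complex.norm_mul_sin_arg] at h
    exact h

theorem differentiable_of_cauchyRiemann {P Q : ℝ × ℝ → ℝ}
    (h : ∀ p, ∃ a b, HasPD P a b p ∧ HasPD Q (-b) a p) :
    Differentiable ℂ (fun z : ℂ => (⟨P (z.re, z.im), Q (z.re, z.im)⟩ : ℂ)) := by
  intro z
  obtain ⟨a, b, hP, hQ⟩ := h (z.re, z.im)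
  have hz : HasFDerivAt (fun z : ℂ => (z.re, z.im))
      (Complex.reCLM.prod Complex.imCLM) z :=
    Complex.reCLM.hasFDerivAt.prodMk Complex.imCLM.hasFDerivAt
  have hP' := Complex.ofRealCLM.hasFDerivAt.comp z
    (HasFDerivAt.comp (f := fun z : ℂ => (z.re, z.im)) z hP hz)
  have hQ' := Complex.ofRealCLM.hasFDerivAt.comp z
    (HasFDerivAt.comp (f := fun z : ℂ => (z.re, z.im)) z hQ hz)
  have hf := hP'.add (hQ'.mul_const Complex.I)
  have e : (fun z : ℂ => (⟨P (z.re, z.im), Q (z.re, z.im)⟩ : ℂ))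
      = fun z : ℂ => (P (z.re, z.im) : ℂ) + (Q (z.re, z.im) : ℂ) * Complex.I :=
    funext fun z => Complex.mk_eq_add_mul_I _ _
  rw [e]
  refine (hasFDerivAt_of_restrictScalars ℝ
    (f' := ContinuousLinearMap.toSpanSingleton ℂ ((⟨a, -b⟩ : ℂ))) hf ?_).differentiableAt
  ext v
  apply Complex.ext <;> simp <;> ring

theorem iteratedDeriv_cauchyRiemann_eq_zero {P Q : ℝ × ℝ → ℝ} {m j : ℕ}
    (h : ∀ p, ∃ a b, HasPD P a b p ∧ HasPD Q (-b) a p) (hmj : m ≤ j + 1)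
    {g : ℝ × ℝ → ℝ} (hg : Integrable g)
    (hle : ∀ p, (P p ^ 2 + Q p ^ 2) / (1 + p.1 ^ 2 + p.2 ^ 2) ^ m ≤ g p) :
    iteratedDeriv j (fun z : ℂ => (⟨P (z.re, z.im), Q (z.re, z.im)⟩ : ℂ)) 0 = 0 := by
  refine iteratedDeriv_eq_zero_of_integrable (differentiable_of_cauchyRiemann h) hmj ?_
  have hPc : Continuous P := continuous_iff_continuousAt.2 fun p => by
    obtain ⟨a, b, hP, hQ⟩ := h p
    exact hP.continuousAt
  have hQc : Continuous Q := continuous_iff_continuousAt.2 fun p => by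
    obtain ⟨a, b, hP, hQ⟩ := h p
    exact hQ.continuousAt
  have e : (fun p : ℝ × ℝ => ‖(⟨P (p.1, p.2), Q (p.1, p.2)⟩ : ℂ)‖ ^ 2
      / (1 + p.1 ^ 2 + p.2 ^ 2) ^ m)
      = fun p => (P p ^ 2 + Q p ^ 2) / (1 + p.1 ^ 2 + p.2 ^ 2) ^ m := by
    funext p
    rw [Complex.sq_norm, Complex.normSq_mk]
    simp only [sq]
  change Integrable (fun p : ℝ × ℝ => ‖(⟨P (p.1, p.2), Q (p.1, p.2)⟩ : ℂ)‖ ^ 2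
      / (1 + p.1 ^ 2 + p.2 ^ 2) ^ m)
  rw [e]
  refine hg.mono' ?_ (Filter.Eventually.of_forall fun p => ?_)
  · refine Continuous.aestronglyMeasurable ?_
    exact Continuous.div (by fun_prop) (by fun_prop) fun p => pow_ne_zero m (one_add_sq_ne p)
  · have hD := one_add_sq_pos p
    rw [Real.norm_of_nonneg (by positivity)]
    exact hle p

theorem eq_quadratic_of_iteratedDeriv {H : ℂ → ℂ} (hH : Differentiable ℂ H)
    (h : ∀ j, 3 ≤ j → iteratedDeriv j H 0 = 0) :
    ∃ a₀ a₁ a₂ : ℂ, ∀ z, H z = a₀ + a₁ * z + a₂ * z ^ 2 := by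
  refine ⟨iteratedDeriv 0 H 0, iteratedDeriv 1 H 0, (Nat.factorial 2 : ℂ)⁻¹ * iteratedDeriv 2 H 0,
    fun z => ?_⟩
  have ht := Complex.taylorSeries_eq_of_entire' (c := 0) (z := z) hH
  rw [tsum_eq_sum (s := Finset.range 3) fun j hj => by
    rw [h j (by simpa using hj)]; simp] at ht
  rw [← ht]
  simp [Finset.sum_range_succ]

theorem quad_sq_le {u v : Fin 3 → ℝ} {a b : Fin 3 → ℝ} (ha : ∑ i, a i ^ 2 ≤ 4)
    (hb : ∑ i, b i ^ 2 ≤ 4) :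
    ((u 0 * a 0 + u 1 * a 1 + u 2 * a 2) + (v 0 * b 0 + v 1 * b 1 + v 2 * b 2)) ^ 2
      ≤ 8 * (∑ i, u i ^ 2 + ∑ i, v i ^ 2) := by
  have h1 := Finset.sum_mul_sq_le_sq_mul_sq Finset.univ u a
  have h2 := Finset.sum_mul_sq_le_sq_mul_sq Finset.univ v b
  have hu : 0 ≤ ∑ i, u i ^ 2 := by positivity
  have hv : 0 ≤ ∑ i, v i ^ 2 := by positivity
  have h3 := mul_le_mul_of_nonneg_left ha hu
  have h4 := mul_le_mul_of_nonneg_left hb hv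
  rw [← Fin.sum_univ_three fun i => u i * a i, ← Fin.sum_univ_three fun i => v i * b i]
  nlinarith [sq_nonneg (∑ i, u i * a i - ∑ i, v i * b i)]

theorem sum_sq_stereoX (p : ℝ × ℝ) :
    ∑ i, stereoX p i ^ 2 = 4 / (1 + p.1 ^ 2 + p.2 ^ 2) ^ 2 := by
  have hD := one_add_sq_ne p
  simp only [Fin.sum_univ_three, stereoX, Matrix.cons_val]
  field_simp
  ring

theorem sum_sq_stereoY (p : ℝ × ℝ) :
    ∑ i, stereoY p i ^ 2 = 4 / (1 + p.1 ^ 2 + p.2 ^ 2) ^ 2 := by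
  have hD := one_add_sq_ne p
  simp only [Fin.sum_univ_three, stereoY, Matrix.cons_val]
  field_simp
  ring

theorem four_div_sq_le (p : ℝ × ℝ) : 4 / (1 + p.1 ^ 2 + p.2 ^ 2) ^ 2 ≤ 4 := by
  have h : 1 ≤ (1 + p.1 ^ 2 + p.2 ^ 2) ^ 2 := one_le_pow₀ <| by
    nlinarith [sq_nonneg p.1, sq_nonneg p.2]
  exact div_le_self (by norm_num) h

theorem hopf_sq_le (w : ℝ × ℝ → Fin 3 → ℝ) (p : ℝ × ℝ) :
    hopfRe w p ^ 2 + hopfIm w p ^ 2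
      ≤ 16 * (∑ i, pdx w p i ^ 2 + ∑ i, pdy w p i ^ 2) := by
  have hX : ∑ i, stereoX p i ^ 2 ≤ 4 := (sum_sq_stereoX p).trans_le (four_div_sq_le p)
  have hY : ∑ i, stereoY p i ^ 2 ≤ 4 := (sum_sq_stereoY p).trans_le (four_div_sq_le p)
  have hY' : ∑ i, (-stereoY p) i ^ 2 ≤ 4 := by simpa using hY
  have h1 := quad_sq_le (u := pdx w p) (v := pdy w p) hX hY'
  have h2 := quad_sq_le (u := pdx w p) (v := pdy w p) hY hX
  simp only [Pi.neg_apply] at h1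
  rw [hopfRe, hopfIm]
  linarith

theorem integrable_inv_one_add_sq_sq :
    Integrable (fun p : ℝ × ℝ => 1 / (1 + p.1 ^ 2 + p.2 ^ 2) ^ 2) := by
  have h := integrable_rpow_neg_one_add_norm_sq (E := ℝ × ℝ) (μ := volume) (r := 4)
    (by simp; norm_num)
  refine h.mono' ?_ (Filter.Eventually.of_forall fun p => ?_)
  · refine Continuous.aestronglyMeasurable ?_
    exact Continuous.div (by fun_prop) (by fun_prop) fun p => pow_ne_zero 2 (one_add_sq_ne p)
  · have hD := one_add_sq_pos p
    rw [Real.norm_of_nonneg (by positivity)]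
    have hn : ‖p‖ ^ 2 ≤ p.1 ^ 2 + p.2 ^ 2 := by
      rw [Prod.norm_def]
      rcases max_cases ‖p.1‖ ‖p.2‖ with ⟨h, -⟩ | ⟨h, -⟩ <;> rw [h, Real.norm_eq_abs, sq_abs] <;>
        nlinarith [sq_nonneg p.1, sq_nonneg p.2]
    have e : (1 + ‖p‖ ^ 2) ^ (-(4 : ℝ) / 2) = 1 / (1 + ‖p‖ ^ 2) ^ 2 := by
      rw [show (-(4 : ℝ) / 2) = -((2 : ℕ) : ℝ) by norm_num, Real.rpow_neg (by positivity),
        Real.rpow_natCast, one_div]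
    rw [e]
    have : 1 + ‖p‖ ^ 2 ≤ 1 + p.1 ^ 2 + p.2 ^ 2 := by linarith
    gcongr

theorem stereo_sq_le (p : ℝ × ℝ) (i : Fin 3) : stereo p i ^ 2 ≤ 1 := by
  have hs : ∑ i, stereo p i ^ 2 = 1 := by
    have hD := one_add_sq_ne p
    simp only [Fin.sum_univ_three, stereo, Matrix.cons_val]
    field_simp
    ring
  rw [← hs]
  exact Finset.single_le_sum (f := fun i => stereo p i ^ 2) (fun _ _ => sq_nonneg _)
    (Finset.mem_univ i)

/-- The only finite energy eigenfunctions on the sphere for the first nonzero eigenvalue are the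
restrictions of linear forms. -/
theorem exists_eq_linear_of_lap {f : ℝ × ℝ → ℝ} (hf : ContDiff ℝ 2 f)
    (hlap : ∀ p, lap f p = -8 * f p / (1 + p.1 ^ 2 + p.2 ^ 2) ^ 2)
    (hint : Integrable (fun p : ℝ × ℝ => f p ^ 2 / (1 + p.1 ^ 2 + p.2 ^ 2) ^ 2)) :
    ∃ b₀ b₁ b₂ : ℝ, ∀ p, f p = b₀ * stereo p 0 + b₁ * stereo p 1 + b₂ * stereo p 2 := by
  obtain ⟨b₀, hb₀⟩ : ∃ b, b = pdx f 0 / 2 := ⟨_, rfl⟩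
  obtain ⟨b₁, hb₁⟩ : ∃ b, b = pdy f 0 / 2 := ⟨_, rfl⟩
  obtain ⟨b₂, hb₂⟩ : ∃ b, b = -f 0 := ⟨_, rfl⟩
  refine ⟨b₀, b₁, b₂, fun p => ?_⟩
  have hpd : ∀ q, HasPD (fun p => f p - (b₀ * stereo p 0 + b₁ * stereo p 1 + b₂ * stereo p 2))
      (pdx f q - (b₀ * stereoX q 0 + b₁ * stereoX q 1 + b₂ * stereoX q 2))
      (pdy f q - (b₀ * stereoY q 0 + b₁ * stereoY q 1 + b₂ * stereoY q 2)) q := fun q =>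
    ((hf.differentiable (by norm_num) q).hasPD.sub
      ((((HasPD.const b₀ q).mul (hasPD_stereo q 0)).add
        ((HasPD.const b₁ q).mul (hasPD_stereo q 1))).add
        ((HasPD.const b₂ q).mul (hasPD_stereo q 2)))).congr (by ring) (by ring)
  refine sub_eq_zero.1 (eigenfunction_eq_zero
    (f := fun p => f p - (b₀ * stereo p 0 + b₁ * stereo p 1 + b₂ * stereo p 2)) ?_ ?_ ?_ ?_ ?_ ?_ p)
  · exact hf.sub (((contDiff_const.mul (contDiff_stereo_apply 0)).add
      (contDiff_const.mul (contDiff_stereo_apply 1))).add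
      (contDiff_const.mul (contDiff_stereo_apply 2)))
  · intro q
    have hx := (hf.pdx_one.differentiable (by norm_num) q).hasPD.sub
      ((((HasPD.const b₀ q).mul (hasPD_stereoX q 0)).add
        ((HasPD.const b₁ q).mul (hasPD_stereoX q 1))).add
        ((HasPD.const b₂ q).mul (hasPD_stereoX q 2)))
    have hy := (hf.pdy_one.differentiable (by norm_num) q).hasPD.sub
      ((((HasPD.const b₀ q).mul (hasPD_stereoY q 0)).add
        ((HasPD.const b₁ q).mul (hasPD_stereoY q 1))).add
        ((HasPD.const b₂ q).mul (hasPD_stereoY q 2)))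
    rw [lap_eq_of_hasPD hpd hx hy]
    have hl := hlap q
    rw [lap] at hl
    have hs := fun i => lap_stereo_apply i q
    simp only [fun i => lap_eq_of_hasPD (fun q => hasPD_stereo q i) (hasPD_stereoX q i)
      (hasPD_stereoY q i)] at hs
    linear_combination hl - b₀ * hs 0 - b₁ * hs 1 - b₂ * hs 2
  · refine ((hint.const_mul 4).add
      (integrable_inv_one_add_sq_sq.const_mul (4 * (b₀ ^ 2 + b₁ ^ 2 + b₂ ^ 2)))).mono' ?_
      (Filter.Eventually.of_forall fun q => ?_)
    · refine Continuous.aestronglyMeasurable ?_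
      have h0 := (contDiff_stereo_apply 0).continuous
      have h1 := (contDiff_stereo_apply 1).continuous
      have h2 := (contDiff_stereo_apply 2).continuous
      have h3 := hf.continuous
      exact Continuous.div (by fun_prop) (by fun_prop) fun p => pow_ne_zero 2 (one_add_sq_ne p)
    · have hD := one_add_sq_pos q
      rw [Real.norm_of_nonneg (by positivity)]
      have h0 := mul_le_mul_of_nonneg_left (stereo_sq_le q 0) (sq_nonneg b₀)
      have h1 := mul_le_mul_of_nonneg_left (stereo_sq_le q 1) (sq_nonneg b₁)
      have h2 := mul_le_mul_of_nonneg_left (stereo_sq_le q 2) (sq_nonneg b₂)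
      have key : (f q - (b₀ * stereo q 0 + b₁ * stereo q 1 + b₂ * stereo q 2)) ^ 2
          ≤ 4 * f q ^ 2 + 4 * (b₀ ^ 2 + b₁ ^ 2 + b₂ ^ 2) := by
        nlinarith [sq_nonneg (f q + b₀ * stereo q 0), sq_nonneg (f q + b₁ * stereo q 1),
          sq_nonneg (f q + b₂ * stereo q 2), sq_nonneg (b₀ * stereo q 0 - b₁ * stereo q 1),
          sq_nonneg (b₁ * stereo q 1 - b₂ * stereo q 2),
          sq_nonneg (b₀ * stereo q 0 - b₂ * stereo q 2)]
      have := div_le_div_of_nonneg_right key (sq_nonneg (1 + q.1 ^ 2 + q.2 ^ 2))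
      refine this.trans_eq ?_
      simp only [Pi.add_apply]
      ring
  · simp [stereo, hb₂]
  · rw [(hpd 0).pdx_eq]
    simp [stereoX, hb₀]
  · rw [(hpd 0).pdy_eq]
    simp [stereoY, hb₁]

theorem contDiff_normalPart {w : ℝ × ℝ → Fin 3 → ℝ} (hw : ContDiff ℝ 2 w) :
    ContDiff ℝ 2 (normalPart w) := by
  have h := contDiff_pi.1 hw
  exact (((h 0).mul (contDiff_stereo_apply 0)).add ((h 1).mul (contDiff_stereo_apply 1))).add
    ((h 2).mul (contDiff_stereo_apply 2))

/-- Non-degeneracy of the bubble: any finite-energy solution of the linearized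
H-surface equation at the stereographic projection π is of the form
`w = c + A·π + ⟨b, π⟩·π` with `c, b ∈ ℝ³` and `A` skew-symmetric. -/
theorem statement3
    (w : ℝ × ℝ → Fin 3 → ℝ) (hw : ContDiff ℝ 2 w)
    (hgrad : Integrable (fun ξ : ℝ × ℝ => ∑ i, (pdx w ξ i) ^ 2 + ∑ i, (pdy w ξ i) ^ 2))
    (hw2 : Integrable (fun ξ : ℝ × ℝ => (∑ i, (w ξ i) ^ 2) / (1 + ξ.1 ^ 2 + ξ.2 ^ 2) ^ 2))
    (hpde : ∀ ξ : ℝ × ℝ, lap w ξ =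
      (2 : ℝ) • (cross3 (pdx w ξ) (pdy stereo ξ) + cross3 (pdx stereo ξ) (pdy w ξ))) :
    ∃ (c b : Fin 3 → ℝ) (A : Matrix (Fin 3) (Fin 3) ℝ), A.transpose = -A ∧
      ∀ ξ : ℝ × ℝ, w ξ = c + A.mulVec (stereo ξ) + (∑ i, b i * stereo ξ i) • stereo ξ := by
  have hd : Differentiable ℝ w := hw.differentiable (by norm_num)
  have hopf : ∀ p : ℝ × ℝ, hopfRe w p = 0 ∧ hopfIm w p = 0 := by
    have hCR := hopf_cauchyRiemann hw hpde
    have hz : ∀ z : ℂ, (⟨hopfRe w (z.re, z.im), hopfIm w (z.re, z.im)⟩ : ℂ) = 0 := fun z => by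
      rw [← Complex.taylorSeries_eq_of_entire' (c := 0) (z := z)
        (differentiable_of_cauchyRiemann hCR)]
      refine (tsum_congr fun j => ?_).trans tsum_zero
      rw [iteratedDeriv_cauchyRiemann_eq_zero (m := 0) hCR (Nat.zero_le _) (hgrad.const_mul 16)
        fun p => by simpa using hopf_sq_le w p]
      simp
    intro p
    have := hz ⟨p.1, p.2⟩
    exact ⟨congrArg Complex.re this, congrArg Complex.im this⟩
  have hCR := tangent_cauchyRiemann hd (fun p => (hopf p).1) (fun p => (hopf p).2)
  obtain ⟨⟨p₀, q₀⟩, ⟨p₁, q₁⟩, ⟨p₂, q₂⟩, hquad⟩ :=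
    eq_quadratic_of_iteratedDeriv (differentiable_of_cauchyRiemann hCR) fun j hj =>
      iteratedDeriv_cauchyRiemann_eq_zero (m := 4) hCR (by omega) hw2 fun p => by
        have hD := one_add_sq_pos p
        rw [sum_sq_eq w p, div_le_div_iff₀ (by positivity) (by positivity)]
        have : 0 ≤ 3 * (tangentX w p ^ 2 + tangentY w p ^ 2) * (1 + p.1 ^ 2 + p.2 ^ 2) ^ 2
            + normalPart w p ^ 2 * (1 + p.1 ^ 2 + p.2 ^ 2) ^ 4 := by positivity
        have e : 4 * (tangentX w p ^ 2 + tangentY w p ^ 2) / (1 + p.1 ^ 2 + p.2 ^ 2) ^ 2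
            * (1 + p.1 ^ 2 + p.2 ^ 2) ^ 4
            = 4 * (tangentX w p ^ 2 + tangentY w p ^ 2) * (1 + p.1 ^ 2 + p.2 ^ 2) ^ 2 := by
          field_simp
        rw [add_mul (normalPart w p ^ 2), e]
        linarith
  obtain ⟨b₀, b₁, b₂, hb⟩ := exists_eq_linear_of_lap (contDiff_normalPart hw)
    (lap_normalPart hw hpde) <| by
      refine hw2.mono' ?_ (Filter.Eventually.of_forall fun p => ?_)
      · have := (contDiff_normalPart hw).continuous
        exact (Continuous.div (by fun_prop) (by fun_prop)
          fun p => pow_ne_zero 2 (one_add_sq_ne p)).aestronglyMeasurable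
      · have hD := one_add_sq_pos p
        rw [Real.norm_of_nonneg (by positivity), sum_sq_eq w p]
        gcongr
        exact le_add_of_nonneg_right (by positivity)
  refine ⟨![p₀ - p₂, q₀ + q₂, p₁], ![b₀ - (p₀ - p₂), b₁ - (q₀ + q₂), b₂ - p₁],
    !![0, -q₁, -p₀ - p₂; q₁, 0, -q₀ + q₂; p₀ + p₂, q₀ - q₂, 0], ?_, fun p => ?_⟩
  · ext i j
    fin_cases i <;> fin_cases j <;> simp <;> ring
  · have hX : tangentX w p = p₀ + p₁ * p.1 - q₁ * p.2 + p₂ * (p.1 ^ 2 - p.2 ^ 2)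
        - 2 * q₂ * p.1 * p.2 := by
      have := congrArg Complex.re (hquad ⟨p.1, p.2⟩)
      simp [sq] at this
      linear_combination this
    have hY : tangentY w p = q₀ + q₁ * p.1 + p₁ * p.2 + q₂ * (p.1 ^ 2 - p.2 ^ 2)
        + 2 * p₂ * p.1 * p.2 := by
      have := congrArg Complex.im (hquad ⟨p.1, p.2⟩)
      simp [sq] at this
      linear_combination this
    have hD := one_add_sq_ne p
    funext i
    rw [eq_normalPart_add_tangent w p i, hb p, hX, hY]
    fin_cases i <;>
      simp only [stereo, stereoX, stereoY, Matrix.mulVec, dotProduct, Fin.sum_univ_three,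
        Fin.zero_eta, Fin.mk_one, Fin.reduceFinMk, Pi.add_apply, Pi.smul_apply, smul_eq_mul,
        Matrix.of_apply, Matrix.cons_val] <;>
      field_simp <;> ring
end
end

section
/- Let Ω ⊂ ℝ² be a nonempty bounded open simply connected set with smooth boundary and let a ∈ Ω. Assume h₁(a,·), h₂(a,·) and the regular part H(a,·) exist as in the context. Then H̃(a) = 2 e^{2 H(a,a)}. -/
noncomputable section

/-- A function is harmonic on an open set if it is C² there with vanishing Laplacian. -/
def HarmonicOnR (f : ℝ × ℝ → ℝ) (s : Set (ℝ × ℝ)) : Prop :=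
  ContDiffOn ℝ 2 f s ∧ ∀ p ∈ s, lap f p = 0

/-- A bounded open set has smooth boundary: it is the sublevel set of a smooth
defining function whose gradient does not vanish on the boundary. -/
def HasSmoothBoundary (Ω : Set (ℝ × ℝ)) : Prop :=
  ∃ ρ : ℝ × ℝ → ℝ, ContDiff ℝ (⊤ : ℕ∞) ρ ∧ Ω = {p | ρ p < 0} ∧ frontier Ω = {p | ρ p = 0} ∧
    ∀ p ∈ frontier Ω, fderiv ℝ ρ p ≠ 0

open Filter Topology Set

/-- Over a simply connected base, functions whose differences are locally constant on overlaps
can be glued, up to local constants, to one global function. -/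
theorem exists_glue_of_sub_locally_const {A G : Type*} [TopologicalSpace A]
    [SimplyConnectedSpace A] [LocallyPathConnectedSpace A] [AddCommGroup G]
    (V : A → Set A) (hV : ∀ i, IsOpen (V i)) (hmem : ∀ i, i ∈ V i) (f : A → A → G)
    (hf : ∀ i j, ∀ x ∈ V i ∩ V j, ∀ᶠ y in 𝓝 x, f i y - f j y = f i x - f j x) :
    ∃ g : A → G, ∀ x, ∃ c, ∀ᶠ y in 𝓝 x, g y = f x y + c := by
  let _ : TopologicalSpace G := ⊥
  have _ : DiscreteTopology G := ⟨rfl⟩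
  let Z : FiberBundleCore A A G :=
    { baseSet := V
      isOpen_baseSet := hV
      indexAt := id
      mem_baseSet_at := hmem
      coordChange := fun i j x v => v + (f i x - f j x)
      coordChange_self := by simp
      continuousOn_coordChange := by
        rintro i j ⟨x, v⟩ ⟨hx, -⟩
        refine ContinuousAt.continuousWithinAt ?_
        refine continuousAt_snd.add (ContinuousAt.comp (g := fun y => f i y - f j y) ?_
          continuousAt_fst)
        exact (continuousAt_const (y := f i x - f j x)).congr
          ((hf i j x hx).mono fun _ h => h.symm)
      coordChange_comp := by intros; abel }
  have hcov : IsCoveringMap Z.proj :=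
    IsCoveringMap.mk Z.proj (fun _ => G) (fun x => Z.localTriv x) fun x => hmem x
  obtain ⟨a₀⟩ : Nonempty A := inferInstance
  obtain ⟨s, ⟨-, hs⟩, -⟩ := hcov.existsUnique_continuousMap_lifts (ContinuousMap.id A) a₀
    (⟨a₀, (0 : G)⟩ : Z.TotalSpace) rfl
  have hs1 : ∀ x, (s x).1 = x := fun x => congrFun hs x
  refine ⟨fun x => f x x + (Z.localTriv x (s x)).2, fun x => ⟨(Z.localTriv x (s x)).2, ?_⟩⟩
  have hcont : ContinuousAt (fun y => (Z.localTriv x (s y)).2) x := by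
    refine continuousAt_snd.comp (ContinuousAt.comp ?_ s.continuous.continuousAt)
    refine (Z.localTriv x).toOpenPartialHomeomorph.continuousAt ?_
    rw [Z.mem_localTriv_source, hs1]
    exact hmem x
  have hev : ∀ᶠ y in 𝓝 x, (Z.localTriv x (s y)).2 = (Z.localTriv x (s x)).2 :=
    hcont.eventually_mem (s := {(Z.localTriv x (s x)).2}) (mem_nhds_discrete.2 rfl)
  filter_upwards [hev] with y hy
  rw [← hy]
  simp only [Z.localTriv_apply, Z, hs1, id]
  abel

open InnerProductSpace Complex

/-- A real harmonic function on a simply connected open subset of the plane is the real part of a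
holomorphic function. -/
theorem exists_analyticOnNhd_re_eq_of_isSimplyConnected {U : Set ℂ} (hU : IsOpen U)
    (hsc : SimplyConnectedSpace U) {f : ℂ → ℝ} (hf : HarmonicOnNhd f U) :
    ∃ F : ℂ → ℂ, AnalyticOnNhd ℂ F U ∧ ∀ z ∈ U, (F z).re = f z := by
  classical
  have hloc : ∀ z : U, ∃ r > 0, Metric.ball (z : ℂ) r ⊆ U ∧ ∃ F : ℂ → ℂ,
      AnalyticOnNhd ℂ F (Metric.ball z r) ∧ ∀ w ∈ Metric.ball (z : ℂ) r, (F w).re = f w := by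
    intro z
    obtain ⟨r, hr, hrU⟩ := Metric.isOpen_iff.1 hU z z.2
    obtain ⟨F, hF, hFf⟩ := (hf.mono hrU).exists_analyticOnNhd_ball_re_eq
    exact ⟨r, hr, hrU, F, hF, hFf⟩
  choose r hr hrU F hF hFf using hloc
  have := hU.locallyPathConnectedSpace
  have hdiff : ∀ i j : U, ∀ x ∈ (Subtype.val ⁻¹' Metric.ball (i : ℂ) (r i) ∩
      Subtype.val ⁻¹' Metric.ball (j : ℂ) (r j) : Set U),
      ∀ᶠ y : U in 𝓝 x, (F i y).im - (F j y).im = (F i x).im - (F j x).im := by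
    rintro i j x ⟨hxi, hxj⟩
    have hconn : IsConnected (Metric.ball (i : ℂ) (r i) ∩ Metric.ball (j : ℂ) (r j)) :=
      ⟨⟨x, hxi, hxj⟩, ((convex_ball _ _).inter (convex_ball _ _)).isPreconnected⟩
    obtain ⟨c, hc⟩ := AnalyticOnNhd.eq_const_of_re_eq_const (c₀ := 0)
      (((hF i).mono inter_subset_left).sub ((hF j).mono inter_subset_right))
      (fun w hw => by simp [hFf i w hw.1, hFf j w hw.2])
      (Metric.isOpen_ball.inter Metric.isOpen_ball) hconn
    have hopen : IsOpen (Subtype.val ⁻¹' (Metric.ball (i : ℂ) (r i) ∩ Metric.ball (j : ℂ) (r j)) :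
        Set U) := (Metric.isOpen_ball.inter Metric.isOpen_ball).preimage continuous_subtype_val
    filter_upwards [hopen.mem_nhds ⟨hxi, hxj⟩] with y hy
    have h1 := congrArg Complex.im (hc y hy)
    have h2 := congrArg Complex.im (hc x ⟨hxi, hxj⟩)
    simp only [Pi.sub_apply, sub_im] at h1 h2
    rw [h1, h2]
  obtain ⟨g, hg⟩ := exists_glue_of_sub_locally_const (A := U) (G := ℝ)
    (fun z => Subtype.val ⁻¹' Metric.ball (z : ℂ) (r z))
    (fun z => Metric.isOpen_ball.preimage continuous_subtype_val)
    (fun z => Metric.mem_ball_self (hr z)) (fun z w => (F z w).im) hdiff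
  refine ⟨fun z => if h : z ∈ U then f z + g ⟨z, h⟩ * I else 0, fun z hz => ?_,
    fun z hz => by simp [hz]⟩
  obtain ⟨c, hc⟩ := hg ⟨z, hz⟩
  have hc' : ∀ᶠ w in 𝓝 z, ∀ h : w ∈ U, g ⟨w, h⟩ = (F ⟨z, hz⟩ w).im + c := by
    rw [nhds_subtype_eq_comap, eventually_comap] at hc
    filter_upwards [hc] with w hw h using hw ⟨w, h⟩ rfl
  have han : AnalyticAt ℂ (fun w => F ⟨z, hz⟩ w + c * I) z :=
    (hF ⟨z, hz⟩ z (Metric.mem_ball_self (hr _))).add analyticAt_const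
  refine han.congr ?_
  filter_upwards [hc', Metric.ball_mem_nhds z (hr ⟨z, hz⟩)] with w hw hwb
  have hwU : w ∈ U := hrU ⟨z, hz⟩ hwb
  rw [dif_pos hwU, hw hwU, ← hFf ⟨z, hz⟩ w hwb]
  apply Complex.ext <;> simp

/-- A harmonic function is locally constant near a local maximum. -/
theorem InnerProductSpace.HarmonicAt.eventually_eq_of_isLocalMax {f : ℂ → ℝ} {z : ℂ}
    (hf : HarmonicAt f z) (hmax : IsLocalMax f z) : ∀ᶠ w in 𝓝 z, f w = f z := by
  obtain ⟨r, hr, hrf⟩ := Metric.eventually_nhds_iff_ball.1 hf.eventually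
  obtain ⟨F, hF, hFf⟩ := HarmonicOnNhd.exists_analyticOnNhd_ball_re_eq hrf
  have hball := Metric.ball_mem_nhds z hr
  have key : ∀ᶠ w in 𝓝 z, ‖Complex.exp (F w)‖ = ‖Complex.exp (F z)‖ := by
    refine Complex.norm_eventually_eq_of_isLocalMax (f := fun w => Complex.exp (F w)) ?_ ?_
    · filter_upwards [hball] with w hw using (hF w hw).differentiableAt.cexp
    · filter_upwards [hmax, hball] with w hw hwb
      simpa [Complex.norm_exp, show (F w).re = f w from hFf hwb,
        show (F z).re = f z from hFf (Metric.mem_ball_self hr)] using hw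
  filter_upwards [key, hball] with w hw hwb
  simpa [Complex.norm_exp, show (F w).re = f w from hFf hwb,
        show (F z).re = f z from hFf (Metric.mem_ball_self hr)] using hw

/-- A continuous function tending to zero along a filter within an open set,
extended by zero, is continuous. -/
theorem continuous_indicator_of_tendsto_frontier {X Y : Type*} [TopologicalSpace X]
    [TopologicalSpace Y] [Zero Y] {U : Set X} (hU : IsOpen U) {u : X → Y} (hu : ContinuousOn u U)
    (hb : ∀ p ∈ frontier U, Tendsto u (𝓝[U] p) (𝓝 0)) : Continuous (U.indicator u) := by
  rw [continuous_iff_continuousAt]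
  intro p
  by_cases hp : p ∈ U
  · refine (hu.continuousAt (hU.mem_nhds hp)).congr ?_
    filter_upwards [hU.mem_nhds hp] with q hq using (indicator_of_mem hq u).symm
  · rw [ContinuousAt, indicator_of_notMem hp, ← nhdsWithin_univ, ← union_compl_self U,
      nhdsWithin_union]
    refine Tendsto.sup ?_ ?_
    · by_cases hcl : p ∈ closure U
      · refine (hb p ⟨hcl, by rwa [hU.interior_eq]⟩).congr' ?_
        filter_upwards [self_mem_nhdsWithin] with q hq using (indicator_of_mem hq u).symm
      · rw [notMem_closure_iff_nhdsWithin_eq_bot.1 hcl]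
        exact tendsto_bot
    · refine tendsto_const_nhds.congr' ?_
      filter_upwards [self_mem_nhdsWithin] with q hq using (indicator_of_notMem hq u).symm

/-- The weak maximum principle for harmonic functions with zero boundary values. -/
theorem InnerProductSpace.HarmonicOnNhd.nonpos_of_tendsto_frontier {U : Set ℂ} (hU : IsOpen U)
    (hbdd : Bornology.IsBounded U) {u : ℂ → ℝ} (hu : HarmonicOnNhd u U)
    (hb : ∀ p ∈ frontier U, Tendsto u (𝓝[U] p) (𝓝 0)) {z : ℂ} (hz : z ∈ U) : u z ≤ 0 := by
  by_contra! hpos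
  have hcont := continuous_indicator_of_tendsto_frontier hU hu.continuousOn hb
  have hcs : HasCompactSupport (U.indicator u) :=
    HasCompactSupport.intro hbdd.isCompact_closure fun x hx =>
      indicator_of_notMem (fun h => hx (subset_closure h)) u
  obtain ⟨m, hm⟩ := hcont.exists_forall_ge_of_hasCompactSupport hcs
  have hMpos : 0 < U.indicator u m := by
    have := hm z
    rw [indicator_of_mem hz] at this
    linarith
  have hsub : ∀ w, U.indicator u w = U.indicator u m → w ∈ U := by
    intro w hw
    by_contra h
    rw [indicator_of_notMem h] at hw
    linarith
  have hopen : IsOpen {w | U.indicator u w = U.indicator u m} := by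
    rw [isOpen_iff_mem_nhds]
    intro w (hw : U.indicator u w = U.indicator u m)
    have hwU := hsub w hw
    have heq : ∀ᶠ y in 𝓝 w, U.indicator u y = u y := by
      filter_upwards [hU.mem_nhds hwU] with y hy using indicator_of_mem hy u
    have hmax : IsLocalMax u w := by
      filter_upwards [heq] with y hy
      rw [← hy, ← heq.self_of_nhds, hw]
      exact hm y
    filter_upwards [heq, (hu w hwU).eventually_eq_of_isLocalMax hmax] with y hy hy'
    rw [hy, hy', ← heq.self_of_nhds, hw]
  have hclopen : IsClopen {w | U.indicator u w = U.indicator u m} :=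
    ⟨isClosed_eq hcont continuous_const, hopen⟩
  have huniv := hclopen.eq_univ ⟨m, rfl⟩
  exact NormedSpace.unbounded_univ ℝ ℂ
    (hbdd.subset fun w _ => hsub w (huniv.ge (mem_univ w)))

/-- A harmonic function on a bounded open set with zero boundary values vanishes. -/
theorem InnerProductSpace.HarmonicOnNhd.eq_zero_of_tendsto_frontier {U : Set ℂ} (hU : IsOpen U)
    (hbdd : Bornology.IsBounded U) {u : ℂ → ℝ} (hu : HarmonicOnNhd u U)
    (hb : ∀ p ∈ frontier U, Tendsto u (𝓝[U] p) (𝓝 0)) {z : ℂ} (hz : z ∈ U) : u z = 0 := by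
  refine le_antisymm (hu.nonpos_of_tendsto_frontier hU hbdd hb hz) ?_
  have := hu.neg.nonpos_of_tendsto_frontier hU hbdd
    (fun p hp => by simpa [Pi.neg_def] using (hb p hp).neg) hz
  simpa using this

/-- Harmonicity on `ℝ × ℝ` in terms of partial derivatives transports to Mathlib's notion on the
complex plane. -/
theorem HarmonicOnR.harmonicOnNhd {h : ℝ × ℝ → ℝ} {Ω : Set (ℝ × ℝ)} (hΩ : IsOpen Ω)
    (hh : HarmonicOnR h Ω) :
    HarmonicOnNhd (h ∘ equivRealProdCLM) (equivRealProdCLM ⁻¹' Ω) := by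
  have hlap : ∀ z ∈ equivRealProdCLM ⁻¹' Ω, Laplacian.laplacian (h ∘ equivRealProdCLM) z = 0 := by
    intro z hz
    have hC : ContDiffAt ℝ 2 h (equivRealProdCLM z) := hh.1.contDiffAt (hΩ.mem_nhds hz)
    have hd : DifferentiableAt ℝ (fderiv ℝ h) (equivRealProdCLM z) :=
      (hC.fderiv_right (m := 1) (by norm_num)).differentiableAt (by norm_num)
    have hsecond : ∀ v, fderiv ℝ (fun q => fderiv ℝ h q v) (equivRealProdCLM z) v =
        fderiv ℝ (fderiv ℝ h) (equivRealProdCLM z) v v := by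
      intro v
      rw [fderiv_clm_apply hd (differentiableAt_const v)]
      simp
    have hiter : iteratedFDeriv ℝ 2 (h ∘ equivRealProdCLM) z =
        (iteratedFDeriv ℝ 2 h (equivRealProdCLM z)).compContinuousLinearMap
          fun _ => (equivRealProdCLM : ℂ →L[ℝ] ℝ × ℝ) := by
      simpa [iteratedFDerivWithin_univ] using
        equivRealProdCLM.iteratedFDerivWithin_comp_right h uniqueDiffOn_univ
          (x := z) (mem_univ _) 2
    have hz0 := hh.2 _ hz
    rw [lap, show pdx (pdx h) _ = _ from hsecond (1, 0),
      show pdy (pdy h) _ = _ from hsecond (0, 1)] at hz0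
    rw [laplacian_eq_iteratedFDeriv_complexPlane]
    simp only [hiter, ContinuousMultilinearMap.compContinuousLinearMap_apply,
      iteratedFDeriv_two_apply]
    simpa using hz0
  intro z hz
  have hopen : IsOpen (equivRealProdCLM ⁻¹' Ω) := hΩ.preimage equivRealProdCLM.continuous
  refine ⟨(hh.1.contDiffAt (hΩ.mem_nhds hz)).comp z equivRealProdCLM.contDiff.contDiffAt, ?_⟩
  filter_upwards [hopen.mem_nhds hz] with w hw using hlap w hw

open scoped ComplexConjugate

/-- On a bounded simply connected domain the harmonic function with boundary values `1 / (z - a)`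
splits into a holomorphic and an antiholomorphic part, the latter being a multiple of the conjugate
of the Riemann map `z ↦ (z - a) * exp (F z)`. -/
theorem exists_analyticOnNhd_add_conj_of_boundary_inv {U : Set ℂ} (hU : IsOpen U)
    (hbdd : Bornology.IsBounded U) (hsc : SimplyConnectedSpace U) {a : ℂ} (ha : a ∈ U)
    {g₁ g₂ g : ℂ → ℝ} (hg₁ : HarmonicOnNhd g₁ U) (hg₁c : ContinuousOn g₁ (closure U))
    (hg₁b : ∀ p ∈ frontier U, g₁ p = ((p - a)⁻¹).re)
    (hg₂ : HarmonicOnNhd g₂ U) (hg₂c : ContinuousOn g₂ (closure U))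
    (hg₂b : ∀ p ∈ frontier U, g₂ p = -((p - a)⁻¹).im)
    (hg : HarmonicOnNhd g U) (hgc : ContinuousOn g (closure U))
    (hgb : ∀ p ∈ frontier U, g p = -Real.log ‖p - a‖) :
    ∃ G F : ℂ → ℂ, AnalyticOnNhd ℂ G U ∧ AnalyticOnNhd ℂ F U ∧ (F a).re = g a ∧
      ∀ z ∈ U, (g₁ z : ℂ) - I * g₂ z =
        G z + cexp (F a) * conj ((z - a) * cexp (F z)) := by
  obtain ⟨F, hF, hFre⟩ := exists_analyticOnNhd_re_eq_of_isSimplyConnected hU hsc hg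
  set k : ℂ → ℂ := fun z => 1 - cexp (F a - F z) with hk
  have hkd : DifferentiableOn ℂ k U := by
    have := hF.differentiableOn
    fun_prop
  have hG : AnalyticOnNhd ℂ (dslope k a) U :=
    ((Complex.differentiableOn_dslope (hU.mem_nhds ha)).2 hkd).analyticOnNhd hU
  have hΦ : AnalyticOnNhd ℂ (fun z => (z - a) * cexp (F z)) U := fun z hz =>
    (analyticAt_id.sub analyticAt_const).mul (hF z hz).cexp
  refine ⟨dslope k a, F, hG, hF, hFre a ha, ?_⟩
  let D : ℂ → ℂ := fun z => (g₁ z : ℂ) - I * g₂ z -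
    (dslope k a z + cexp (F a) * conj ((z - a) * cexp (F z)))
  have hlim : ∀ p ∈ frontier U, Tendsto D (𝓝[U] p) (𝓝 0) := by
    intro p hp
    have hpa : p - a ≠ 0 := by
      rintro h
      rw [sub_eq_zero.1 h, hU.frontier_eq] at hp
      exact hp.2 ha
    have hpc : p ∈ closure U := frontier_subset_closure hp
    have t₁ := (hg₁c p hpc).mono_left (nhdsWithin_mono p subset_closure)
    have t₂ := (hg₂c p hpc).mono_left (nhdsWithin_mono p subset_closure)
    have t := (hgc p hpc).mono_left (nhdsWithin_mono p subset_closure)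
    have tz : Tendsto (fun z : ℂ => z - a) (𝓝[U] p) (𝓝 (p - a)) :=
      (continuous_id.sub continuous_const).continuousWithinAt
    have hnorm : Tendsto (fun z => ‖(z - a) * cexp (F z)‖) (𝓝[U] p) (𝓝 1) := by
      have h := tz.norm.mul ((Real.continuous_exp.tendsto _).comp t)
      rw [hgb p hp, Real.exp_neg, Real.exp_log (norm_pos_iff.2 hpa),
        mul_inv_cancel₀ (norm_ne_zero_iff.2 hpa)] at h
      refine h.congr' ?_
      filter_upwards [self_mem_nhdsWithin] with z hz
      rw [norm_mul, Complex.norm_exp, hFre z hz, Function.comp_apply]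
    have hfirst : Tendsto (fun z => (g₁ z : ℂ) - I * g₂ z - (z - a)⁻¹) (𝓝[U] p) (𝓝 0) := by
      have h := (((continuous_ofReal.tendsto _).comp t₁).sub
        (((continuous_ofReal.tendsto _).comp t₂).const_mul I)).sub (tz.inv₀ hpa)
      have hz : ((g₁ p : ℂ) - I * g₂ p) - (p - a)⁻¹ = 0 := by
        rw [hg₁b p hp, hg₂b p hp]
        apply Complex.ext <;> simp
      rw [hz] at h
      exact h
    have hsecond : Tendsto (fun z => ((z - a) * cexp (F z))⁻¹ - conj ((z - a) * cexp (F z)))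
        (𝓝[U] p) (𝓝 0) := by
      rw [tendsto_zero_iff_norm_tendsto_zero]
      have h : Tendsto (fun z => ‖1 - ‖(z - a) * cexp (F z)‖ ^ 2‖ / ‖(z - a) * cexp (F z)‖)
          (𝓝[U] p) (𝓝 (‖(1 : ℝ) - 1 ^ 2‖ / 1)) :=
        ((hnorm.pow 2).const_sub 1).norm.div hnorm one_ne_zero
      rw [one_pow, sub_self, norm_zero, zero_div] at h
      refine h.congr' ?_
      filter_upwards [tz.eventually_ne hpa] with z hz
      have hw : (z - a) * cexp (F z) ≠ 0 := mul_ne_zero hz (Complex.exp_ne_zero _)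
      generalize (z - a) * cexp (F z) = w at hw
      have : w⁻¹ - conj w = ((1 - ‖w‖ ^ 2 : ℝ) : ℂ) / w := by
        push_cast
        rw [← Complex.mul_conj']
        field_simp
      rw [this, norm_div, Complex.norm_real]
    have h := hfirst.add (hsecond.const_mul (cexp (F a)))
    rw [mul_zero, add_zero] at h
    refine h.congr' ?_
    filter_upwards [tz.eventually_ne hpa] with z hz
    have hza : z ≠ a := sub_ne_zero.1 hz
    have hs : dslope k a z = (z - a)⁻¹ - cexp (F a) * ((z - a) * cexp (F z))⁻¹ := by
      rw [dslope_of_ne k hza, slope_def_field]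
      simp only [hk, Complex.exp_sub]
      field_simp
      ring
    simp only [D]
    rw [hs]
    ring
  have hconj : HarmonicOnNhd (fun z => cexp (F a) * conj ((z - a) * cexp (F z))) U := fun z hz =>
    (hΦ z hz).harmonicAt_conj.comp_CLM ((ContinuousLinearMap.mul ℂ ℂ (cexp (F a))).restrictScalars ℝ)
  have hsum : HarmonicOnNhd
      (fun z => dslope k a z + cexp (F a) * conj ((z - a) * cexp (F z))) U := fun z hz =>
    (hG z hz).harmonicAt.add (hconj z hz)
  intro z hz
  have hre : (D z).re = 0 := by
    refine HarmonicOnNhd.eq_zero_of_tendsto_frontier hU hbdd (u := fun z => (D z).re) ?_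
      (fun p hp => (continuous_re.tendsto _).comp (hlim p hp)) hz
    have h := hg₁.sub (hsum.comp_CLM reCLM)
    convert h using 1
    ext w
    simp [D]
  have him : (D z).im = 0 := by
    refine HarmonicOnNhd.eq_zero_of_tendsto_frontier hU hbdd (u := fun z => (D z).im) ?_
      (fun p hp => (continuous_im.tendsto _).comp (hlim p hp)) hz
    have h := hg₂.neg.sub (hsum.comp_CLM imCLM)
    convert h using 1
    ext w
    simp [D]
  exact sub_eq_zero.1 (Complex.ext hre him)

/-- The divergence identity at `a` read off from a decomposition into a holomorphic and an
antiholomorphic part. -/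
theorem fderiv_one_add_fderiv_I_of_eq_add_conj {a : ℂ} {g₁ g₂ : ℂ → ℝ} {G F : ℂ → ℂ}
    (hG : AnalyticAt ℂ G a) (hF : AnalyticAt ℂ F a)
    (h : ∀ᶠ z in 𝓝 a, (g₁ z : ℂ) - I * g₂ z = G z + cexp (F a) * conj ((z - a) * cexp (F z))) :
    fderiv ℝ g₁ a 1 + fderiv ℝ g₂ a I = 2 * Real.exp (2 * (F a).re) := by
  have hΦ : HasDerivAt (fun z => (z - a) * cexp (F z)) (cexp (F a)) a := by
    have := ((hasDerivAt_id' a).sub_const a).fun_mul hF.differentiableAt.hasDerivAt.cexp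
    simpa using this
  have hR : HasFDerivAt (𝕜 := ℝ)
      (fun z => G z + cexp (F a) * conj ((z - a) * cexp (F z))) _ a :=
    (hG.differentiableAt.hasDerivAt.hasFDerivAt.restrictScalars ℝ).add
    ((((conjCLE : ℂ →L[ℝ] ℂ).hasFDerivAt).comp a
      (hΦ.hasFDerivAt.restrictScalars ℝ)).const_mul (cexp (F a)))
  have h₁ : g₁ =ᶠ[𝓝 a] reCLM ∘ fun z => (G z + cexp (F a) * conj ((z - a) * cexp (F z))) := by
    filter_upwards [h] with z hz
    rw [Function.comp_apply, ← hz]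
    simp
  have h₂ : g₂ =ᶠ[𝓝 a] ⇑(-imCLM) ∘ fun z => (G z + cexp (F a) * conj ((z - a) * cexp (F z))) := by
    filter_upwards [h] with z hz
    rw [Function.comp_apply, ← hz]
    simp
  rw [h₁.fderiv_eq, h₂.fderiv_eq, (reCLM.hasFDerivAt.comp a hR).fderiv,
    ((-imCLM).hasFDerivAt.comp a hR).fderiv]
  have hsq : (cexp (F a)).re ^ 2 + (cexp (F a)).im ^ 2 = Real.exp (2 * (F a).re) := by
    rw [two_mul, Real.exp_add, ← Complex.norm_exp, Complex.norm_mul_self_eq_normSq,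
      Complex.normSq_apply]
    ring
  rw [← hsq]
  simp
  ring

/-- On a simply connected domain, `H̃(a) = 2 e^{2H(a,a)}`, where `H(a,·)` is the
regular part of the Green's function and `H̃(a) = ∂ₓh₁(a,a) + ∂_yh₂(a,a)`. -/
theorem statement4
    (Ω : Set (ℝ × ℝ)) (hne : Ω.Nonempty) (hopen : IsOpen Ω)
    (hbdd : Bornology.IsBounded Ω) (hsc : SimplyConnectedSpace Ω)
    (hsmooth : HasSmoothBoundary Ω)
    (a : ℝ × ℝ) (ha : a ∈ Ω)
    (h1 h2 HH : ℝ × ℝ → ℝ)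
    (hh1harm : HarmonicOnR h1 Ω) (hh1cont : ContinuousOn h1 (closure Ω))
    (hh1bc : ∀ ξ ∈ frontier Ω,
      h1 ξ = (ξ.1 - a.1) / ((ξ.1 - a.1) ^ 2 + (ξ.2 - a.2) ^ 2))
    (hh2harm : HarmonicOnR h2 Ω) (hh2cont : ContinuousOn h2 (closure Ω))
    (hh2bc : ∀ ξ ∈ frontier Ω,
      h2 ξ = (ξ.2 - a.2) / ((ξ.1 - a.1) ^ 2 + (ξ.2 - a.2) ^ 2))
    (hHharm : HarmonicOnR HH Ω) (hHcont : ContinuousOn HH (closure Ω))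
    (hHbc : ∀ ξ ∈ frontier Ω,
      HH ξ = - Real.log (Real.sqrt ((ξ.1 - a.1) ^ 2 + (ξ.2 - a.2) ^ 2))) :
    pdx h1 a + pdy h2 a = 2 * Real.exp (2 * HH a) := by
  set e := equivRealProdCLM
  set U : Set ℂ := e ⁻¹' Ω with hUdef
  have hU : IsOpen U := hopen.preimage e.continuous
  have himage : e.symm '' Ω = U := e.symm.toEquiv.image_eq_preimage_symm Ω
  have hUb : Bornology.IsBounded U := by
    rw [← himage]
    exact e.symm.lipschitz.isBounded_image hbdd
  have hUsc : SimplyConnectedSpace U :=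
    (e.toHomeomorph.isSimplyConnected_preimage (s := Ω)).2 hsc
  have hcl : closure U = e ⁻¹' closure Ω := (e.toHomeomorph.preimage_closure Ω).symm
  have hfr : frontier U = e ⁻¹' frontier Ω := (e.toHomeomorph.preimage_frontier Ω).symm
  have hcont : ∀ {h : ℝ × ℝ → ℝ}, ContinuousOn h (closure Ω) →
      ContinuousOn (h ∘ e) (closure U) := fun hh =>
    hh.comp e.continuous.continuousOn fun z hz => by rwa [hcl] at hz
  have hbd : ∀ p ∈ frontier U, e p ∈ frontier Ω := fun p hp => by rwa [hfr] at hp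
  have hpd : ∀ (h : ℝ × ℝ → ℝ) (v : ℂ),
      fderiv ℝ (h ∘ e) (e.symm a) v = fderiv ℝ h a (e v) := by
    intro h v
    rw [e.comp_right_fderiv]
    simp
  have haU : e.symm a ∈ U := by simpa [hUdef] using ha
  have hb₁ : ∀ p ∈ frontier U, (h1 ∘ e) p = ((p - e.symm a)⁻¹).re := fun p hp => by
    rw [Function.comp_apply, hh1bc _ (hbd p hp)]
    simp [e, Complex.inv_re, Complex.normSq_apply, pow_two]
  have hb₂ : ∀ p ∈ frontier U, (h2 ∘ e) p = -((p - e.symm a)⁻¹).im := fun p hp => by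
    rw [Function.comp_apply, hh2bc _ (hbd p hp)]
    simp [e, Complex.inv_im, Complex.normSq_apply, pow_two, ← neg_div]
  have hb : ∀ p ∈ frontier U, (HH ∘ e) p = -Real.log ‖p - e.symm a‖ := fun p hp => by
    rw [Function.comp_apply, hHbc _ (hbd p hp), Complex.norm_def]
    simp [e, Complex.normSq_apply, pow_two]
  obtain ⟨G, F, hG, hF, hFa, hdec⟩ := exists_analyticOnNhd_add_conj_of_boundary_inv hU hUb hUsc haU
    (hh1harm.harmonicOnNhd hopen) (hcont hh1cont) hb₁ (hh2harm.harmonicOnNhd hopen) (hcont hh2cont)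
    hb₂ (hHharm.harmonicOnNhd hopen) (hcont hHcont) hb
  have key := fderiv_one_add_fderiv_I_of_eq_add_conj (hG _ haU) (hF _ haU)
    (eventually_of_mem (hU.mem_nhds haU) hdec)
  rw [hFa, hpd, hpd] at key
  simpa [pdx, pdy, e] using key
end
end

section
/- Let Ω ⊂ ℝ² be a nonempty bounded open set with smooth boundary, let a ∈ Ω, and let h₁(a,·), h₂(a,·), H̃(a) be as in the context. Then H̃(a) ≥ 0. -/
noncomputable section

open MeasureTheory Set Topology

theorem contDiffOn_pdx {f : ℝ × ℝ → ℝ} {s : Set (ℝ × ℝ)} {m n : WithTop ℕ∞}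
    (hf : ContDiffOn ℝ n f s) (hs : IsOpen s) (hmn : m + 1 ≤ n) : ContDiffOn ℝ m (pdx f) s :=
  (hf.fderiv_of_isOpen hs hmn).clm_apply contDiffOn_const

theorem contDiffOn_pdy {f : ℝ × ℝ → ℝ} {s : Set (ℝ × ℝ)} {m n : WithTop ℕ∞}
    (hf : ContDiffOn ℝ n f s) (hs : IsOpen s) (hmn : m + 1 ≤ n) : ContDiffOn ℝ m (pdy f) s :=
  (hf.fderiv_of_isOpen hs hmn).clm_apply contDiffOn_const

/-- Mixed second partial derivatives of a `C²` function agree. -/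
theorem pdx_pdy_comm_s9 {f : ℝ × ℝ → ℝ} {p : ℝ × ℝ} (hf : ContDiffAt ℝ 2 f p) :
    pdx (pdy f) p = pdy (pdx f) p := by
  have hd : DifferentiableAt ℝ (fderiv ℝ f) p :=
    (hf.fderiv_right (m := 1) (by norm_num)).differentiableAt (by norm_num)
  have hsymm : IsSymmSndFDerivAt ℝ f p := hf.isSymmSndFDerivAt (by simp)
  have hx := (hd.hasFDerivAt.clm_apply (hasFDerivAt_const ((0, 1) : ℝ × ℝ) p)).fderiv
  have hy := (hd.hasFDerivAt.clm_apply (hasFDerivAt_const ((1, 0) : ℝ × ℝ) p)).fderiv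
  unfold pdx pdy
  rw [hx, hy]
  simpa using hsymm (1, 0) (0, 1)

theorem contDiff_of_eq_zero_off_compact {f : ℝ × ℝ → ℝ} {Ω K : Set (ℝ × ℝ)} {n : WithTop ℕ∞}
    (hΩ : IsOpen Ω) (hK : IsCompact K) (hKΩ : K ⊆ Ω) (hf : ContDiffOn ℝ n f Ω)
    (h0 : ∀ p ∉ K, f p = 0) : ContDiff ℝ n f := by
  rw [contDiff_iff_contDiffAt]
  intro p
  by_cases hp : p ∈ K
  · exact hf.contDiffAt (hΩ.mem_nhds (hKΩ hp))
  · refine (contDiffAt_const (c := (0 : ℝ))).congr_of_eventuallyEq ?_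
    filter_upwards [hK.isClosed.isOpen_compl.mem_nhds hp] with q hq using h0 q hq

theorem integral_fderiv_apply_eq_zero {f : ℝ × ℝ → ℝ} (hf : ContDiff ℝ 1 f)
    (hc : HasCompactSupport f) (v : ℝ × ℝ) :
    Integrable (fun p => fderiv ℝ f p v) ∧ ∫ p, fderiv ℝ f p v = 0 := by
  have hint : Integrable (fun p => fderiv ℝ f p v) :=
    ((hf.continuous_fderiv (by norm_num)).clm_apply continuous_const).integrable_of_hasCompactSupport
      (hc.fderiv_apply (𝕜 := ℝ) v)
  refine ⟨hint, ?_⟩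
  have h := integral_mul_fderiv_eq_neg_fderiv_mul_of_integrable (μ := (volume : Measure (ℝ × ℝ)))
    (f := fun _ => (1 : ℝ)) (g := f) (v := v) (by simp) (by simpa using hint)
    (by simpa using hf.continuous.integrable_of_hasCompactSupport hc)
    (fun _ _ => by fun_prop) (fun x _ => hf.differentiable (by norm_num) x)
  simpa using h

/-- A smooth approximation of the identity vanishing near the origin. -/
theorem exists_smooth_truncation : ∃ (C : ℝ) (χ : ℝ → ℝ), ContDiff ℝ 2 χ ∧
    (∀ t, |t| ≤ 1 → χ t = 0) ∧ (∀ t, 0 ≤ deriv χ t ∧ deriv χ t ≤ 1) ∧ ∀ t, |χ t - t| ≤ C := by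
  set φ : ℝ → ℝ := fun t => Real.smoothTransition (t ^ 2 - 1) with hφ
  have hφs : ContDiff ℝ 1 φ := (Real.smoothTransition.contDiff (n := 1)).comp (by fun_prop)
  have hφc : Continuous φ := hφs.continuous
  have hderiv (t : ℝ) : HasDerivAt (fun x => ∫ s in (0 : ℝ)..x, φ s) (φ t) t :=
    intervalIntegral.integral_hasDerivAt_right (hφc.intervalIntegrable _ _)
      (hφc.stronglyMeasurableAtFilter _ _) hφc.continuousAt
  have hd : deriv (fun x => ∫ s in (0 : ℝ)..x, φ s) = φ := funext fun t => (hderiv t).deriv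
  have hsupp : HasCompactSupport (fun s => φ s - 1) := by
    refine HasCompactSupport.intro (isCompact_Icc (a := (-2 : ℝ)) (b := 2)) fun t ht => ?_
    have : 1 ≤ t ^ 2 - 1 := by
      by_contra! h
      exact ht ⟨by nlinarith, by nlinarith⟩
    simp [hφ, Real.smoothTransition.one_of_one_le this]
  have hint : Integrable (fun s => φ s - 1) :=
    (hφc.sub continuous_const).integrable_of_hasCompactSupport hsupp
  refine ⟨∫ s, ‖φ s - 1‖, fun x => ∫ s in (0 : ℝ)..x, φ s, ?_, ?_, ?_, ?_⟩
  · rw [show (2 : WithTop ℕ∞) = 1 + 1 by norm_num, contDiff_succ_iff_deriv]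
    exact ⟨fun t => (hderiv t).differentiableAt, by simp, by rwa [hd]⟩
  · intro t ht
    refine intervalIntegral.integral_zero_ae (Filter.Eventually.of_forall fun s hs => ?_)
    refine Real.smoothTransition.zero_of_nonpos ?_
    have h1 : |s| ≤ |t| := by
      rcases mem_uIoc.1 hs with h | h
      · rw [abs_of_pos h.1, abs_of_pos (h.1.trans_le h.2)]; exact h.2
      · rw [abs_of_nonpos h.2, abs_of_neg (h.1.trans_le h.2)]; linarith [h.1]
    nlinarith [sq_abs s, abs_nonneg s]
  · intro t
    rw [hd]
    exact ⟨Real.smoothTransition.nonneg _, Real.smoothTransition.le_one _⟩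
  · intro t
    have : (∫ s in (0 : ℝ)..t, φ s) - t = ∫ s in (0 : ℝ)..t, (φ s - 1) := by
      rw [intervalIntegral.integral_sub (hφc.intervalIntegrable _ _) (by simp)]
      simp
    rw [this, ← Real.norm_eq_abs]
    exact intervalIntegral.norm_integral_le_integral_norm_uIoc.trans
      (setIntegral_le_integral hint.norm (Filter.Eventually.of_forall fun _ => norm_nonneg _))

/-- A `C²` function vanishing on the boundary of a bounded open set is uniformly approximated by
compactly supported ones whose gradient is a contraction of the original gradient. -/
theorem exists_compact_truncation {Ω : Set (ℝ × ℝ)} (hΩ : IsOpen Ω)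
    (hb : Bornology.IsBounded Ω) {u : ℝ × ℝ → ℝ} (hu : ContDiffOn ℝ 2 u Ω)
    (hc : ContinuousOn u (closure Ω)) (hz : ∀ ξ ∈ frontier Ω, u ξ = 0) {δ : ℝ} (hδ : 0 < δ) :
    ∃ (w : ℝ × ℝ → ℝ) (K : Set (ℝ × ℝ)), IsCompact K ∧ K ⊆ Ω ∧ (∀ p ∉ K, w p = 0) ∧
      ContDiff ℝ 2 w ∧ ∀ p ∈ Ω, |w p - u p| ≤ δ ∧
        ∃ c, 0 ≤ c ∧ c ≤ 1 ∧ pdx w p = c * pdx u p ∧ pdy w p = c * pdy u p := by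
  obtain ⟨C, χ, hχ, hχ0, hχd, hχC⟩ := exists_smooth_truncation
  have hC : 0 ≤ C := (abs_nonneg _).trans (hχC 0)
  set ε : ℝ := δ / (C + 1) with hε
  have hε0 : 0 < ε := by positivity
  set w : ℝ × ℝ → ℝ := Ω.indicator fun p => ε * χ (u p / ε) with hw
  set K : Set (ℝ × ℝ) := closure Ω ∩ (fun p => |u p|) ⁻¹' Ici ε with hK
  have hKc : IsCompact K :=
    hb.isCompact_closure.of_isClosed_subset
      (hc.abs.preimage_isClosed_of_isClosed isClosed_closure isClosed_Ici) inter_subset_left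
  have hKΩ : K ⊆ Ω := by
    rintro p ⟨hp, hpε⟩
    by_contra hn
    have : p ∈ frontier Ω := by rw [hΩ.frontier_eq]; exact ⟨hp, hn⟩
    simp only [mem_preimage, hz p this, abs_zero, mem_Ici] at hpε
    linarith
  have hwΩ : ∀ p ∈ Ω, w p = ε * χ (u p / ε) := fun p hp => indicator_of_mem hp _
  have hw0 : ∀ p ∉ K, w p = 0 := by
    intro p hp
    by_cases hpΩ : p ∈ Ω
    · have hlt : |u p| < ε := by
        by_contra! h
        exact hp ⟨subset_closure hpΩ, h⟩
      rw [hwΩ p hpΩ, hχ0 _ (by rw [abs_div, abs_of_pos hε0, div_le_one hε0]; exact hlt.le),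
        mul_zero]
    · exact indicator_of_notMem hpΩ _
  have hwc : ContDiffOn ℝ 2 w Ω :=
    (contDiffOn_const.mul (hχ.comp_contDiffOn (hu.div_const ε))).congr hwΩ
  refine ⟨w, K, hKc, hKΩ, hw0, contDiff_of_eq_zero_off_compact hΩ hKc hKΩ hwc hw0,
    fun p hp => ⟨?_, deriv χ (u p / ε), (hχd _).1, (hχd _).2, ?_⟩⟩
  · have h := hχC (u p / ε)
    rw [hwΩ p hp]
    calc |ε * χ (u p / ε) - u p| = ε * |χ (u p / ε) - u p / ε| := by
          rw [← abs_of_pos hε0, ← abs_mul, abs_of_pos hε0]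
          congr 1
          field_simp
      _ ≤ ε * C := by gcongr
      _ ≤ ε * (C + 1) := by nlinarith
      _ = δ := by rw [hε]; field_simp
  · have hud : HasFDerivAt u (fderiv ℝ u p) p :=
      ((hu.contDiffAt (hΩ.mem_nhds hp)).differentiableAt (by norm_num)).hasFDerivAt
    have hχ' : HasDerivAt χ (deriv χ (u p / ε)) (u p / ε) :=
      (hχ.differentiable (by norm_num) _).hasDerivAt
    have hcomp : HasFDerivAt (fun q => ε * χ (ε⁻¹ * u q))
        (ε • (deriv χ (u p / ε) • (ε⁻¹ • fderiv ℝ u p))) p := by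
      refine HasFDerivAt.const_mul (HasDerivAt.comp_hasFDerivAt p ?_ (hud.const_mul ε⁻¹)) ε
      rwa [← div_eq_inv_mul]
    have hfd : fderiv ℝ w p = deriv χ (u p / ε) • fderiv ℝ u p := by
      have hsmul : ε • (deriv χ (u p / ε) • (ε⁻¹ • fderiv ℝ u p))
          = deriv χ (u p / ε) • fderiv ℝ u p := by
        rw [smul_comm (deriv χ (u p / ε)), smul_smul, mul_inv_cancel₀ hε0.ne', one_smul]
      rw [← hsmul, ← hcomp.fderiv]
      refine Filter.EventuallyEq.fderiv_eq ?_
      filter_upwards [hΩ.mem_nhds hp] with q hq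
      rw [hwΩ q hq, div_eq_inv_mul]
    simp [pdx, pdy, hfd]

theorem pdx_add_pdy_energy_field {u₁ u₂ w₁ w₂ μ : ℝ × ℝ → ℝ} {p : ℝ × ℝ}
    (hu₁ : ContDiffAt ℝ 2 u₁ p) (hu₂ : ContDiffAt ℝ 2 u₂ p) (hw₁ : ContDiffAt ℝ 2 w₁ p)
    (hw₂ : ContDiffAt ℝ 2 w₂ p) (hμ : ContDiffAt ℝ 1 μ p) :
    pdx (fun p => w₁ p * pdx u₁ p + w₂ p * pdx u₂ p + 2 * (w₁ p * pdy w₂ p)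
      + μ p * (4 * w₁ p - 2 * u₁ p)) p
      + pdy (fun p => w₁ p * pdy u₁ p + w₂ p * pdy u₂ p - 2 * (w₁ p * pdx w₂ p)
      + μ p * (4 * w₂ p - 2 * u₂ p)) p =
    w₁ p * lap u₁ p + w₂ p * lap u₂ p
      + (pdx w₁ p * pdx u₁ p + pdy w₁ p * pdy u₁ p) + (pdx w₂ p * pdx u₂ p + pdy w₂ p * pdy u₂ p)
      + 2 * (pdx w₁ p * pdy w₂ p - pdy w₁ p * pdx w₂ p)
      + μ p * (4 * (pdx w₁ p + pdy w₂ p) - 2 * (pdx u₁ p + pdy u₂ p))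
      + (pdx μ p * (4 * w₁ p - 2 * u₁ p) + pdy μ p * (4 * w₂ p - 2 * u₂ p)) := by
  have d {f : ℝ × ℝ → ℝ} (hf : ContDiffAt ℝ 2 f p) : HasFDerivAt f (fderiv ℝ f p) p :=
    (hf.differentiableAt (by norm_num)).hasFDerivAt
  have dx {f : ℝ × ℝ → ℝ} (hf : ContDiffAt ℝ 2 f p) :
      HasFDerivAt (pdx f) (fderiv ℝ (pdx f) p) p :=
    (((hf.fderiv_right (m := 1) (by norm_num)).differentiableAt (by norm_num)).clm_apply
      (differentiableAt_const _)).hasFDerivAt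
  have dy {f : ℝ × ℝ → ℝ} (hf : ContDiffAt ℝ 2 f p) :
      HasFDerivAt (pdy f) (fderiv ℝ (pdy f) p) p :=
    (((hf.fderiv_right (m := 1) (by norm_num)).differentiableAt (by norm_num)).clm_apply
      (differentiableAt_const _)).hasFDerivAt
  have dμ : HasFDerivAt μ (fderiv ℝ μ p) p := (hμ.differentiableAt (by norm_num)).hasFDerivAt
  have h₁ := congrArg (fun L => L (1, 0))
    (((((d hw₁).mul (dx hu₁)).add ((d hw₂).mul (dx hu₂))).add
      (((d hw₁).mul (dy hw₂)).const_mul 2)).add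
      (dμ.mul (((d hw₁).const_mul 4).sub ((d hu₁).const_mul 2)))).fderiv
  have h₂ := congrArg (fun L => L (0, 1))
    (((((d hw₁).mul (dy hu₁)).add ((d hw₂).mul (dy hu₂))).sub
      (((d hw₁).mul (dx hw₂)).const_mul 2)).add
      (dμ.mul (((d hw₂).const_mul 4).sub ((d hu₂).const_mul 2)))).fderiv
  have hcomm := pdx_pdy_comm_s9 hw₂
  refine (congrArg₂ (· + ·) h₁ h₂).trans ?_
  simp only [pdx, pdy, lap, add_apply, sub_apply, smul_apply, smul_eq_mul, Pi.sub_apply]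
    at hcomm ⊢
  linear_combination 2 * w₁ p * hcomm

/-- Let `(u₁, u₂)` vanish on `∂Ω` and satisfy `Δu = -2∇μ` for a bump `μ` supported in `Ω`. Then
`∫ μ (div u + 2μ) ≥ 0`. -/
theorem integral_bump_mul_div_nonneg {Ω : Set (ℝ × ℝ)} (hΩ : IsOpen Ω)
    (hb : Bornology.IsBounded Ω) {u₁ u₂ μ : ℝ × ℝ → ℝ}
    (hu₁ : ContDiffOn ℝ 2 u₁ Ω) (hu₂ : ContDiffOn ℝ 2 u₂ Ω)
    (hc₁ : ContinuousOn u₁ (closure Ω)) (hc₂ : ContinuousOn u₂ (closure Ω))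
    (hz₁ : ∀ ξ ∈ frontier Ω, u₁ ξ = 0) (hz₂ : ∀ ξ ∈ frontier Ω, u₂ ξ = 0)
    (hμ : ContDiff ℝ 1 μ) (hμc : HasCompactSupport μ) (hμΩ : tsupport μ ⊆ Ω)
    (hl₁ : ∀ p ∈ Ω, lap u₁ p = -2 * pdx μ p) (hl₂ : ∀ p ∈ Ω, lap u₂ p = -2 * pdy μ p) :
    0 ≤ ∫ p, μ p * (pdx u₁ p + pdy u₂ p + 2 * μ p) := by
  have hμ0 : ∀ p ∉ tsupport μ, μ p = 0 := fun p hp => image_eq_zero_of_notMem_tsupport hp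
  have hu₁x := contDiffOn_pdx (m := 1) hu₁ hΩ (by norm_num)
  have hu₁y := contDiffOn_pdy (m := 1) hu₁ hΩ (by norm_num)
  have hu₂x := contDiffOn_pdx (m := 1) hu₂ hΩ (by norm_num)
  have hu₂y := contDiffOn_pdy (m := 1) hu₂ hΩ (by norm_num)
  set B : ℝ × ℝ → ℝ := fun p => μ p * (pdx u₁ p + pdy u₂ p + 2 * μ p) with hB
  have hBint : Integrable B := by
    have hBz : ∀ p ∉ tsupport μ, B p = 0 := fun p hp => by simp [hB, hμ0 p hp]
    have hBc : ContDiffOn ℝ 1 B Ω :=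
      hμ.contDiffOn.mul ((hu₁x.add hu₂y).add (contDiffOn_const.mul hμ.contDiffOn))
    exact (contDiff_of_eq_zero_off_compact hΩ hμc hμΩ hBc
      hBz).continuous.integrable_of_hasCompactSupport (HasCompactSupport.intro hμc hBz)
  set A : ℝ × ℝ → ℝ := fun p => |pdx μ p| + |pdy μ p| with hA
  have hAint : Integrable A :=
    (integral_fderiv_apply_eq_zero hμ hμc _).1.abs.add
      (integral_fderiv_apply_eq_zero hμ hμc _).1.abs
  have hmain : ∀ δ > 0, 0 ≤ (∫ p, B p) + δ * ∫ p, A p := by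
    intro δ hδ
    obtain ⟨w₁, K₁, hK₁, hK₁Ω, hw₁0, hw₁, hw₁u⟩ :=
      exists_compact_truncation hΩ hb hu₁ hc₁ hz₁ hδ
    obtain ⟨w₂, K₂, hK₂, hK₂Ω, hw₂0, hw₂, hw₂u⟩ :=
      exists_compact_truncation hΩ hb hu₂ hc₂ hz₂ hδ
    have hw₂x := contDiffOn_pdx (m := 1) hw₂.contDiffOn hΩ (by norm_num)
    have hw₂y := contDiffOn_pdy (m := 1) hw₂.contDiffOn hΩ (by norm_num)
    set V₁ : ℝ × ℝ → ℝ := fun p => w₁ p * pdx u₁ p + w₂ p * pdx u₂ p + 2 * (w₁ p * pdy w₂ p)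
      + μ p * (4 * w₁ p - 2 * u₁ p) with hV₁
    set V₂ : ℝ × ℝ → ℝ := fun p => w₁ p * pdy u₁ p + w₂ p * pdy u₂ p - 2 * (w₁ p * pdx w₂ p)
      + μ p * (4 * w₂ p - 2 * u₂ p) with hV₂
    have hK : IsCompact (K₁ ∪ K₂ ∪ tsupport μ) := (hK₁.union hK₂).union hμc
    have hKΩ : K₁ ∪ K₂ ∪ tsupport μ ⊆ Ω := union_subset (union_subset hK₁Ω hK₂Ω) hμΩ
    have hV₁0 : ∀ p ∉ K₁ ∪ K₂ ∪ tsupport μ, V₁ p = 0 := by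
      intro p hp
      simp only [mem_union, not_or] at hp
      simp [hV₁, hw₁0 p hp.1.1, hw₂0 p hp.1.2, hμ0 p hp.2]
    have hV₂0 : ∀ p ∉ K₁ ∪ K₂ ∪ tsupport μ, V₂ p = 0 := by
      intro p hp
      simp only [mem_union, not_or] at hp
      simp [hV₂, hw₁0 p hp.1.1, hw₂0 p hp.1.2, hμ0 p hp.2]
    have hw₁' := (hw₁.of_le one_le_two).contDiffOn (s := Ω)
    have hw₂' := (hw₂.of_le one_le_two).contDiffOn (s := Ω)
    have hu₁' := hu₁.of_le one_le_two
    have hu₂' := hu₂.of_le one_le_two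
    have hμ' := hμ.contDiffOn (s := Ω)
    have hV₁c : ContDiff ℝ 1 V₁ :=
      contDiff_of_eq_zero_off_compact hΩ hK hKΩ (by fun_prop) hV₁0
    have hV₂c : ContDiff ℝ 1 V₂ :=
      contDiff_of_eq_zero_off_compact hΩ hK hKΩ (by fun_prop) hV₂0
    have hV₁i := integral_fderiv_apply_eq_zero hV₁c (HasCompactSupport.intro hK hV₁0) (1, 0)
    have hV₂i := integral_fderiv_apply_eq_zero hV₂c (HasCompactSupport.intro hK hV₂0) (0, 1)
    have hpt : ∀ p, 0 ≤ pdx V₁ p + pdy V₂ p + 2 * B p + 2 * δ * A p := by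
      intro p
      by_cases hp : p ∈ Ω
      · have hn := hΩ.mem_nhds hp
        have e : pdx V₁ p + pdy V₂ p = _ := pdx_add_pdy_energy_field (hu₁.contDiffAt hn)
          (hu₂.contDiffAt hn) hw₁.contDiffAt hw₂.contDiffAt hμ.contDiffAt
        obtain ⟨hd₁, c₁, hc₁0, hc₁1, hx₁, hy₁⟩ := hw₁u p hp
        obtain ⟨hd₂, c₂, hc₂0, hc₂1, hx₂, hy₂⟩ := hw₂u p hp
        have a₁ : 0 ≤ pdx μ p * (w₁ p - u₁ p) + δ * |pdx μ p| := by
          have := neg_abs_le (pdx μ p * (w₁ p - u₁ p))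
          rw [abs_mul] at this
          linear_combination this + mul_le_mul_of_nonneg_left hd₁ (abs_nonneg (pdx μ p))
        have a₂ : 0 ≤ pdy μ p * (w₂ p - u₂ p) + δ * |pdy μ p| := by
          have := neg_abs_le (pdy μ p * (w₂ p - u₂ p))
          rw [abs_mul] at this
          linear_combination this + mul_le_mul_of_nonneg_left hd₂ (abs_nonneg (pdy μ p))
        have g₁ : pdx w₁ p ^ 2 + pdy w₁ p ^ 2 ≤ pdx w₁ p * pdx u₁ p + pdy w₁ p * pdy u₁ p := by
          rw [hx₁, hy₁]
          linear_combination mul_nonneg (mul_nonneg hc₁0 (sub_nonneg.2 hc₁1))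
            (add_nonneg (sq_nonneg (pdx u₁ p)) (sq_nonneg (pdy u₁ p)))
        have g₂ : pdx w₂ p ^ 2 + pdy w₂ p ^ 2 ≤ pdx w₂ p * pdx u₂ p + pdy w₂ p * pdy u₂ p := by
          rw [hx₂, hy₂]
          linear_combination mul_nonneg (mul_nonneg hc₂0 (sub_nonneg.2 hc₂1))
            (add_nonneg (sq_nonneg (pdx u₂ p)) (sq_nonneg (pdy u₂ p)))
        rw [e, hl₁ p hp, hl₂ p hp]
        simp only [hA, hB]
        linear_combination g₁ + g₂ + 2 * a₁ + 2 * a₂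
          + sq_nonneg (pdx w₁ p + pdy w₂ p + 2 * μ p) + sq_nonneg (pdy w₁ p - pdx w₂ p)
      · have hpK : p ∉ K₁ ∪ K₂ ∪ tsupport μ := fun h => hp (hKΩ h)
        have hev := hK.isClosed.isOpen_compl.mem_nhds hpK
        have z₁ : fderiv ℝ V₁ p = 0 := by
          rw [Filter.EventuallyEq.fderiv_eq (f := fun _ => (0 : ℝ))
            (by filter_upwards [hev] with q hq using hV₁0 q hq)]
          simp
        have z₂ : fderiv ℝ V₂ p = 0 := by
          rw [Filter.EventuallyEq.fderiv_eq (f := fun _ => (0 : ℝ))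
            (by filter_upwards [hev] with q hq using hV₂0 q hq)]
          simp
        have hμp : μ p = 0 := hμ0 p fun h => hp (hμΩ h)
        simp only [pdx, pdy, z₁, z₂, hB, hA, hμp, zero_apply, zero_mul, mul_zero, zero_add]
        positivity
    have hi : 0 ≤ ∫ p, (pdx V₁ p + pdy V₂ p + 2 * B p + 2 * δ * A p) := integral_nonneg hpt
    have hVV : Integrable (fun p => pdx V₁ p + pdy V₂ p) := hV₁i.1.add hV₂i.1
    have hVB : Integrable (fun p => pdx V₁ p + pdy V₂ p + 2 * B p) :=
      hVV.add (hBint.const_mul 2)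
    have hV₁x : Integrable (fun p => pdx V₁ p) := hV₁i.1
    have hV₂y : Integrable (fun p => pdy V₂ p) := hV₂i.1
    rw [integral_add hVB (hAint.const_mul _),
      integral_add hVV (hBint.const_mul 2), integral_add hV₁x hV₂y,
      integral_const_mul, integral_const_mul] at hi
    have i₁ : ∫ p, pdx V₁ p = 0 := hV₁i.2
    have i₂ : ∫ p, pdy V₂ p = 0 := hV₂i.2
    rw [i₁, i₂] at hi
    linarith
  have hlim : Filter.Tendsto (fun δ : ℝ => (∫ p, B p) + δ * ∫ p, A p) (𝓝[>] 0)
      (𝓝 ((∫ p, B p) + 0 * ∫ p, A p)) :=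
    (Continuous.tendsto (by fun_prop) 0).mono_left nhdsWithin_le_nhds
  rw [zero_mul, add_zero] at hlim
  exact ge_of_tendsto hlim (by filter_upwards [self_mem_nhdsWithin] with δ hδ using hmain δ hδ)

/-- A smooth radial profile equal to `1 / s` away from the origin. -/
theorem exists_radial_profile {r : ℝ} (hr : 0 < r) : ∃ k : ℝ → ℝ, ContDiff ℝ 2 k ∧
    (∀ s, 2 * r ≤ s → k s = 1 / s) ∧ (∀ s, 0 ≤ k s + s * deriv k s) ∧
    (∀ s, 2 * r ≤ s → k s + s * deriv k s = 0) ∧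
    ∃ s, 0 < s ∧ s < 2 * r ∧ 0 < k s + s * deriv k s := by
  set M : ℝ → ℝ := fun s => Real.smoothTransition (s / r - 1) with hM
  have hMs : ContDiff ℝ 2 M := (Real.smoothTransition.contDiff (n := 2)).comp (by fun_prop)
  have hMd : Differentiable ℝ M := hMs.differentiable (by norm_num)
  have hM0 : ∀ s ≤ r, M s = 0 := fun s hs =>
    Real.smoothTransition.zero_of_nonpos (by rw [sub_nonpos, div_le_one hr]; exact hs)
  have hM1 : ∀ s, 2 * r ≤ s → M s = 1 := fun s hs =>
    Real.smoothTransition.one_of_one_le (by rw [le_sub_iff_add_le, le_div_iff₀ hr]; linarith)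
  have hmono : Monotone M := Real.smoothTransition.monotone.comp fun x y h =>
    sub_le_sub_right (div_le_div_of_nonneg_right h hr.le) 1
  set k : ℝ → ℝ := fun s => M s / s with hk
  have hks : ContDiff ℝ 2 k := by
    rw [contDiff_iff_contDiffAt]
    intro s
    rcases lt_or_ge s r with h | h
    · refine (contDiffAt_const (c := (0 : ℝ))).congr_of_eventuallyEq ?_
      filter_upwards [Iio_mem_nhds h] with t ht
      simp [hk, hM0 t (le_of_lt ht)]
    · exact hMs.contDiffAt.div contDiffAt_id (hr.trans_le h).ne'
  have hkM : M = fun s => s * k s := by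
    ext s
    rcases eq_or_ne s 0 with rfl | h
    · simp [hM0 0 hr.le]
    · simp only [hk]; field_simp
  have hd : ∀ s, k s + s * deriv k s = deriv M s := by
    intro s
    have h := ((hasDerivAt_id s).mul (hks.differentiable (by norm_num) s).hasDerivAt).deriv
    rw [hkM]
    refine (h.trans ?_).symm
    simp
  refine ⟨k, hks, fun s hs => by simp [hk, hM1 s hs], fun s => ?_, fun s hs => ?_, ?_⟩
  · rw [hd]; exact hmono.deriv_nonneg
  · rw [hd]
    refine IsLocalMax.deriv_eq_zero (Filter.Eventually.of_forall fun t => ?_)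
    rw [hM1 s hs]
    exact Real.smoothTransition.le_one _
  · obtain ⟨c, hc, hcs⟩ := exists_deriv_eq_slope M (show r < 2 * r by linarith)
      hMs.continuous.continuousOn hMd.differentiableOn
    refine ⟨c, hr.trans hc.1, hc.2, ?_⟩
    rw [hd, hcs, hM1 _ le_rfl, hM0 _ le_rfl]
    apply div_pos <;> linarith

/-- Squared Euclidean distance on `ℝ × ℝ`. -/
def sqDist (a p : ℝ × ℝ) : ℝ := (p.1 - a.1) ^ 2 + (p.2 - a.2) ^ 2

theorem contDiff_sqDist (a : ℝ × ℝ) {n : WithTop ℕ∞} : ContDiff ℝ n (sqDist a) := by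
  unfold sqDist; fun_prop

theorem pdx_eq_of_hasDerivAt {f : ℝ × ℝ → ℝ} {f' : ℝ} {p : ℝ × ℝ} (hf : DifferentiableAt ℝ f p)
    (h : HasDerivAt (fun t => f (t, p.2)) f' p.1) : pdx f p = f' :=
  (HasFDerivAt.comp_hasDerivAt (l := f) p.1 hf.hasFDerivAt
    ((hasDerivAt_id p.1).prodMk (hasDerivAt_const p.1 p.2))).unique h

theorem pdy_eq_of_hasDerivAt {f : ℝ × ℝ → ℝ} {f' : ℝ} {p : ℝ × ℝ} (hf : DifferentiableAt ℝ f p)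
    (h : HasDerivAt (fun t => f (p.1, t)) f' p.2) : pdy f p = f' :=
  (HasFDerivAt.comp_hasDerivAt (l := f) p.2 hf.hasFDerivAt
    ((hasDerivAt_const p.2 p.1).prodMk (hasDerivAt_id p.2))).unique h

theorem pdx_comp_swap (f : ℝ × ℝ → ℝ) : pdx (f ∘ Prod.swap) = pdy f ∘ Prod.swap := by
  ext p
  have h := (ContinuousLinearEquiv.prodComm ℝ ℝ ℝ).comp_right_fderiv (f := f) (x := p)
  exact congrArg (fun L => L (1, 0)) h

theorem pdy_comp_swap (f : ℝ × ℝ → ℝ) : pdy (f ∘ Prod.swap) = pdx f ∘ Prod.swap := by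
  ext p
  have h := (ContinuousLinearEquiv.prodComm ℝ ℝ ℝ).comp_right_fderiv (f := f) (x := p)
  exact congrArg (fun L => L (0, 1)) h

theorem hasDerivAt_comp_sq_add {g : ℝ → ℝ} (hg : Differentiable ℝ g) (α c x : ℝ) :
    HasDerivAt (fun t => g ((t - α) ^ 2 + c)) (deriv g ((x - α) ^ 2 + c) * (2 * (x - α))) x := by
  refine HasDerivAt.comp x (hg _).hasDerivAt ?_
  simpa using (((hasDerivAt_id x).sub_const α).pow 2).add_const c

theorem pdx_comp_sqDist {g : ℝ → ℝ} (hg : Differentiable ℝ g) (a p : ℝ × ℝ) :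
    pdx (fun p => g (sqDist a p)) p = deriv g (sqDist a p) * (2 * (p.1 - a.1)) :=
  pdx_eq_of_hasDerivAt
    (hg.comp ((contDiff_sqDist a (n := 1)).differentiable (by norm_num))).differentiableAt
    (hasDerivAt_comp_sq_add hg a.1 ((p.2 - a.2) ^ 2) p.1)

theorem pdx_fst_mul_radial {k : ℝ → ℝ} (hk : Differentiable ℝ k) (a : ℝ × ℝ) :
    pdx (fun p => (p.1 - a.1) * k (sqDist a p)) =
      fun p => k (sqDist a p) + 2 * (p.1 - a.1) ^ 2 * deriv k (sqDist a p) := by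
  have hs := (contDiff_sqDist a (n := 1)).differentiable (by norm_num)
  ext p
  refine pdx_eq_of_hasDerivAt (by fun_prop) ?_
  refine (((hasDerivAt_id p.1).sub_const a.1).mul
    (hasDerivAt_comp_sq_add hk a.1 ((p.2 - a.2) ^ 2) p.1)).congr_deriv ?_
  simp only [sqDist, id]
  ring

theorem pdy_fst_mul_radial {k : ℝ → ℝ} (hk : Differentiable ℝ k) (a : ℝ × ℝ) :
    pdy (fun p => (p.1 - a.1) * k (sqDist a p)) =
      fun p => 2 * (p.1 - a.1) * ((p.2 - a.2) * deriv k (sqDist a p)) := by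
  have hs := (contDiff_sqDist a (n := 1)).differentiable (by norm_num)
  ext p
  refine pdy_eq_of_hasDerivAt (by fun_prop) ?_
  have h := (hasDerivAt_comp_sq_add hk a.2 ((p.1 - a.1) ^ 2) p.2).const_mul (p.1 - a.1)
  simp only [sqDist, add_comm ((p.1 - a.1) ^ 2)]
  exact h.congr_deriv (by ring)

/-- The field `(x - a) k(|x - a|²)` has Laplacian `2 ∇(k + s k')`; first component. -/
theorem lap_fst_mul_radial {k : ℝ → ℝ} (hk : ContDiff ℝ 2 k) (a p : ℝ × ℝ) :
    lap (fun p => (p.1 - a.1) * k (sqDist a p)) p =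
      2 * pdx (fun p => k (sqDist a p) + sqDist a p * deriv k (sqDist a p)) p := by
  have hs := (contDiff_sqDist a (n := 1)).differentiable (by norm_num)
  have hk1 : Differentiable ℝ k := hk.differentiable (by norm_num)
  have hk' : ContDiff ℝ 1 (deriv k) := by
    rw [show (2 : WithTop ℕ∞) = 1 + 1 by norm_num, contDiff_succ_iff_deriv] at hk
    exact hk.2.2
  have hk2 : Differentiable ℝ (deriv k) := hk'.differentiable (by norm_num)
  have hμ : pdx (fun p => k (sqDist a p) + sqDist a p * deriv k (sqDist a p)) p = _ :=
    pdx_comp_sqDist (g := fun s => k s + s * deriv k s) (by fun_prop) a p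
  have hm : deriv (fun s => k s + s * deriv k s) (sqDist a p) =
      2 * deriv k (sqDist a p) + sqDist a p * deriv (deriv k) (sqDist a p) := by
    refine (((hk1 _).hasDerivAt).add
      ((hasDerivAt_id _).mul (hk2 (sqDist a p)).hasDerivAt)).deriv.trans ?_
    ring
  have hxx : pdx (fun p => k (sqDist a p) + 2 * (p.1 - a.1) ^ 2 * deriv k (sqDist a p)) p =
      6 * (p.1 - a.1) * deriv k (sqDist a p)
        + 4 * (p.1 - a.1) ^ 3 * deriv (deriv k) (sqDist a p) := by
    refine pdx_eq_of_hasDerivAt (by fun_prop) ?_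
    refine ((hasDerivAt_comp_sq_add hk1 a.1 ((p.2 - a.2) ^ 2) p.1).add
      (((((hasDerivAt_id p.1).sub_const a.1).pow 2).const_mul 2).mul
      (hasDerivAt_comp_sq_add hk2 a.1 ((p.2 - a.2) ^ 2) p.1))).congr_deriv ?_
    simp only [sqDist, id]
    norm_num
    ring
  have hyy : pdy (fun p => 2 * (p.1 - a.1) * ((p.2 - a.2) * deriv k (sqDist a p))) p =
      2 * (p.1 - a.1) * deriv k (sqDist a p)
        + 4 * (p.1 - a.1) * (p.2 - a.2) ^ 2 * deriv (deriv k) (sqDist a p) := by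
    refine pdy_eq_of_hasDerivAt (by fun_prop) ?_
    have h := (((hasDerivAt_id p.2).sub_const a.2).mul
      (hasDerivAt_comp_sq_add hk2 a.2 ((p.1 - a.1) ^ 2) p.2)).const_mul (2 * (p.1 - a.1))
    simp only [sqDist, add_comm ((p.1 - a.1) ^ 2)]
    exact h.congr_deriv (by rw [id]; ring)
  rw [hμ, hm, lap, pdx_fst_mul_radial hk1, pdy_fst_mul_radial hk1, hxx, hyy, sqDist]
  ring

theorem sqDist_swap (a p : ℝ × ℝ) : sqDist a.swap p.swap = sqDist a p := by
  simp [sqDist, add_comm]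

theorem snd_mul_radial_eq_comp_swap (k : ℝ → ℝ) (a : ℝ × ℝ) :
    (fun p : ℝ × ℝ => (p.2 - a.2) * k (sqDist a p)) =
      (fun p => (p.1 - a.swap.1) * k (sqDist a.swap p)) ∘ Prod.swap := by
  ext p
  simp [sqDist_swap]

theorem pdy_snd_mul_radial {k : ℝ → ℝ} (hk : Differentiable ℝ k) (a : ℝ × ℝ) :
    pdy (fun p => (p.2 - a.2) * k (sqDist a p)) =
      fun p => k (sqDist a p) + 2 * (p.2 - a.2) ^ 2 * deriv k (sqDist a p) := by
  rw [snd_mul_radial_eq_comp_swap, pdy_comp_swap, pdx_fst_mul_radial hk]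
  ext p
  simp [sqDist_swap]

/-- The field `(x - a) k(|x - a|²)` has Laplacian `2 ∇(k + s k')`; second component. -/
theorem lap_snd_mul_radial {k : ℝ → ℝ} (hk : ContDiff ℝ 2 k) (a p : ℝ × ℝ) :
    lap (fun p => (p.2 - a.2) * k (sqDist a p)) p =
      2 * pdy (fun p => k (sqDist a p) + sqDist a p * deriv k (sqDist a p)) p := by
  have hμ : (fun p => k (sqDist a p) + sqDist a p * deriv k (sqDist a p)) =
      (fun p => k (sqDist a.swap p) + sqDist a.swap p * deriv k (sqDist a.swap p)) ∘
        Prod.swap := by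
    ext p
    simp [sqDist_swap]
  rw [hμ, snd_mul_radial_eq_comp_swap, lap, pdx_comp_swap, pdy_comp_swap, pdx_comp_swap,
    pdy_comp_swap, pdy_comp_swap, add_comm]
  exact lap_fst_mul_radial hk a.swap p.swap

theorem lap_sub {f g : ℝ × ℝ → ℝ} {p : ℝ × ℝ} (hf : ContDiffAt ℝ 2 f p)
    (hg : ContDiffAt ℝ 2 g p) : lap (fun q => f q - g q) p = lap f p - lap g p := by
  have key (v : ℝ × ℝ) : fderiv ℝ (fun q => fderiv ℝ (fun q => f q - g q) q v) p v =
      fderiv ℝ (fun q => fderiv ℝ f q v) p v - fderiv ℝ (fun q => fderiv ℝ g q v) p v := by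
    have hdf : DifferentiableAt ℝ (fun q => fderiv ℝ f q v) p :=
      ((hf.fderiv_right (m := 1) (by norm_num)).differentiableAt (by norm_num)).clm_apply
        (differentiableAt_const _)
    have hdg : DifferentiableAt ℝ (fun q => fderiv ℝ g q v) p :=
      ((hg.fderiv_right (m := 1) (by norm_num)).differentiableAt (by norm_num)).clm_apply
        (differentiableAt_const _)
    have hev : (fun q => fderiv ℝ (fun q => f q - g q) q v) =ᶠ[𝓝 p]
        fun q => fderiv ℝ f q v - fderiv ℝ g q v := by
      filter_upwards [hf.eventually (by simp), hg.eventually (by simp)] with q hfq hgq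
      rw [fderiv_fun_sub (hfq.differentiableAt (by norm_num)) (hgq.differentiableAt (by norm_num))]
      rfl
    rw [hev.fderiv_eq, fderiv_fun_sub hdf hdg]
    rfl
  have hx := key (1, 0)
  have hy := key (0, 1)
  simp only [lap, pdx, pdy] at hx hy ⊢
  unfold pdx pdy
  rw [hx, hy]
  ring

/-- On any smooth bounded domain, `H̃(a) = ∂ₓh₁(a,a) + ∂_yh₂(a,a) ≥ 0`. -/
theorem statement9
    (Ω : Set (ℝ × ℝ)) (hne : Ω.Nonempty) (hopen : IsOpen Ω)
    (hbdd : Bornology.IsBounded Ω)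
    (hsmooth : HasSmoothBoundary Ω)
    (a : ℝ × ℝ) (ha : a ∈ Ω)
    (h1 h2 : ℝ × ℝ → ℝ)
    (hh1harm : HarmonicOnR h1 Ω) (hh1cont : ContinuousOn h1 (closure Ω))
    (hh1bc : ∀ ξ ∈ frontier Ω,
      h1 ξ = (ξ.1 - a.1) / ((ξ.1 - a.1) ^ 2 + (ξ.2 - a.2) ^ 2))
    (hh2harm : HarmonicOnR h2 Ω) (hh2cont : ContinuousOn h2 (closure Ω))
    (hh2bc : ∀ ξ ∈ frontier Ω,
      h2 ξ = (ξ.2 - a.2) / ((ξ.1 - a.1) ^ 2 + (ξ.2 - a.2) ^ 2)) :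
    0 ≤ pdx h1 a + pdy h2 a := by
  by_contra! hneg
  have hdx := contDiffOn_pdx (m := 1) hh1harm.1 hopen (by norm_num)
  have hdy := contDiffOn_pdy (m := 1) hh2harm.1 hopen (by norm_num)
  have hU : Ω ∩ {p | pdx h1 p + pdy h2 p < 0} ∈ 𝓝 a :=
    Filter.inter_mem (hopen.mem_nhds ha)
      (((hdx.add hdy).continuousOn.continuousAt (hopen.mem_nhds ha)).eventually_lt
        continuousAt_const hneg)
  obtain ⟨R, hR, hRU⟩ := Metric.mem_nhds_iff.1 hU
  have hball : ∀ p, sqDist a p < R ^ 2 → p ∈ Metric.ball a R := by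
    intro p hp
    unfold sqDist at hp
    rw [Metric.mem_ball, Prod.dist_eq, max_lt_iff, Real.dist_eq, Real.dist_eq]
    exact ⟨abs_lt_of_sq_lt_sq (by nlinarith [sq_nonneg (p.2 - a.2)]) hR.le,
      abs_lt_of_sq_lt_sq (by nlinarith [sq_nonneg (p.1 - a.1)]) hR.le⟩
  set r : ℝ := R ^ 2 / 4 with hrdef
  have hr : 0 < r := by positivity
  have hrR : 2 * r < R ^ 2 := by rw [hrdef]; nlinarith
  obtain ⟨k, hk, hk1, hm0, hmz, s₀, hs₀, hs₀r, hms₀⟩ := exists_radial_profile hr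
  have hkd : Differentiable ℝ k := hk.differentiable (by norm_num)
  have hk' : ContDiff ℝ 1 (deriv k) := by
    rw [show (2 : WithTop ℕ∞) = 1 + 1 by norm_num, contDiff_succ_iff_deriv] at hk
    exact hk.2.2
  set μ : ℝ × ℝ → ℝ := fun p => k (sqDist a p) + sqDist a p * deriv k (sqDist a p) with hμdef
  set ψ₁ : ℝ × ℝ → ℝ := fun p => (p.1 - a.1) * k (sqDist a p) with hψ₁
  set ψ₂ : ℝ × ℝ → ℝ := fun p => (p.2 - a.2) * k (sqDist a p) with hψ₂
  have hψ₁s : ContDiff ℝ 2 ψ₁ :=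
    (contDiff_fst.sub contDiff_const).mul (hk.comp (contDiff_sqDist a))
  have hψ₂s : ContDiff ℝ 2 ψ₂ :=
    (contDiff_snd.sub contDiff_const).mul (hk.comp (contDiff_sqDist a))
  have hμs : ContDiff ℝ 1 μ := ((hk.of_le one_le_two).comp (contDiff_sqDist a)).add
    ((contDiff_sqDist a).mul (hk'.comp (contDiff_sqDist a)))
  have hK : IsClosed {p | sqDist a p ≤ 2 * r} :=
    isClosed_le (contDiff_sqDist a (n := 1)).continuous continuous_const
  have hKU : {p | sqDist a p ≤ 2 * r} ⊆ Ω ∩ {p | pdx h1 p + pdy h2 p < 0} :=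
    fun p hp => hRU (hball p (lt_of_le_of_lt hp hrR))
  have hKc : IsCompact {p | sqDist a p ≤ 2 * r} :=
    (isCompact_closedBall a R).of_isClosed_subset hK fun p hp =>
      Metric.ball_subset_closedBall (hball p (lt_of_le_of_lt hp hrR))
  have hμ0 : ∀ p ∉ {p | sqDist a p ≤ 2 * r}, μ p = 0 :=
    fun p hp => hmz _ (not_le.1 hp).le
  have hμc : HasCompactSupport μ := HasCompactSupport.intro hKc hμ0
  have hμK : tsupport μ ⊆ {p | sqDist a p ≤ 2 * r} :=
    closure_minimal (fun p hp => by_contra fun h => hp (hμ0 p h)) hK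
  have hfr : ∀ ξ ∈ frontier Ω, k (sqDist a ξ) = 1 / sqDist a ξ := fun ξ hξ =>
    hk1 _ (le_of_not_ge fun h => by
      rw [hopen.frontier_eq] at hξ
      exact hξ.2 (hKU h).1)
  have hpos := integral_bump_mul_div_nonneg hopen hbdd (u₁ := fun p => h1 p - ψ₁ p)
    (u₂ := fun p => h2 p - ψ₂ p) (μ := μ) (hh1harm.1.sub hψ₁s.contDiffOn)
    (hh2harm.1.sub hψ₂s.contDiffOn) (hh1cont.sub hψ₁s.continuous.continuousOn)
    (hh2cont.sub hψ₂s.continuous.continuousOn)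
    (fun ξ hξ => by simp only [hψ₁, hh1bc ξ hξ, hfr ξ hξ]; unfold sqDist; ring)
    (fun ξ hξ => by simp only [hψ₂, hh2bc ξ hξ, hfr ξ hξ]; unfold sqDist; ring)
    hμs hμc (fun p hp => (hKU (hμK hp)).1)
    (fun p hp => by
      rw [lap_sub (hh1harm.1.contDiffAt (hopen.mem_nhds hp)) hψ₁s.contDiffAt, hh1harm.2 p hp,
        show lap ψ₁ p = 2 * pdx μ p from lap_fst_mul_radial hk a p]
      ring)
    (fun p hp => by
      rw [lap_sub (hh2harm.1.contDiffAt (hopen.mem_nhds hp)) hψ₂s.contDiffAt, hh2harm.2 p hp,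
        show lap ψ₂ p = 2 * pdy μ p from lap_snd_mul_radial hk a p]
      ring)
  have hB : (fun p => μ p * (pdx (fun p => h1 p - ψ₁ p) p + pdy (fun p => h2 p - ψ₂ p) p
      + 2 * μ p)) = fun p => -(μ p * -(pdx h1 p + pdy h2 p)) := by
    ext p
    by_cases hp : p ∈ {p | sqDist a p ≤ 2 * r}
    · have hn := hopen.mem_nhds (hKU hp).1
      have e₁ : pdx (fun p => h1 p - ψ₁ p) p = pdx h1 p - pdx ψ₁ p :=
        congrArg (fun L => L (1, 0)) (fderiv_fun_sub
          ((hh1harm.1.contDiffAt hn).differentiableAt (by norm_num))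
          (hψ₁s.differentiable (by norm_num) p))
      have e₂ : pdy (fun p => h2 p - ψ₂ p) p = pdy h2 p - pdy ψ₂ p :=
        congrArg (fun L => L (0, 1)) (fderiv_fun_sub
          ((hh2harm.1.contDiffAt hn).differentiableAt (by norm_num))
          (hψ₂s.differentiable (by norm_num) p))
      rw [e₁, e₂, hψ₁, hψ₂, pdx_fst_mul_radial hkd, pdy_snd_mul_radial hkd, hμdef]
      simp only [sqDist]
      ring
    · simp [hμ0 p hp]
  rw [hB, integral_neg, neg_nonneg] at hpos
  have hG0 : ∀ p ∉ {p | sqDist a p ≤ 2 * r}, μ p * -(pdx h1 p + pdy h2 p) = 0 :=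
    fun p hp => by rw [hμ0 p hp, zero_mul]
  have hGs := contDiff_of_eq_zero_off_compact hopen hKc (fun p hp => (hKU hp).1)
    (hμs.contDiffOn.mul (hdx.add hdy).neg) hG0
  refine absurd hpos (not_le.2 ?_)
  have hq : sqDist a (a.1 + √s₀, a.2) = s₀ := by simp [sqDist, Real.sq_sqrt hs₀.le]
  refine hGs.continuous.integral_pos_of_hasCompactSupport_nonneg_nonzero (x := (a.1 + √s₀, a.2))
    (HasCompactSupport.intro hKc hG0) (fun p => ?_) ?_
  · by_cases hp : p ∈ {p | sqDist a p ≤ 2 * r}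
    · exact mul_nonneg (hm0 _) (neg_nonneg.2 (le_of_lt (hKU hp).2))
    · exact (hG0 p hp).ge
  · have hlt := (hKU (show sqDist a (a.1 + √s₀, a.2) ≤ 2 * r by rw [hq]; exact hs₀r.le)).2
    refine (mul_pos ?_ (neg_pos.2 hlt)).ne'
    simp only [hμdef, hq]
    exact hms₀
end
end

section
/- Let ω ∈ (0,1) and define g_ω : closure(D) → ℝ³ by g_ω(x,y) = ( (x−ω(x²+y²)) / ((1−ωx)²+(ωy)²), y / ((1−ωx)²+(ωy)²), 0 ), where D is the open unit disk in ℝ². Then: (i) each component of g_ω is harmonic in D; (ii) for every (x,y) with x²+y² = 1, g_ω(x,y) = ( (x−ω)/((x−ω)²+y²), y/((x−ω)²+y²), 0 ); and (iii) for every (x,y) ∈ D, |∇g_ω(x,y)|² + 2 |(g_ω)_x(x,y) ∧ (g_ω)_y(x,y)| = 4 / ((1−ωx)² + ω²y²)². -/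
noncomputable section

/-- The point `x + iy` of the complex plane with real coordinates `p = (x, y)`. -/
def toComplex : ℝ × ℝ →L[ℝ] ℂ := Complex.equivRealProdCLM.symm

lemma toComplex_apply (p : ℝ × ℝ) : toComplex p = ⟨p.1, p.2⟩ := rfl

/-- The real derivative of `p ↦ Re f(x + iy)` for complex differentiable `f`. -/
lemma hasFDerivAt_re_comp_toComplex {f : ℂ → ℂ} {f' : ℂ} {p : ℝ × ℝ}
    (hf : HasDerivAt f f' (toComplex p)) :
    HasFDerivAt (fun q => (f (toComplex q)).re)
      (Complex.reCLM.comp (f' • toComplex)) p := by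
  have h := Complex.reCLM.hasFDerivAt.comp p (hf.comp_hasFDerivAt p toComplex.hasFDerivAt)
  exact h

lemma pdx_re_comp_toComplex {f : ℂ → ℂ} {f' : ℂ} {p : ℝ × ℝ}
    (hf : HasDerivAt f f' (toComplex p)) :
    pdx (fun q => (f (toComplex q)).re) p = f'.re := by
  rw [pdx, (hasFDerivAt_re_comp_toComplex hf).fderiv]
  simp [toComplex_apply]

lemma pdy_re_comp_toComplex {f : ℂ → ℂ} {f' : ℂ} {p : ℝ × ℝ}
    (hf : HasDerivAt f f' (toComplex p)) :
    pdy (fun q => (f (toComplex q)).re) p = -f'.im := by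
  rw [pdy, (hasFDerivAt_re_comp_toComplex hf).fderiv]
  simp [toComplex_apply]

/-- The real part of a holomorphic function is harmonic. -/
lemma harmonicOnR_re_of_differentiableOn {f : ℂ → ℂ} {U : Set ℂ} (hU : IsOpen U)
    (hf : DifferentiableOn ℂ f U) :
    HarmonicOnR (fun q => (f (toComplex q)).re) (toComplex ⁻¹' U) := by
  refine ⟨?_, fun p hp => ?_⟩
  · have h : ContDiffOn ℝ 2 f U := (hf.contDiffOn hU).restrict_scalars ℝ
    exact Complex.reCLM.contDiff.comp_contDiffOn
      (h.comp toComplex.contDiff.contDiffOn (Set.mapsTo_preimage _ _))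
  · have hV : ∀ᶠ q in nhds p, toComplex q ∈ U :=
      (hU.preimage toComplex.continuous).mem_nhds hp
    have hd : ∀ z ∈ U, HasDerivAt f (deriv f z) z := fun z hz =>
      (hf.differentiableAt (hU.mem_nhds hz)).hasDerivAt
    have hd' : HasDerivAt (deriv f) (deriv (deriv f) (toComplex p)) (toComplex p) :=
      ((hf.deriv hU).differentiableAt (hU.mem_nhds hp)).hasDerivAt
    have hx : pdx (fun q => (f (toComplex q)).re) =ᶠ[nhds p]
        fun q => (deriv f (toComplex q)).re :=
      hV.mono fun q hq => pdx_re_comp_toComplex (hd _ hq)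
    have hy : pdy (fun q => (f (toComplex q)).re) =ᶠ[nhds p]
        fun q => (Complex.I * deriv f (toComplex q)).re :=
      hV.mono fun q hq => by simp [pdy_re_comp_toComplex (hd _ hq)]
    have hxx : pdx (pdx fun q => (f (toComplex q)).re) p = (deriv (deriv f) (toComplex p)).re := by
      rw [pdx, hx.fderiv_eq]
      exact pdx_re_comp_toComplex hd'
    have hyy : pdy (pdy fun q => (f (toComplex q)).re) p =
        -(Complex.I * deriv (deriv f) (toComplex p)).im := by
      rw [pdy, hy.fderiv_eq]
      exact pdy_re_comp_toComplex (f := fun z => Complex.I * deriv f z) (hd'.const_mul _)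
    rw [lap, hxx, hyy]
    simp

lemma HarmonicOnR.mono {f : ℝ × ℝ → ℝ} {s t : Set (ℝ × ℝ)} (hf : HarmonicOnR f t)
    (hst : s ⊆ t) : HarmonicOnR f s :=
  ⟨hf.1.mono hst, fun p hp => hf.2 p (hst hp)⟩

lemma one_sub_mul_toComplex_ne_zero {ω : ℝ} (hω : ω ∈ Set.Ioo (0 : ℝ) 1) {p : ℝ × ℝ}
    (hp : p ∈ unitDisk) : 1 - (ω : ℂ) * toComplex p ≠ 0 := by
  obtain ⟨h0, h1⟩ := hω
  have hp' : p.1 ^ 2 + p.2 ^ 2 < 1 := hp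
  intro h
  have hre := congrArg Complex.re h
  simp [toComplex_apply] at hre
  nlinarith [sq_nonneg p.2, sq_nonneg (p.1 - 1)]

lemma hasDerivAt_div_one_sub_mul {ω z : ℂ} (hz : 1 - ω * z ≠ 0) :
    HasDerivAt (fun z => z / (1 - ω * z)) (1 / (1 - ω * z) ^ 2) z := by
  have h := (hasDerivAt_id z).div (((hasDerivAt_id z).const_mul ω).const_sub 1) hz
  have he : (1 * (1 - ω * z) - z * -(ω * 1)) / (1 - ω * z) ^ 2 = 1 / (1 - ω * z) ^ 2 := by
    ring
  exact he ▸ h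

lemma re_toComplex_div (ω : ℝ) (p : ℝ × ℝ) :
    (toComplex p / (1 - ω * toComplex p)).re =
      (p.1 - ω * (p.1 ^ 2 + p.2 ^ 2)) / ((1 - ω * p.1) ^ 2 + (ω * p.2) ^ 2) := by
  simp [toComplex_apply, Complex.div_re, Complex.normSq_apply]
  rw [← add_div]
  congr 1 <;> ring

lemma im_toComplex_div (ω : ℝ) (p : ℝ × ℝ) :
    (toComplex p / (1 - ω * toComplex p)).im =
      p.2 / ((1 - ω * p.1) ^ 2 + (ω * p.2) ^ 2) := by
  simp [toComplex_apply, Complex.div_im, Complex.normSq_apply]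
  rw [← sub_div]
  congr 1 <;> ring

/-- Properties of the boundary datum `g_ω`: it is harmonic in the unit disk, it has
the stated boundary values on the unit circle, and
`|∇g_ω|² + 2|(g_ω)ₓ ∧ (g_ω)_y| = 4/((1−ωx)² + ω²y²)²` in the disk. -/
theorem statement12
    (ω : ℝ) (hω : ω ∈ Set.Ioo (0 : ℝ) 1)
    (g : ℝ × ℝ → Fin 3 → ℝ)
    (hg : ∀ p : ℝ × ℝ, g p =
      ![(p.1 - ω * (p.1 ^ 2 + p.2 ^ 2)) / ((1 - ω * p.1) ^ 2 + (ω * p.2) ^ 2),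
        p.2 / ((1 - ω * p.1) ^ 2 + (ω * p.2) ^ 2), 0]) :
    (∀ i : Fin 3, HarmonicOnR (fun p => g p i) unitDisk) ∧
    (∀ p : ℝ × ℝ, p.1 ^ 2 + p.2 ^ 2 = 1 → g p =
      ![(p.1 - ω) / ((p.1 - ω) ^ 2 + p.2 ^ 2), p.2 / ((p.1 - ω) ^ 2 + p.2 ^ 2), 0]) ∧
    (∀ p ∈ unitDisk,
      (∑ i, ((pdx g p i) ^ 2 + (pdy g p i) ^ 2)) +
        2 * Real.sqrt (∑ i, (cross3 (pdx g p) (pdy g p) i) ^ 2) =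
      4 / ((1 - ω * p.1) ^ 2 + ω ^ 2 * p.2 ^ 2) ^ 2) := by
  let F : ℂ → ℂ := fun z => z / (1 - ω * z)
  let G : ℂ → ℂ := fun z => -Complex.I * F z
  have hg0 : (fun p => g p 0) = fun p => (F (toComplex p)).re := by
    funext p
    simp [hg, F, re_toComplex_div]
  have hg1 : (fun p => g p 1) = fun p => (G (toComplex p)).re := by
    funext p
    simp [hg, F, G, im_toComplex_div]
  have hg2 : (fun p => g p 2) = fun _ => 0 := by
    funext p
    simp [hg]
  have hF : ∀ z : ℂ, 1 - (ω : ℂ) * z ≠ 0 → HasDerivAt F (1 / (1 - ω * z) ^ 2) z :=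
    fun z hz => hasDerivAt_div_one_sub_mul hz
  have hG : ∀ z : ℂ, 1 - (ω : ℂ) * z ≠ 0 →
      HasDerivAt G (-Complex.I * (1 / (1 - ω * z) ^ 2)) z :=
    fun z hz => (hF z hz).const_mul _
  refine ⟨?_, ?_, ?_⟩
  · have hU : IsOpen {z : ℂ | 1 - (ω : ℂ) * z ≠ 0} :=
      isOpen_ne_fun (by fun_prop) continuous_const
    have hsub : unitDisk ⊆ toComplex ⁻¹' {z : ℂ | 1 - (ω : ℂ) * z ≠ 0} :=
      fun p hp => one_sub_mul_toComplex_ne_zero hω hp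
    intro i
    fin_cases i
    · change HarmonicOnR (fun p => g p 0) unitDisk
      rw [hg0]
      exact (harmonicOnR_re_of_differentiableOn hU fun z hz =>
        (hF z hz).differentiableAt.differentiableWithinAt).mono hsub
    · change HarmonicOnR (fun p => g p 1) unitDisk
      rw [hg1]
      exact (harmonicOnR_re_of_differentiableOn hU fun z hz =>
        (hG z hz).differentiableAt.differentiableWithinAt).mono hsub
    · change HarmonicOnR (fun p => g p 2) unitDisk
      rw [hg2]
      refine ⟨contDiffOn_const, fun p _ => ?_⟩
      have hx : pdx (fun _ : ℝ × ℝ => (0 : ℝ)) = fun _ => 0 := by funext q; simp [pdx]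
      have hy : pdy (fun _ : ℝ × ℝ => (0 : ℝ)) = fun _ => 0 := by funext q; simp [pdy]
      simp [lap, hx, hy]
  · intro p hp
    have hq : (1 - ω * p.1) ^ 2 + (ω * p.2) ^ 2 = (p.1 - ω) ^ 2 + p.2 ^ 2 := by
      linear_combination (ω ^ 2 - 1) * hp
    rw [hg, hq, hp, mul_one]
  · intro p hp
    have hz := one_sub_mul_toComplex_ne_zero hω hp
    have hdiff : ∀ i, DifferentiableAt ℝ (fun q => g q i) p := by
      intro i
      fin_cases i
      · change DifferentiableAt ℝ (fun q => g q 0) p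
        rw [hg0]
        exact (hasFDerivAt_re_comp_toComplex (hF _ hz)).differentiableAt
      · change DifferentiableAt ℝ (fun q => g q 1) p
        rw [hg1]
        exact (hasFDerivAt_re_comp_toComplex (hG _ hz)).differentiableAt
      · change DifferentiableAt ℝ (fun q => g q 2) p
        rw [hg2]
        exact differentiableAt_const _
    have hpdx : ∀ i, pdx g p i = pdx (fun q => g q i) p := fun i => by
      simp [pdx, fderiv_apply (differentiableAt_pi.2 hdiff)]
    have hpdy : ∀ i, pdy g p i = pdy (fun q => g q i) p := fun i => by
      simp [pdy, fderiv_apply (differentiableAt_pi.2 hdiff)]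
    set w : ℂ := 1 / (1 - ω * toComplex p) ^ 2 with hw
    have hx0 : pdx g p 0 = w.re := by
      rw [hpdx, hg0, pdx_re_comp_toComplex (hF _ hz)]
    have hy0 : pdy g p 0 = -w.im := by
      rw [hpdy, hg0, pdy_re_comp_toComplex (hF _ hz)]
    have hx1 : pdx g p 1 = w.im := by
      rw [hpdx, hg1, pdx_re_comp_toComplex (hG _ hz)]
      simp [hw]
    have hy1 : pdy g p 1 = w.re := by
      rw [hpdy, hg1, pdy_re_comp_toComplex (hG _ hz)]
      simp [hw]
    have hx2 : pdx g p 2 = 0 := by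
      rw [hpdx, hg2]
      simp [pdx]
    have hy2 : pdy g p 2 = 0 := by
      rw [hpdy, hg2]
      simp [pdy]
    have hn : w.re ^ 2 + w.im ^ 2 = 1 / ((1 - ω * p.1) ^ 2 + ω ^ 2 * p.2 ^ 2) ^ 2 := by
      have h : Complex.normSq (1 - ω * toComplex p) =
          (1 - ω * p.1) ^ 2 + ω ^ 2 * p.2 ^ 2 := by
        simp [toComplex_apply, Complex.normSq_apply]
        ring
      rw [← h, ← map_pow, ← map_one Complex.normSq, ← map_div₀, ← hw, Complex.normSq_apply]
      ring
    have hc : ∑ i, (cross3 (pdx g p) (pdy g p) i) ^ 2 = (w.re ^ 2 + w.im ^ 2) ^ 2 := by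
      simp [Fin.sum_univ_three, cross3, hx0, hx1, hx2, hy0, hy1, hy2]
      ring
    rw [hc, Real.sqrt_sq (by positivity), Fin.sum_univ_three, hx0, hx1, hx2, hy0, hy1, hy2]
    linear_combination 4 * hn
end
end
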